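/- arXiv:1603.01350 — 9 statements merged into one kernel-verified Lean document; each statement's English description precedes it below -/
import Mathlib

section
/- Let h be a symmetric positive definite 2×2 real matrix, with h^{ij} denoting the entries of its inverse. Let ξ = (ξ₁, ξ₂) ∈ ℝ² be nonzero, let u = (u₁, u₂) ∈ ℝ², and set η := (1/2)·Σ_{i,j} h^{ij} u_i ξ_j. If u₁ξ₁ = η·h₁₁, u₁ξ₂ + u₂ξ₁ = 2η·h₁₂, and u₂ξ₂ = η·h₂₂, then u₁ = u₂ = 0. -/
/-- Vanishing of the principal symbol of the operator `L_h` forces `u = 0`: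
if `h` is a symmetric positive definite `2×2` matrix, `ξ ≠ 0`,
`η = (1/2) Σ h^{ij} u_i ξ_j`, and the three symbol equations hold, then `u₁ = u₂ = 0`. -/
theorem symbol_vanishing_implies_zero
    (h : Matrix (Fin 2) (Fin 2) ℝ) (hsymm : h.IsSymm) (hpd : h.PosDef)
    (ξ u : Fin 2 → ℝ) (hξ : ξ ≠ 0)
    (η : ℝ) (hη : η = (1 / 2) * ∑ i, ∑ j, h⁻¹ i j * u i * ξ j)
    (e1 : u 0 * ξ 0 = η * h 0 0)
    (e2 : u 0 * ξ 1 + u 1 * ξ 0 = 2 * η * h 0 1)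
    (e3 : u 1 * ξ 1 = η * h 1 1) :
    u 0 = 0 ∧ u 1 = 0 := by
  have hdet : 0 < h 0 0 * h 1 1 - h 0 1 * h 0 1 := by
    have hd := hpd.det_pos
    rwa [Matrix.det_fin_two, hsymm.apply 0 1] at hd
  have key : 4 * η ^ 2 * (h 0 0 * h 1 1 - h 0 1 * h 0 1) + (u 0 * ξ 1 - u 1 * ξ 0) ^ 2 = 0 := by
    linear_combination (-4 * u 1 * ξ 1) * e1 - 4 * η * h 0 0 * e3 +
      (u 0 * ξ 1 + u 1 * ξ 0 + 2 * η * h 0 1) * e2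
  have η_zero : η = 0 := by
    by_contra hne
    nlinarith [mul_pos (sq_pos_of_ne_zero hne) hdet, sq_nonneg (u 0 * ξ 1 - u 1 * ξ 0)]
  have cross : u 0 * ξ 1 - u 1 * ξ 0 = 0 := by
    simpa [η_zero] using key
  simp only [η_zero, zero_mul, mul_zero] at e1 e2 e3
  have e01 : u 0 * ξ 1 = 0 := by linarith
  have e10 : u 1 * ξ 0 = 0 := by linarith
  obtain ⟨i, hi⟩ := Function.ne_iff.mp hξ
  fin_cases i
  · exact ⟨(mul_eq_zero.mp e1).resolve_right hi, (mul_eq_zero.mp e10).resolve_right hi⟩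
  · exact ⟨(mul_eq_zero.mp e01).resolve_right hi, (mul_eq_zero.mp e3).resolve_right hi⟩
end

section
/- Let h be a symmetric positive definite 2×2 real matrix, with h^{kl} denoting the entries of its inverse, and let ξ = (ξ₁, ξ₂) ∈ ℝ² be nonzero. Define the linear map Φ : ℝ² → Sym(2×2, ℝ) by Φ(u)_{ij} = (1/2)(u_i ξ_j + u_j ξ_i) − (1/2)·(Σ_{k,l} h^{kl} u_k ξ_l)·h_{ij}. Then Φ is a linear bijection from ℝ² onto the 2-dimensional space V = { q : q symmetric 2×2 real matrix with Σ_{i,j} h^{ij} q_{ij} = 0 } of h-traceless symmetric matrices. -/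
/-- The principal symbol `Φ` of the operator `L_h` at a nonzero covector `ξ`,
`Φ(u)_{ij} = (1/2)(u_i ξ_j + u_j ξ_i) − (1/2)(Σ h^{kl} u_k ξ_l) h_{ij}`,
is a linear bijection from `ℝ²` onto the 2-dimensional space of
`h`-traceless symmetric `2×2` matrices. -/
theorem symbol_linear_bijection
    (h : Matrix (Fin 2) (Fin 2) ℝ) (hsymm : h.IsSymm) (hpd : h.PosDef)
    (ξ : Fin 2 → ℝ) (hξ : ξ ≠ 0)
    (Φ : (Fin 2 → ℝ) → Matrix (Fin 2) (Fin 2) ℝ)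
    (hΦ : ∀ (u : Fin 2 → ℝ) (i j : Fin 2),
      Φ u i j = (1 / 2) * (u i * ξ j + u j * ξ i)
        - (1 / 2) * (∑ k, ∑ l, h⁻¹ k l * u k * ξ l) * h i j) :
    (∀ u v : Fin 2 → ℝ, Φ (u + v) = Φ u + Φ v) ∧
    (∀ (c : ℝ) (u : Fin 2 → ℝ), Φ (c • u) = c • Φ u) ∧
    Function.Injective Φ ∧
    Set.range Φ
      = {q : Matrix (Fin 2) (Fin 2) ℝ | q.IsSymm ∧ ∑ i, ∑ j, h⁻¹ i j * q i j = 0} := by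
  have hb : h 1 0 = h 0 1 := hsymm.apply 0 1
  have hdet : 0 < h 0 0 * h 1 1 - h 0 1 ^ 2 := by
    have := hpd.det_pos
    rwa [Matrix.det_fin_two, hb, ← sq] at this
  have ha : 0 < h 0 0 := hpd.diag_pos
  have hinv : h⁻¹ = (h 0 0 * h 1 1 - h 0 1 ^ 2)⁻¹ • !![h 1 1, -h 0 1; -h 0 1, h 0 0] := by
    rw [Matrix.inv_def, Matrix.adjugate_fin_two, Matrix.det_fin_two, hb, ← sq, Ring.inverse_eq_inv']
  have hN : 0 < h 1 1 * ξ 0 ^ 2 - 2 * h 0 1 * ξ 0 * ξ 1 + h 0 0 * ξ 1 ^ 2 := by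
    have hfactor : h 0 0 * (h 1 1 * ξ 0 ^ 2 - 2 * h 0 1 * ξ 0 * ξ 1 + h 0 0 * ξ 1 ^ 2)
        = (h 0 0 * h 1 1 - h 0 1 ^ 2) * ξ 0 ^ 2 + (h 0 0 * ξ 1 - h 0 1 * ξ 0) ^ 2 := by
      ring
    refine pos_of_mul_pos_right (a := h 0 0) ?_ ha.le
    rw [hfactor]
    by_cases h0 : ξ 0 = 0
    · have h1 : ξ 1 ≠ 0 := fun h1 => hξ (by ext i; fin_cases i <;> assumption)
      simp only [h0]
      have : h 0 0 * ξ 1 ≠ 0 := mul_ne_zero ha.ne' h1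
      simpa using sq_pos_of_ne_zero this
    · have := mul_pos hdet (sq_pos_of_ne_zero h0)
      positivity
  simp only [hinv, Fin.sum_univ_two, Matrix.smul_apply, smul_eq_mul, Matrix.of_apply,
    Matrix.cons_val', Matrix.cons_val_zero, Matrix.cons_val_one, Matrix.cons_val_fin_one]
    at hΦ ⊢
  obtain ⟨a, ha'⟩ : ∃ a, h 0 0 = a := ⟨_, rfl⟩
  obtain ⟨b, hb'⟩ : ∃ b, h 0 1 = b := ⟨_, rfl⟩
  obtain ⟨c, hc'⟩ : ∃ c, h 1 1 = c := ⟨_, rfl⟩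
  obtain ⟨x, hx⟩ : ∃ x, ξ 0 = x := ⟨_, rfl⟩
  obtain ⟨y, hy⟩ : ∃ y, ξ 1 = y := ⟨_, rfl⟩
  have h00 := fun u => hΦ u 0 0
  have h01 := fun u => hΦ u 0 1
  have h10 := fun u => hΦ u 1 0
  have h11 := fun u => hΦ u 1 1
  simp only [hb, ha', hb', hc', hx, hy] at h00 h01 h10 h11 hdet hN ⊢
  have hD := hdet.ne'
  have hleft : ∀ u, (c * x ^ 2 - 2 * b * x * y + a * y ^ 2) * u 0
        = 2 * (Φ u 0 0 * (c * x - b * y) + Φ u 0 1 * (a * y - b * x)) ∧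
      (c * x ^ 2 - 2 * b * x * y + a * y ^ 2) * u 1
        = 2 * (Φ u 0 1 * (c * x - b * y) + Φ u 1 1 * (a * y - b * x)) := by
    intro u
    rw [h00, h01, h11]
    constructor
    · linear_combination
        x * (u 0 * (c * x - b * y) + u 1 * (a * y - b * x)) * mul_inv_cancel₀ hD
    · linear_combination
        y * (u 0 * (c * x - b * y) + u 1 * (a * y - b * x)) * mul_inv_cancel₀ hD
  refine ⟨fun u v => ?_, fun r u => ?_, fun u v huv => ?_, Set.ext fun q => ⟨?_, ?_⟩⟩
  · ext i j
    simp only [hΦ, Matrix.add_apply, Pi.add_apply]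
    ring
  · ext i j
    simp only [hΦ, Matrix.smul_apply, Pi.smul_apply, smul_eq_mul]
    ring
  · have hu := hleft u
    rw [huv] at hu
    ext i
    fin_cases i
    · exact mul_left_cancel₀ hN.ne' (hu.1.trans (hleft v).1.symm)
    · exact mul_left_cancel₀ hN.ne' (hu.2.trans (hleft v).2.symm)
  · rintro ⟨u, rfl⟩
    refine ⟨Matrix.IsSymm.ext fun i j => ?_, ?_⟩
    · rw [hΦ, hΦ, hsymm.apply i j]
      ring
    · rw [h00, h01, h10, h11]
      field_simp
      ring
  · rintro ⟨hq, htr⟩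
    have hq10 : q 1 0 = q 0 1 := hq.apply 0 1
    have htr' : c * q 0 0 - 2 * b * q 0 1 + a * q 1 1 = 0 := by
      rw [hq10] at htr
      field_simp at htr
      linarith
    have hN' := hN.ne'
    refine ⟨![2 * (q 0 0 * (c * x - b * y) + q 0 1 * (a * y - b * x))
          / (c * x ^ 2 - 2 * b * x * y + a * y ^ 2),
        2 * (q 0 1 * (c * x - b * y) + q 1 1 * (a * y - b * x))
          / (c * x ^ 2 - 2 * b * x * y + a * y ^ 2)], ?_⟩
    have key : ∀ {p r : ℝ}, (a * c - b ^ 2) * (c * x ^ 2 - 2 * b * x * y + a * y ^ 2) * p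
        = (a * c - b ^ 2) * (c * x ^ 2 - 2 * b * x * y + a * y ^ 2) * r → p = r :=
      fun H => mul_left_cancel₀ (mul_ne_zero hD hN') H
    ext i j
    fin_cases i <;> fin_cases j <;>
      simp only [Fin.zero_eta, Fin.mk_one, Fin.isValue, h00, h01, h10, h11, hq10,
        Matrix.cons_val_zero, Matrix.cons_val_one] <;> apply key
    · trans 2 * x * (q 0 0 * (c * x - b * y) + q 0 1 * (a * y - b * x)) * (a * c - b ^ 2)
        - a * (q 0 0 * (c * x - b * y) ^ 2 + 2 * q 0 1 * (c * x - b * y) * (a * y - b * x)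
          + q 1 1 * (a * y - b * x) ^ 2)
      · generalize c * x ^ 2 - 2 * b * x * y + a * y ^ 2 = N at *
        field_simp
        ring
      · linear_combination -(a * y - b * x) ^ 2 * htr'
    iterate 2
      · trans (y * (q 0 0 * (c * x - b * y) + q 0 1 * (a * y - b * x))
          + x * (q 0 1 * (c * x - b * y) + q 1 1 * (a * y - b * x))) * (a * c - b ^ 2)
          - b * (q 0 0 * (c * x - b * y) ^ 2 + 2 * q 0 1 * (c * x - b * y) * (a * y - b * x)
            + q 1 1 * (a * y - b * x) ^ 2)
        · generalize c * x ^ 2 - 2 * b * x * y + a * y ^ 2 = N at *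
          field_simp
          ring
        · linear_combination (c * x - b * y) * (a * y - b * x) * htr'
    · trans 2 * y * (q 0 1 * (c * x - b * y) + q 1 1 * (a * y - b * x)) * (a * c - b ^ 2)
        - c * (q 0 0 * (c * x - b * y) ^ 2 + 2 * q 0 1 * (c * x - b * y) * (a * y - b * x)
          + q 1 1 * (a * y - b * x) ^ 2)
      · generalize c * x ^ 2 - 2 * b * x * y + a * y ^ 2 = N at *
        field_simp
        ring
      · linear_combination -(c * x - b * y) ^ 2 * htr'
end

section
/- Let c : [0, ∞) → ℝ be a function with c(t) > 0 for all t ≥ 0, and let λ : [0, ∞) → ℝ be differentiable with λ′(t) = −λ(t)² + c(t) for all t ≥ 0 and λ(0) > 0. Then λ(t) > 0 for all t ≥ 0. -/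
/-- Riccati equation with positive inhomogeneity preserves positivity:
if `λ′(t) = −λ(t)² + c(t)` with `c > 0` on `[0, ∞)` and `λ(0) > 0`,
then `λ(t) > 0` for all `t ≥ 0`. -/
theorem riccati_positivity_preserved
    (c lam : ℝ → ℝ)
    (hc : ∀ t, 0 ≤ t → 0 < c t)
    (hderiv : ∀ t, 0 ≤ t → HasDerivAt lam (-(lam t) ^ 2 + c t) t)
    (h0 : 0 < lam 0) :
    ∀ t, 0 ≤ t → 0 < lam t := by
  have nonneg : ∀ t, 0 ≤ t → 0 ≤ lam t := fun t ht =>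
    image_le_of_deriv_right_lt_deriv_boundary' (f := fun _ => 0) (f' := fun _ => 0)
      (a := 0) (b := t) continuousOn_const (fun x _ => hasDerivWithinAt_const x _ 0) h0.le
      (fun x hx => (hderiv x hx.1).continuousAt.continuousWithinAt)
      (fun x hx => (hderiv x hx.1).hasDerivWithinAt)
      (fun x hx h => by simpa [← h] using hc x hx.1) (Set.right_mem_Icc.2 ht)
  intro t ht
  refine (nonneg t ht).lt_of_ne' fun hzero => ?_
  have tpos : 0 < t := ht.lt_of_ne' (by rintro rfl; exact h0.ne' hzero)
  have hmin : IsLocalMin lam t := by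
    filter_upwards [lt_mem_nhds tpos] with s hs
    exact hzero.trans_le (nonneg s hs.le)
  have hcrit := hmin.hasDerivAt_eq_zero (hderiv t ht)
  have := hc t ht
  simp_all
end

section
/- Let m > 0 and T > 0, and let λ : [T, ∞) → ℝ be differentiable with λ′(t) ≤ −λ(t)² + m/t³ for all t ≥ T. Then for all t ≥ T one has λ(t) ≤ 1/t + ( m·log(t/T) + T·(T·λ(T) − 1) )/t². -/
open Set in
/-- If `λ′ ≤ −λ² + m/t³` on `[T, ∞)`, then `t (t λ(t) − 1) − m log t` is nonincreasing there. -/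
theorem antitoneOn_of_riccati_le {m T : ℝ} (hT : 0 < T) {lam lam' : ℝ → ℝ}
    (hderiv : ∀ t, T ≤ t → HasDerivAt lam (lam' t) t)
    (hineq : ∀ t, T ≤ t → lam' t ≤ -(lam t) ^ 2 + m / t ^ 3) :
    AntitoneOn (fun t => t * (t * lam t - 1) - m * Real.log t) (Ici T) := by
  have hd : ∀ t, T ≤ t → HasDerivAt (fun t => t * (t * lam t - 1) - m * Real.log t)
      (1 * (t * lam t - 1) + t * (1 * lam t + t * lam' t) - m * t⁻¹) t := fun t ht =>
    ((hasDerivAt_id t).mul (((hasDerivAt_id t).mul (hderiv t ht)).sub_const 1)).sub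
      ((Real.hasDerivAt_log (hT.trans_le ht).ne').const_mul m)
  refine antitoneOn_of_hasDerivWithinAt_nonpos (convex_Ici T)
    (fun t ht => (hd t ht).continuousAt.continuousWithinAt)
    (fun t ht => (hd t (interior_subset ht)).hasDerivWithinAt) fun t ht => ?_
  have hTt : T ≤ t := interior_subset ht
  have ht0 : 0 < t := hT.trans_le hTt
  have h := mul_le_mul_of_nonneg_left (hineq t hTt) (sq_nonneg t)
  have hm : t ^ 2 * (m / t ^ 3) = m * t⁻¹ := by field_simp
  rw [mul_add, hm] at h
  linarith [sq_nonneg (t * lam t - 1)]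

/-- Riccati comparison from above: if `λ′(t) ≤ −λ(t)² + m/t³` for `t ≥ T > 0`, then
`λ(t) ≤ 1/t + (m·log(t/T) + T·(T·λ(T) − 1))/t²` for all `t ≥ T`. -/
theorem riccati_upper_bound
    (m T : ℝ) (hm : 0 < m) (hT : 0 < T) (lam lam' : ℝ → ℝ)
    (hderiv : ∀ t, T ≤ t → HasDerivAt lam (lam' t) t)
    (hineq : ∀ t, T ≤ t → lam' t ≤ -(lam t) ^ 2 + m / t ^ 3) :
    ∀ t, T ≤ t →
      lam t ≤ 1 / t + (m * Real.log (t / T) + T * (T * lam T - 1)) / t ^ 2 := by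
  intro t ht
  have ht0 : 0 < t := hT.trans_le ht
  have h := antitoneOn_of_riccati_le hT hderiv hineq Set.self_mem_Ici ht ht
  dsimp only at h
  have hsum (c : ℝ) : 1 / t + c / t ^ 2 = (t + c) / t ^ 2 := by field_simp
  rw [Real.log_div ht0.ne' hT.ne', hsum, le_div_iff₀ (by positivity)]
  linarith
end

section
/- Let m > 0 and T > 1, and let λ : [T, ∞) → ℝ be differentiable with λ(t) > 0, λ′(t) ≥ −λ(t)² + m/(4t³), and λ(t) ≤ 1/t + 2m·(log t)/t² for all t ≥ T. Then there exists T′ ≥ T such that λ(t) ≥ 1/t + (m/6)·(log t)/t² for all t ≥ T′. -/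
/-- Riccati comparison from below: if `λ > 0`, `λ′(t) ≥ −λ(t)² + m/(4t³)` and
`λ(t) ≤ 1/t + 2m·log t/t²` for `t ≥ T > 1`, then for sufficiently large `t` one has
`λ(t) ≥ 1/t + (m/6)·log t/t²`. -/
theorem riccati_lower_bound
    (m T : ℝ) (hm : 0 < m) (hT : 1 < T) (lam lam' : ℝ → ℝ)
    (hderiv : ∀ t, T ≤ t → HasDerivAt lam (lam' t) t)
    (hpos : ∀ t, T ≤ t → 0 < lam t)
    (hlow : ∀ t, T ≤ t → -(lam t) ^ 2 + m / (4 * t ^ 3) ≤ lam' t)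
    (hup : ∀ t, T ≤ t → lam t ≤ 1 / t + 2 * m * Real.log t / t ^ 2) :
    ∃ T', T ≤ T' ∧ ∀ t, T' ≤ t →
      1 / t + (m / 6) * Real.log t / t ^ 2 ≤ lam t := by
  have hlog : ∀ᶠ t : ℝ in Filter.atTop, Real.log t ≤ 1 / (20 * m) * t := by
    have h := Real.isLittleO_log_id_atTop.bound (show 0 < 1 / (20 * m) by positivity)
    filter_upwards [h, Filter.eventually_ge_atTop 1] with t ht h1
    rw [Real.norm_eq_abs, Real.norm_eq_abs, id, abs_of_nonneg (by linarith : 0 ≤ t)] at ht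
    exact (le_abs_self _).trans ht
  obtain ⟨S, hS⟩ := Filter.eventually_atTop.1 hlog
  set T₁ := max S T
  set f : ℝ → ℝ := fun t => (lam t)⁻¹ - t + m / 5 * Real.log t
  have hf : ∀ t, T ≤ t → HasDerivAt f (-lam' t / lam t ^ 2 - 1 + m / 5 * t⁻¹) t := fun t ht =>
    (((hderiv t ht).inv (hpos t ht).ne').sub (hasDerivAt_id t)).add
      ((Real.hasDerivAt_log (by linarith)).const_mul (m / 5))
  have hanti : AntitoneOn f (Set.Ici T₁) := by
    refine antitoneOn_of_hasDerivWithinAt_nonpos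
      (f' := fun t => -lam' t / lam t ^ 2 - 1 + m / 5 * t⁻¹) (convex_Ici T₁)
      (fun t ht => (hf t ((le_max_right S T).trans ht)).continuousAt.continuousWithinAt)
      (fun t ht => (hf t ((le_max_right S T).trans (interior_subset ht))).hasDerivWithinAt)
      fun t ht => ?_
    have ht₁ : T₁ ≤ t := interior_subset ht
    have htT : T ≤ t := (le_max_right S T).trans ht₁
    have ht0 : 0 < t := by linarith
    have hl := hpos t htT
    have htl : t * lam t ≤ 11 / 10 := by
      have h1 : t * lam t ≤ 1 + 2 * m * Real.log t / t :=
        (mul_le_mul_of_nonneg_left (hup t htT) ht0.le).trans_eq (by field_simp)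
      have h2 : 2 * m * Real.log t / t ≤ 1 / 10 := by
        rw [div_le_iff₀ ht0]
        calc 2 * m * Real.log t ≤ 2 * m * (1 / (20 * m) * t) := by
              gcongr
              exact hS t ((le_max_left S T).trans ht₁)
          _ = 1 / 10 * t := by field_simp; norm_num
      linarith
    have hsq : (t * lam t) ^ 2 ≤ 5 / 4 := by
      nlinarith [mul_pos ht0 hl]
    have hcmp : m / 5 * t⁻¹ * lam t ^ 2 ≤ m / (4 * t ^ 3) := by
      rw [le_div_iff₀ (by positivity)]
      calc m / 5 * t⁻¹ * lam t ^ 2 * (4 * t ^ 3) = 4 * m / 5 * (t * lam t) ^ 2 := by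
            field_simp
        _ ≤ 4 * m / 5 * (5 / 4) := by gcongr
        _ = m := by ring
    have hdiv : -lam' t / lam t ^ 2 ≤ 1 - m / 5 * t⁻¹ := by
      rw [div_le_iff₀ (by positivity)]
      linarith [hlow t htT]
    linarith
  obtain ⟨R, hR⟩ := Filter.eventually_atTop.1
    (Real.tendsto_log_atTop.eventually_ge_atTop (30 * f T₁ / m))
  refine ⟨max T₁ R, (le_max_right S T).trans (le_max_left _ _), fun t ht => ?_⟩
  have ht₁ : T₁ ≤ t := (le_max_left _ _).trans ht
  have htT : T ≤ t := (le_max_right S T).trans ht₁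
  have ht0 : 0 < t := by linarith
  have hl := hpos t htT
  have hft : (lam t)⁻¹ - t + m / 5 * Real.log t ≤ f T₁ :=
    hanti Set.self_mem_Ici ht₁ ht₁
  have hC := hR t ((le_max_right _ _).trans ht)
  rw [div_le_iff₀ hm] at hC
  obtain ⟨a, ha⟩ : ∃ a, a = m / 6 * Real.log t := ⟨_, rfl⟩
  have ha0 : 0 ≤ a := ha ▸ mul_nonneg (by positivity) (Real.log_nonneg (by linarith))
  have hinv : (lam t)⁻¹ ≤ t - a := by rw [ha]; linarith
  have hone : 1 ≤ (t - a) * lam t := (inv_le_iff_one_le_mul₀ hl).1 hinv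
  rw [← ha]
  calc 1 / t + a / t ^ 2 = (t + a) / t ^ 2 := by field_simp
    _ ≤ lam t := by
      rw [div_le_iff₀ (by positivity)]
      nlinarith [mul_le_mul_of_nonneg_left hone (by linarith : 0 ≤ t + a),
        mul_nonneg (sq_nonneg a) hl.le]
end

section
/- Let U be an open subset of ℝᵏ, let x₀ : U → ℝ be differentiable with x₀(p) ≠ 0 for all p ∈ U, and let r̄, A : U → ℝⁿ be differentiable (ℝⁿ with its Euclidean inner product ⟨·,·⟩). Then for every p ∈ U and every direction v ∈ ℝᵏ, writing D_v for the directional derivative at p: ⟨D_v r̄, D_v A⟩ − (D_v x₀)·D_v(⟨A, r̄⟩/x₀) = x₀(p)² · ⟨ D_v(r̄/x₀), D_v(A/x₀) ⟩. -/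
open scoped RealInnerProductSpace

/-- The Beltrami-map identity: for differentiable `x₀ : U → ℝ` (nonvanishing on `U`) and
`r̄, A : U → ℝⁿ`, at every `p ∈ U` and direction `v`:
`⟨D_v r̄, D_v A⟩ − (D_v x₀)·D_v(⟨A, r̄⟩/x₀) = x₀(p)²·⟨D_v(r̄/x₀), D_v(A/x₀)⟩`. -/
theorem beltrami_pairing_identity
    (k n : ℕ) (U : Set (EuclideanSpace ℝ (Fin k))) (hU : IsOpen U)
    (x₀ : EuclideanSpace ℝ (Fin k) → ℝ)
    (rbar A : EuclideanSpace ℝ (Fin k) → EuclideanSpace ℝ (Fin n))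
    (hx₀ : ∀ p ∈ U, DifferentiableAt ℝ x₀ p)
    (hx₀ne : ∀ p ∈ U, x₀ p ≠ 0)
    (hrbar : ∀ p ∈ U, DifferentiableAt ℝ rbar p)
    (hA : ∀ p ∈ U, DifferentiableAt ℝ A p) :
    ∀ p ∈ U, ∀ v : EuclideanSpace ℝ (Fin k),
      ⟪fderiv ℝ rbar p v, fderiv ℝ A p v⟫
        - (fderiv ℝ x₀ p v) * (fderiv ℝ (fun q => ⟪A q, rbar q⟫ / x₀ q) p v)
      = (x₀ p) ^ 2 *
          ⟪fderiv ℝ (fun q => (x₀ q)⁻¹ • rbar q) p v,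
            fderiv ℝ (fun q => (x₀ q)⁻¹ • A q) p v⟫ := by
  intro p hp v
  have hne := hx₀ne p hp
  have hinv : HasFDerivAt (fun q => (x₀ q)⁻¹) (-(x₀ p ^ 2)⁻¹ • fderiv ℝ x₀ p) p :=
    (hasDerivAt_inv hne).comp_hasFDerivAt p (hx₀ p hp).hasFDerivAt
  have hr := (hrbar p hp).hasFDerivAt
  have ha := (hA p hp).hasFDerivAt
  simp only [div_eq_mul_inv]
  rw [((ha.inner ℝ hr).fun_mul hinv).fderiv, (hinv.fun_smul hr).fderiv, (hinv.fun_smul ha).fderiv]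
  simp only [add_apply, smul_apply,
    ContinuousLinearMap.smulRight_apply, ContinuousLinearMap.comp_apply,
    ContinuousLinearMap.prod_apply, fderivInnerCLM_apply, smul_eq_mul,
    inner_add_left, inner_add_right, real_inner_smul_left, real_inner_smul_right]
  rw [real_inner_comm (A p) (rbar p), real_inner_comm (A p) (fderiv ℝ rbar p v),
    real_inner_comm (fderiv ℝ A p v) (rbar p)]
  field_simp
  ring
end

section
/- Let S² be the unit 2-sphere as a smooth manifold, and let r : S² → ℝ³ be a smooth immersion admitting a smooth unit normal ν : S² → ℝ³ (i.e. ‖ν(p)‖ = 1 and ⟨ν(p), dr_p(v)⟩ = 0 for every p and every tangent vector v at p) that is strictly convex in the sense that ⟨dν_p(v), dr_p(v)⟩ > 0 for every p and every nonzero tangent vector v at p. Let τ : S² → ℝ³ be a smooth map satisfying the linearized isometry (infinitesimal rigidity) equation ⟨dr_p(v), dτ_p(w)⟩ + ⟨dr_p(w), dτ_p(v)⟩ = 0 for all p ∈ S² and all tangent vectors v, w at p. Then there exist constant vectors A, B ∈ ℝ³ such that τ(p) = A × r(p) + B for all p ∈ S², where × is the Euclidean cross product. -/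
open scoped RealInnerProductSpace Manifold

/-- The tangent spaces of the Euclidean model carry the Euclidean inner product. -/
noncomputable instance tangentSpaceInner {n : ℕ} (x : EuclideanSpace ℝ (Fin n)) :
    Inner ℝ (TangentSpace 𝓘(ℝ, EuclideanSpace ℝ (Fin n)) x) :=
  inferInstanceAs (Inner ℝ (EuclideanSpace ℝ (Fin n)))

/-- The Euclidean cross product of two vectors of `ℝ³`, regarded as elements of
`EuclideanSpace ℝ (Fin 3)`. -/
noncomputable def cross3 (a b : EuclideanSpace ℝ (Fin 3)) : EuclideanSpace ℝ (Fin 3) :=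
  (WithLp.equiv 2 (Fin 3 → ℝ)).symm
    (crossProduct ((WithLp.equiv 2 (Fin 3 → ℝ)) a) ((WithLp.equiv 2 (Fin 3 → ℝ)) b))

open scoped ContDiff
open Filter Topology Asymptotics

/-- The derivative of a map on the plane in the direction of the `i`-th coordinate. -/
noncomputable def partialDeriv {V : Type*} [NormedAddCommGroup V] [NormedSpace ℝ V] (i : Fin 2)
    (F : EuclideanSpace ℝ (Fin 2) → V) (x : EuclideanSpace ℝ (Fin 2)) : V :=
  fderiv ℝ F x (EuclideanSpace.single i 1)

section partialDeriv

variable {V W Z : Type*} [NormedAddCommGroup V] [NormedSpace ℝ V]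
  [NormedAddCommGroup W] [NormedSpace ℝ W] [NormedAddCommGroup Z] [NormedSpace ℝ Z]

theorem ContDiff.partialDeriv_of_le {F : EuclideanSpace ℝ (Fin 2) → V} {n m : ℕ∞ω}
    (hF : ContDiff ℝ n F) (hmn : m + 1 ≤ n) (i : Fin 2) :
    ContDiff ℝ m (partialDeriv i F) :=
  (hF.fderiv_right hmn).clm_apply contDiff_const

theorem fderiv_apply_eq_partialDeriv (F : EuclideanSpace ℝ (Fin 2) → V)
    (x v : EuclideanSpace ℝ (Fin 2)) :
    fderiv ℝ F x v = v 0 • partialDeriv 0 F x + v 1 • partialDeriv 1 F x := by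
  have hv : v = v 0 • EuclideanSpace.single 0 (1 : ℝ) + v 1 • EuclideanSpace.single 1 (1 : ℝ) := by
    ext i
    fin_cases i <;> simp
  conv_lhs => rw [hv]
  simp [partialDeriv]

theorem fderiv_eq_zero_of_partialDeriv_eq_zero {F : EuclideanSpace ℝ (Fin 2) → V}
    {x : EuclideanSpace ℝ (Fin 2)} (h : ∀ i, partialDeriv i F x = 0) : fderiv ℝ F x = 0 := by
  ext1 v
  simp [fderiv_apply_eq_partialDeriv, h]

theorem partialDeriv_comm {F : EuclideanSpace ℝ (Fin 2) → V} (hF : ContDiff ℝ 2 F)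
    (i j : Fin 2) (x : EuclideanSpace ℝ (Fin 2)) :
    partialDeriv i (partialDeriv j F) x = partialDeriv j (partialDeriv i F) x := by
  have hd : DifferentiableAt ℝ (fderiv ℝ F) x :=
    ((hF.fderiv_right (m := 1) (by norm_num)).differentiable (by norm_num)).differentiableAt
  have key : ∀ a b : Fin 2, partialDeriv a (partialDeriv b F) x =
      fderiv ℝ (fderiv ℝ F) x (EuclideanSpace.single a 1) (EuclideanSpace.single b 1) := by
    intro a b
    change fderiv ℝ (fun y => fderiv ℝ F y (EuclideanSpace.single b (1 : ℝ))) x _ = _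
    rw [fderiv_clm_apply hd (differentiableAt_const _)]
    simp
  rw [key, key]
  exact hF.contDiffAt.isSymmSndFDerivAt (by simp) _ _

theorem partialDeriv_bilinear (B : V →L[ℝ] W →L[ℝ] Z) {F : EuclideanSpace ℝ (Fin 2) → V}
    {G : EuclideanSpace ℝ (Fin 2) → W} {x : EuclideanSpace ℝ (Fin 2)}
    (hF : DifferentiableAt ℝ F x) (hG : DifferentiableAt ℝ G x) (i : Fin 2) :
    partialDeriv i (fun y => B (F y) (G y)) x =
      B (F x) (partialDeriv i G x) + B (partialDeriv i F x) (G x) := by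
  simp [partialDeriv, B.fderiv_of_bilinear hF hG]

theorem partialDeriv_inner {V : Type*} [NormedAddCommGroup V] [InnerProductSpace ℝ V]
    {F G : EuclideanSpace ℝ (Fin 2) → V} {x : EuclideanSpace ℝ (Fin 2)}
    (hF : DifferentiableAt ℝ F x) (hG : DifferentiableAt ℝ G x) (i : Fin 2) :
    partialDeriv i (fun y => ⟪F y, G y⟫) x =
      ⟪partialDeriv i F x, G x⟫ + ⟪F x, partialDeriv i G x⟫ := by
  simp only [partialDeriv, fderiv_inner_apply ℝ hF hG]
  rw [add_comm]

end partialDeriv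

section MaximumPrinciple

variable {f : EuclideanSpace ℝ (Fin 2) → ℝ} {x : EuclideanSpace ℝ (Fin 2)}

theorem IsLocalMax.partialDeriv_eq_zero (h : IsLocalMax f x) (i : Fin 2) :
    partialDeriv i f x = 0 := by
  simp [partialDeriv, h.fderiv_eq_zero]

/-- A real function of one variable has nonpositive second derivative at a local maximum. -/
theorem IsLocalMax.deriv_deriv_nonpos {g : ℝ → ℝ} {a : ℝ} (h : IsLocalMax g a)
    (hg : ContinuousAt g a) : deriv (deriv g) a ≤ 0 := by
  by_contra! hpos
  have hmin := isLocalMin_of_deriv_deriv_pos hpos h.deriv_eq_zero hg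
  have hc : g =ᶠ[𝓝 a] fun _ => g a := by
    filter_upwards [h, hmin] with y h1 h2 using le_antisymm h1 h2
  have := hc.deriv.deriv_eq
  simp at this
  linarith

theorem IsLocalMax.hessian_nonpos (h : IsLocalMax f x) (hf : ContDiff ℝ 2 f) (a b : ℝ) :
    a ^ 2 * partialDeriv 0 (partialDeriv 0 f) x + 2 * a * b * partialDeriv 0 (partialDeriv 1 f) x +
      b ^ 2 * partialDeriv 1 (partialDeriv 1 f) x ≤ 0 := by
  set v : EuclideanSpace ℝ (Fin 2) := !₂[a, b] with hv
  set ℓ : ℝ → EuclideanSpace ℝ (Fin 2) := fun t => x + t • v with hℓ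
  have hℓd : ∀ t, HasDerivAt ℓ v t := by
    intro t
    have := ((hasDerivAt_id t).smul_const v).const_add x
    rwa [one_smul] at this
  have hℓ0 : ℓ 0 = x := by simp [hℓ]
  have hℓc : Continuous ℓ := by fun_prop
  have hcomp : ∀ {F : EuclideanSpace ℝ (Fin 2) → ℝ}, ContDiff ℝ 1 F → ∀ t,
      HasDerivAt (fun s => F (ℓ s))
        (a * partialDeriv 0 F (ℓ t) + b * partialDeriv 1 F (ℓ t)) t := by
    intro F hF t
    have := ((hF.differentiable (by norm_num)) (ℓ t)).hasFDerivAt.comp_hasDerivAt t (hℓd t)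
    rw [fderiv_apply_eq_partialDeriv] at this
    exact this
  have hp : ∀ i, ContDiff ℝ 1 (partialDeriv i f) := fun i => hf.partialDeriv_of_le (by norm_num) i
  have hd1 : deriv (fun s => f (ℓ s)) =
      fun t => a * partialDeriv 0 f (ℓ t) + b * partialDeriv 1 f (ℓ t) :=
    funext fun t => (hcomp (hf.of_le (by norm_num)) t).deriv
  have hd2 := (((hcomp (hp 0) 0).const_mul a).add ((hcomp (hp 1) 0).const_mul b)).deriv
  have hmax : IsLocalMax (fun s => f (ℓ s)) 0 := by
    have : Tendsto ℓ (𝓝 0) (𝓝 x) := hℓ0 ▸ hℓc.tendsto 0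
    have h' := this.eventually h
    simpa only [IsLocalMax, IsMaxFilter, hℓ0] using h'
  have hn := hmax.deriv_deriv_nonpos (hf.continuous.comp hℓc).continuousAt
  rw [hd1] at hn
  have hd2' : deriv (fun t => a * partialDeriv 0 f (ℓ t) + b * partialDeriv 1 f (ℓ t)) 0 = _ := hd2
  rw [hd2', hℓ0, partialDeriv_comm hf 1 0] at hn
  linarith

/-- At a local maximum, the contraction of the Hessian with a positive definite form is
nonpositive. -/
theorem IsLocalMax.trace_hessian_nonpos (h : IsLocalMax f x) (hf : ContDiff ℝ 2 f)
    {a b c : ℝ} (ha : 0 < a) (hdet : 0 < a * c - b ^ 2) :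
    a * partialDeriv 0 (partialDeriv 0 f) x + 2 * b * partialDeriv 0 (partialDeriv 1 f) x +
      c * partialDeriv 1 (partialDeriv 1 f) x ≤ 0 := by
  have h1 := h.hessian_nonpos hf a b
  have h2 := h.hessian_nonpos hf 0 1
  have h3 : (a * c - b ^ 2) * partialDeriv 1 (partialDeriv 1 f) x ≤ 0 :=
    mul_nonpos_of_nonneg_of_nonpos hdet.le (by linarith)
  refine le_of_mul_le_mul_left ?_ ha
  linarith

end MaximumPrinciple

section Barrier

theorem partialDeriv_mul {F G : EuclideanSpace ℝ (Fin 2) → ℝ} {x : EuclideanSpace ℝ (Fin 2)}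
    (hF : DifferentiableAt ℝ F x) (hG : DifferentiableAt ℝ G x) (i : Fin 2) :
    partialDeriv i (fun y => F y * G y) x =
      F x * partialDeriv i G x + partialDeriv i F x * G x :=
  partialDeriv_bilinear (ContinuousLinearMap.mul ℝ ℝ) hF hG i

theorem partialDeriv_add_const_mul {F G : EuclideanSpace ℝ (Fin 2) → ℝ}
    {x : EuclideanSpace ℝ (Fin 2)} (hF : DifferentiableAt ℝ F x) (hG : DifferentiableAt ℝ G x)
    (ε : ℝ) (i : Fin 2) :
    partialDeriv i (fun y => F y + ε * G y) x =
      partialDeriv i F x + ε * partialDeriv i G x := by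
  simp only [partialDeriv]
  rw [fderiv_fun_add hF (hG.const_mul ε), fderiv_const_mul hG]
  simp

theorem contDiff_gaussian (α : ℝ) (c : EuclideanSpace ℝ (Fin 2)) :
    ContDiff ℝ 2 (fun x => Real.exp (-α * ‖x - c‖ ^ 2)) := by
  have : ContDiff ℝ 2 (fun x => ‖x - c‖ ^ 2) := (contDiff_id.sub contDiff_const).norm_sq ℝ
  exact (contDiff_const.mul this).exp

theorem partialDeriv_gaussian (α : ℝ) (c : EuclideanSpace ℝ (Fin 2)) (i : Fin 2) :
    partialDeriv i (fun x => Real.exp (-α * ‖x - c‖ ^ 2)) =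
      fun x => -2 * α * (x i - c i) * Real.exp (-α * ‖x - c‖ ^ 2) := by
  funext x
  have h1 : HasFDerivAt (fun x : EuclideanSpace ℝ (Fin 2) => ‖x - c‖ ^ 2) _ x :=
    ((hasFDerivAt_id x).sub_const c).norm_sq
  have h2 := (h1.const_mul (-α)).exp
  rw [partialDeriv, h2.fderiv]
  simp [EuclideanSpace.inner_single_right]
  ring

theorem partialDeriv_coord_sub (c : EuclideanSpace ℝ (Fin 2)) (k : ℝ) (i j : Fin 2)
    (x : EuclideanSpace ℝ (Fin 2)) :
    DifferentiableAt ℝ (fun x : EuclideanSpace ℝ (Fin 2) => k * (x j - c j)) x ∧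
    partialDeriv i (fun x => k * (x j - c j)) x = if i = j then k else 0 := by
  have h : HasFDerivAt (fun x : EuclideanSpace ℝ (Fin 2) => k * (x j - c j)) _ x :=
    (((EuclideanSpace.proj (𝕜 := ℝ) j : EuclideanSpace ℝ (Fin 2) →L[ℝ] ℝ).hasFDerivAt
      (x := x)).sub_const (c j)).const_mul k
  refine ⟨h.differentiableAt, ?_⟩
  rw [partialDeriv, h.fderiv]
  simp [eq_comm]

theorem partialDeriv_partialDeriv_gaussian (α : ℝ) (c : EuclideanSpace ℝ (Fin 2)) (i j : Fin 2)
    (x : EuclideanSpace ℝ (Fin 2)) :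
    partialDeriv i (partialDeriv j (fun x => Real.exp (-α * ‖x - c‖ ^ 2))) x =
      (4 * α ^ 2 * (x i - c i) * (x j - c j) - if i = j then 2 * α else 0) *
        Real.exp (-α * ‖x - c‖ ^ 2) := by
  obtain ⟨hd, hp⟩ := partialDeriv_coord_sub c (-2 * α) i j x
  rw [partialDeriv_gaussian, partialDeriv_mul hd
    ((contDiff_gaussian α c).differentiable (by norm_num)).differentiableAt, hp,
    partialDeriv_gaussian]
  split_ifs <;> ring

variable {f a b c : EuclideanSpace ℝ (Fin 2) → ℝ} {s : Set (EuclideanSpace ℝ (Fin 2))}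
  {θ A C : ℝ}

/-- Adding a sufficiently steep Gaussian to a subsolution of an elliptic inequality destroys its
local maxima away from the centre of the Gaussian. -/
theorem exists_forall_not_isLocalMax_add_gaussian (hf : ContDiff ℝ 2 f) (hθ : 0 < θ) (hC : 0 ≤ C)
    (hell : ∀ x ∈ s, ∀ u v : ℝ,
      θ * (u ^ 2 + v ^ 2) ≤ a x * u ^ 2 + 2 * b x * u * v + c x * v ^ 2)
    (htr : ∀ x ∈ s, a x + c x ≤ A)
    (hsub : ∀ x ∈ s, -(C * (|partialDeriv 0 f x| + |partialDeriv 1 f x|)) ≤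
      a x * partialDeriv 0 (partialDeriv 0 f) x + 2 * b x * partialDeriv 0 (partialDeriv 1 f) x +
        c x * partialDeriv 1 (partialDeriv 1 f) x)
    {d : ℝ} (hd : 0 < d) :
    ∃ α > 0, ∀ y ∈ s, ∀ z : EuclideanSpace ℝ (Fin 2), d ≤ ‖y - z‖ → ∀ ε > 0,
      ¬ IsLocalMax (fun x => f x + ε * Real.exp (-α * ‖x - z‖ ^ 2)) y := by
  obtain ⟨α, hα⟩ : ∃ α, α = (C + (|A| + C + 1) / d ^ 2) / (2 * θ) := ⟨_, rfl⟩
  have hα0 : 0 < α := by rw [hα]; positivity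
  have hα2 : 2 * α * θ = C + (|A| + C + 1) / d ^ 2 := by rw [hα]; field_simp
  refine ⟨α, hα0, fun y hy z hyz ε hε hmax => ?_⟩
  have hg := contDiff_gaussian α z
  set g := fun x : EuclideanSpace ℝ (Fin 2) => Real.exp (-α * ‖x - z‖ ^ 2) with hgdef
  have hgy : 0 < g y := Real.exp_pos _
  have hfg : ContDiff ℝ 2 (fun x => f x + ε * g x) := hf.add (contDiff_const.mul hg)
  have hp : ∀ i, partialDeriv i (fun x => f x + ε * g x) =
      fun x => partialDeriv i f x + ε * partialDeriv i g x := fun i => funext fun x =>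
    partialDeriv_add_const_mul (hf.differentiable (by norm_num)).differentiableAt
      (hg.differentiable (by norm_num)).differentiableAt ε i
  have hpp : ∀ i j, partialDeriv i (partialDeriv j (fun x => f x + ε * g x)) y =
      partialDeriv i (partialDeriv j f) y + ε * partialDeriv i (partialDeriv j g) y := by
    intro i j
    rw [hp]
    exact partialDeriv_add_const_mul
      ((hf.partialDeriv_of_le (m := 1) (by norm_num) j).differentiable
        (by norm_num)).differentiableAt
      ((hg.partialDeriv_of_le (m := 1) (by norm_num) j).differentiable
        (by norm_num)).differentiableAt ε i
  have ha : θ ≤ a y := by simpa using hell y hy 1 0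
  have hdet : 0 < a y * c y - b y ^ 2 := by
    have h1 := hell y hy (b y) (-a y)
    have h2 : 0 < a y := hθ.trans_le ha
    have h3 : 0 < θ * (b y ^ 2 + (-a y) ^ 2) :=
      mul_pos hθ (add_pos_of_nonneg_of_pos (sq_nonneg _) (by rw [neg_sq]; positivity))
    refine pos_of_mul_pos_right (a := a y) ?_ h2.le
    nlinarith
  have htrace := hmax.trace_hessian_nonpos hfg (hθ.trans_le ha) hdet
  rw [hpp, hpp, hpp] at htrace
  have hgrad : ∀ i, |partialDeriv i f y| = ε * (2 * α * |y i - z i| * g y) := by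
    intro i
    have h := hmax.partialDeriv_eq_zero i
    rw [hp] at h
    have h' : partialDeriv i f y = ε * (2 * α * (y i - z i) * g y) := by
      have h2 := congrFun (partialDeriv_gaussian α z i) y
      simp only at h h2
      rw [h2] at h
      simp only [hgdef]
      linarith
    rw [h', abs_mul, abs_mul, abs_mul, abs_mul, abs_of_pos hε, abs_of_pos hgy, abs_of_pos hα0,
      abs_of_pos (by norm_num : (0 : ℝ) < 2)]
  have hs := hsub y hy
  rw [hgrad, hgrad] at hs
  rw [partialDeriv_partialDeriv_gaussian, partialDeriv_partialDeriv_gaussian,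
    partialDeriv_partialDeriv_gaussian] at htrace
  rw [show Real.exp (-α * ‖y - z‖ ^ 2) = g y from rfl] at htrace
  simp only [if_true, zero_ne_one, if_false] at htrace
  set p := y 0 - z 0
  set q := y 1 - z 1
  have hn : d ^ 2 ≤ p ^ 2 + q ^ 2 := by
    have : ‖y - z‖ ^ 2 = p ^ 2 + q ^ 2 := by
      rw [EuclideanSpace.real_norm_sq_eq, Fin.sum_univ_two]; rfl
    rw [← this]
    gcongr
  have hpq : |p| + |q| ≤ 1 + (p ^ 2 + q ^ 2) := by
    rw [← sq_abs p, ← sq_abs q]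
    nlinarith [sq_nonneg (|p| - 1), sq_nonneg (|q| - 1)]
  have hquad := hell y hy p q
  have h1 : |A| + C + 1 ≤ (|A| + C + 1) / d ^ 2 * (p ^ 2 + q ^ 2) := by
    rw [div_mul_eq_mul_div, le_div_iff₀ (by positivity)]
    gcongr
  have h2 : A + C * (|p| + |q|) < 2 * α * (θ * (p ^ 2 + q ^ 2)) := by
    have : C * (|p| + |q|) ≤ C * (1 + (p ^ 2 + q ^ 2)) := by gcongr
    have h3 : 2 * α * (θ * (p ^ 2 + q ^ 2)) =
      (C + (|A| + C + 1) / d ^ 2) * (p ^ 2 + q ^ 2) := by rw [← hα2]; ring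
    rw [h3]
    linarith [le_abs_self A]
  have h4 : 0 < 2 * α * (a y * p ^ 2 + 2 * b y * p * q + c y * q ^ 2) - (a y + c y) -
      C * (|p| + |q|) := by
    have := mul_le_mul_of_nonneg_left hquad (by positivity : 0 ≤ 2 * α)
    linarith [htr y hy]
  have h5 : 0 < ε * (2 * α * g y) := by positivity
  have h6 := mul_pos h5 h4
  linarith

/-- **Strong maximum principle** for subsolutions of an elliptic inequality in the plane: near a
point where the maximum is attained, the function is constant. -/
theorem eventually_eq_of_forall_le_of_elliptic (hf : ContDiff ℝ 2 f) (hθ : 0 < θ) (hC : 0 ≤ C)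
    {x₀ : EuclideanSpace ℝ (Fin 2)} {ρ : ℝ} (hρ : 0 < ρ)
    (hell : ∀ x ∈ Metric.ball x₀ ρ, ∀ u v : ℝ,
      θ * (u ^ 2 + v ^ 2) ≤ a x * u ^ 2 + 2 * b x * u * v + c x * v ^ 2)
    (htr : ∀ x ∈ Metric.ball x₀ ρ, a x + c x ≤ A)
    (hsub : ∀ x ∈ Metric.ball x₀ ρ, -(C * (|partialDeriv 0 f x| + |partialDeriv 1 f x|)) ≤
      a x * partialDeriv 0 (partialDeriv 0 f) x + 2 * b x * partialDeriv 0 (partialDeriv 1 f) x +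
        c x * partialDeriv 1 (partialDeriv 1 f) x)
    (hmax : ∀ x ∈ Metric.ball x₀ ρ, f x ≤ f x₀) :
    ∀ᶠ x in 𝓝 x₀, f x = f x₀ := by
  filter_upwards [Metric.ball_mem_nhds x₀ (show 0 < ρ / 4 by positivity)] with x₁ hx₁
  by_contra hne
  have hd₁ : dist x₀ x₁ < ρ / 4 := by rwa [dist_comm]
  -- a contact point `x₂` of the set of maximum points, nearest to `x₁`
  have hZ : IsCompact (Metric.closedBall x₁ (dist x₀ x₁) ∩ {x | f x = f x₀}) :=
    (isCompact_closedBall _ _).inter_right (isClosed_eq hf.continuous continuous_const)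
  obtain ⟨x₂, ⟨hx₂b, hx₂⟩, hx₂min⟩ := hZ.exists_isMinOn ⟨x₀, by simp, rfl⟩
    (f := fun x => dist x x₁) (by fun_prop)
  simp only [Metric.mem_closedBall, Set.mem_ofPred_eq] at hx₂b hx₂
  set R := dist x₂ x₁ with hR
  have hRpos : 0 < R := by
    refine dist_pos.2 fun h => hne ?_
    rw [← h, hx₂]
  have hlt : ∀ x, dist x x₁ < R → f x < f x₀ := by
    intro x hx
    have hxb : dist x x₁ ≤ dist x₀ x₁ := hx.le.trans hx₂b
    refine lt_of_le_of_ne (hmax x ?_) fun h => ?_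
    · rw [Metric.mem_ball]
      linarith [dist_triangle x x₁ x₀, dist_comm x₁ x₀]
    · exact absurd (hx₂min ⟨hxb, h⟩) (not_le.2 hx)
  set z := midpoint ℝ x₁ x₂ with hz
  have hzx₂ : dist x₂ z = R / 2 := by
    rw [hz, dist_right_midpoint, dist_comm x₁ x₂]
    simp; ring
  have hlt' : ∀ x, dist x z ≤ R / 2 → x ≠ x₂ → f x < f x₀ := by
    intro x hx hxne
    refine hlt x ?_
    have h1 := parallelogram_law_with_norm ℝ (x - z) (z - x₁)
    have h2 : z - x₁ = x₂ - z := by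
      rw [hz]; simp [midpoint_eq_smul_add, smul_add, sub_eq_iff_eq_add]; module
    have h3 : x - z - (z - x₁) = x - x₂ := by rw [h2]; abel
    have h4 : ‖x - z‖ ≤ R / 2 := by rwa [← dist_eq_norm]
    have h5 : ‖z - x₁‖ = R / 2 := by rw [h2, ← dist_eq_norm, hzx₂]
    have h6 : 0 < ‖x - x₂‖ := norm_pos_iff.2 (sub_ne_zero.2 hxne)
    rw [h3, h5, sub_add_sub_cancel] at h1
    rw [dist_eq_norm]
    have h7 := norm_nonneg (x - z)
    refine lt_of_pow_lt_pow_left₀ 2 hRpos.le ?_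
    nlinarith
  set δ := R / 4 with hδ
  have hδpos : 0 < δ := by positivity
  have hRρ : R < ρ / 4 := lt_of_le_of_lt hx₂b hd₁
  have hsubset : Metric.closedBall x₂ δ ⊆ Metric.ball x₀ ρ := by
    intro x hx
    rw [Metric.mem_closedBall] at hx
    rw [Metric.mem_ball]
    linarith [dist_triangle x x₂ x₀, dist_triangle x₂ x₁ x₀, dist_comm x₁ x₀]
  obtain ⟨α, hα, hbar⟩ := exists_forall_not_isLocalMax_add_gaussian hf hθ hC hell htr hsub hδpos
  obtain ⟨η, hη, hηf⟩ : ∃ η > 0, ∀ x ∈ Metric.sphere x₂ δ ∩ Metric.closedBall z (R / 2),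
      f x + η ≤ f x₀ := by
    have hK : IsCompact (Metric.sphere x₂ δ ∩ Metric.closedBall z (R / 2)) :=
      (isCompact_sphere _ _).inter_right Metric.isClosed_closedBall
    rcases Set.eq_empty_or_nonempty (Metric.sphere x₂ δ ∩ Metric.closedBall z (R / 2)) with h | h
    · exact ⟨1, one_pos, by simp [h]⟩
    · obtain ⟨w, hw, hwmax⟩ := hK.exists_isMaxOn h hf.continuous.continuousOn
      refine ⟨f x₀ - f w, sub_pos.2 (hlt' w hw.2 ?_), fun x hx => ?_⟩
      · rintro rfl
        have := hw.1
        simp [hδpos.ne] at this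
      · have := hwmax hx
        simp only [Set.mem_ofPred_eq] at this
        linarith
  have hcont : Continuous fun x => f x + η * Real.exp (-α * ‖x - z‖ ^ 2) :=
    hf.continuous.add (continuous_const.mul (contDiff_gaussian α z).continuous)
  obtain ⟨y, hy, hymax⟩ := (isCompact_closedBall x₂ δ).exists_isMaxOn
    ⟨x₂, Metric.mem_closedBall_self hδpos.le⟩ hcont.continuousOn
  have hyball : dist y x₂ < δ ∨ dist y x₂ = δ := lt_or_eq_of_le (Metric.mem_closedBall.1 hy)
  have hex₂ : f x₀ + η * Real.exp (-α * (R / 2) ^ 2) ≤ f y + η * Real.exp (-α * ‖y - z‖ ^ 2) := by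
    have := hymax (Metric.mem_closedBall_self hδpos.le)
    simp only [Set.mem_ofPred_eq] at this
    rwa [← dist_eq_norm x₂ z, hzx₂, hx₂] at this
  have hle : ∀ w : ℝ, Real.exp (-α * w ^ 2) ≤ 1 := fun w => by
    rw [Real.exp_le_one_iff]; nlinarith [sq_nonneg w]
  rcases hyball with hlt₂ | heq
  · refine hbar y (hsubset hy) z ?_ η hη ?_
    · rw [← dist_eq_norm]
      linarith [dist_triangle x₂ y z, dist_comm x₂ y]
    · exact hymax.isLocalMax (Metric.closedBall_mem_nhds_of_mem hlt₂)
  · rcases le_or_gt (dist y z) (R / 2) with h | h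
    · have h1 := hηf y ⟨heq, h⟩
      have h2 := mul_le_mul_of_nonneg_left (hle ‖y - z‖) hη.le
      have h3 : 0 < η * Real.exp (-α * (R / 2) ^ 2) := by positivity
      linarith
    · have h1 := hmax y (hsubset hy)
      have h2 : Real.exp (-α * ‖y - z‖ ^ 2) < Real.exp (-α * (R / 2) ^ 2) := by
        rw [Real.exp_lt_exp, ← dist_eq_norm, neg_mul, neg_mul, neg_lt_neg_iff]
        gcongr
      have h3 := mul_lt_mul_of_pos_left h2 hη
      linarith

end Barrier

section CrossProduct

variable (a b c d : EuclideanSpace ℝ (Fin 3))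

theorem cross3_zero : cross3 a b 0 = a 1 * b 2 - a 2 * b 1 := by simp [cross3, cross_apply]

theorem cross3_one : cross3 a b 1 = a 2 * b 0 - a 0 * b 2 := by simp [cross3, cross_apply]

theorem cross3_two : cross3 a b 2 = a 0 * b 1 - a 1 * b 0 := by simp [cross3, cross_apply]

theorem real_inner_fin_three : ⟪a, b⟫ = a 0 * b 0 + a 1 * b 1 + a 2 * b 2 := by
  simp [PiLp.inner_apply, Fin.sum_univ_three, mul_comm]

theorem inner_cross3_cross3 :
    ⟪cross3 a b, cross3 c d⟫ = ⟪a, c⟫ * ⟪b, d⟫ - ⟪a, d⟫ * ⟪b, c⟫ := by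
  simp only [real_inner_fin_three, cross3_zero, cross3_one, cross3_two]
  ring

theorem inner_cross3_cyclic : ⟪cross3 a b, c⟫ = ⟪cross3 b c, a⟫ := by
  simp only [real_inner_fin_three, cross3_zero, cross3_one, cross3_two]
  ring

theorem inner_cross3_self_right : ⟪cross3 a b, b⟫ = 0 := by
  simp only [real_inner_fin_three, cross3_zero, cross3_one, cross3_two]
  ring

theorem cross3_comm : cross3 a b = -cross3 b a := by
  ext i
  fin_cases i <;> simp [cross3_zero, cross3_one, cross3_two, mul_comm]

/-- Expansion of a vector in the basis dual to `a, b, c`. -/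
theorem triple_smul_eq_dual_expansion (v : EuclideanSpace ℝ (Fin 3)) :
    ⟪cross3 a b, c⟫ • v = ⟪v, a⟫ • cross3 b c + ⟪v, b⟫ • cross3 c a + ⟪v, c⟫ • cross3 a b := by
  ext i
  fin_cases i <;> simp [cross3_zero, cross3_one, cross3_two, real_inner_fin_three] <;> ring

/-- Expansion of a vector in the basis `a, b, c`. -/
theorem triple_smul_eq_expansion (v : EuclideanSpace ℝ (Fin 3)) :
    ⟪cross3 a b, c⟫ • v = ⟪v, cross3 b c⟫ • a + ⟪v, cross3 c a⟫ • b + ⟪v, cross3 a b⟫ • c := by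
  ext i
  fin_cases i <;> simp [cross3_zero, cross3_one, cross3_two, real_inner_fin_three] <;> ring

variable {a b}

theorem cross3_eq_inner_smul {n : EuclideanSpace ℝ (Fin 3)} (hn : ‖n‖ = 1)
    (ha : ⟪n, a⟫ = 0) (hb : ⟪n, b⟫ = 0) : cross3 a b = ⟪cross3 a b, n⟫ • n := by
  have hn' : ⟪n, n⟫ = 1 := by rw [real_inner_self_eq_norm_sq, hn, one_pow]
  simp only [real_inner_fin_three] at ha hb hn'
  ext i
  fin_cases i <;> simp [cross3_zero, cross3_one, cross3_two, real_inner_fin_three]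
  · linear_combination (-(a 1 * b 2 - a 2 * b 1)) * hn' + (a 1 * n 2 - a 2 * n 1) * hb -
      (b 1 * n 2 - b 2 * n 1) * ha
  · linear_combination (-(a 2 * b 0 - a 0 * b 2)) * hn' + (a 2 * n 0 - a 0 * n 2) * hb -
      (b 2 * n 0 - b 0 * n 2) * ha
  · linear_combination (-(a 0 * b 1 - a 1 * b 0)) * hn' + (a 0 * n 1 - a 1 * n 0) * hb -
      (b 0 * n 1 - b 1 * n 0) * ha

/-- The cross product as a continuous bilinear map. -/
noncomputable def cross3L :
    EuclideanSpace ℝ (Fin 3) →L[ℝ] EuclideanSpace ℝ (Fin 3) →L[ℝ] EuclideanSpace ℝ (Fin 3) :=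
  LinearMap.toContinuousLinearMap
    (LinearMap.toContinuousLinearMap.toLinearMap ∘ₗ LinearMap.mk₂ ℝ cross3
      (fun a b c => by ext i; fin_cases i <;> simp [cross3_zero, cross3_one, cross3_two] <;> ring)
      (fun k a b => by ext i; fin_cases i <;> simp [cross3_zero, cross3_one, cross3_two] <;> ring)
      (fun a b c => by ext i; fin_cases i <;> simp [cross3_zero, cross3_one, cross3_two] <;> ring)
      (fun k a b => by ext i; fin_cases i <;> simp [cross3_zero, cross3_one, cross3_two] <;> ring))

theorem cross3L_apply (a b : EuclideanSpace ℝ (Fin 3)) : cross3L a b = cross3 a b := rfl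

theorem ContDiff.cross3 {V : Type*} [NormedAddCommGroup V] [NormedSpace ℝ V] {n : ℕ∞ω}
    {F G : V → EuclideanSpace ℝ (Fin 3)} (hF : ContDiff ℝ n F) (hG : ContDiff ℝ n G) :
    ContDiff ℝ n fun x => cross3 (F x) (G x) :=
  (cross3L.contDiff.comp hF).clm_apply hG

theorem partialDeriv_cross3 {F G : EuclideanSpace ℝ (Fin 2) → EuclideanSpace ℝ (Fin 3)}
    {x : EuclideanSpace ℝ (Fin 2)} (hF : DifferentiableAt ℝ F x) (hG : DifferentiableAt ℝ G x)
    (i : Fin 2) :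
    partialDeriv i (fun y => cross3 (F y) (G y)) x =
      cross3 (F x) (partialDeriv i G x) + cross3 (partialDeriv i F x) (G x) :=
  partialDeriv_bilinear cross3L hF hG i

end CrossProduct

/-- A symmetric form that is trace-free with respect to a definite form has no kernel unless it
vanishes; quantitatively, its values control the vector and the form. -/
theorem det_mul_le_of_trace_free {h₀ h₁ h₂ p q s u v : ℝ} (hh₀ : 0 < h₀) (hh₂ : 0 < h₂)
    (hdet : 0 < h₀ * h₂ - h₁ ^ 2) (htr : h₂ * p - 2 * h₁ * q + h₀ * s = 0) :
    (h₀ * h₂ - h₁ ^ 2) * ((|p| + |q| + |s|) * (|u| + |v|)) ≤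
      6 * (h₀ + h₂) ^ 2 * (|p * u + q * v| + |q * u + s * v|) := by
  set D := h₀ * h₂ - h₁ ^ 2 with hD
  set m := |p| + |q| + |s| with hm
  set Δ := q ^ 2 - p * s with hΔ
  set x := p * u + q * v with hx
  set y := q * u + s * v with hy
  have hm0 : 0 ≤ m := by positivity
  have hform : D * (p ^ 2 + 2 * q ^ 2 + s ^ 2) ≤ (h₀ + h₂) ^ 2 * Δ := by
    have h1 : h₀ * Δ = h₂ * p ^ 2 - 2 * h₁ * p * q + h₀ * q ^ 2 := by
      rw [hΔ]; linear_combination (-p) * htr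
    have h2 : h₂ * Δ = h₂ * q ^ 2 - 2 * h₁ * q * s + h₀ * s ^ 2 := by
      rw [hΔ]; linear_combination (-s) * htr
    have h3 : (h₀ + h₂) ^ 2 * Δ = (h₀ + h₂) * (h₀ * Δ) + (h₀ + h₂) * (h₂ * Δ) := by ring
    rw [h3, h1, h2, hD]
    nlinarith [sq_nonneg (h₂ * p - h₁ * q), sq_nonneg (h₁ * p - h₀ * q),
      sq_nonneg (h₂ * q - h₁ * s), sq_nonneg (h₁ * q - h₀ * s)]
  have hsq : m ^ 2 ≤ 3 * (p ^ 2 + 2 * q ^ 2 + s ^ 2) := by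
    rw [hm, ← sq_abs p, ← sq_abs q, ← sq_abs s]
    nlinarith [sq_nonneg (|p| - |q|), sq_nonneg (|q| - |s|), sq_nonneg (|p| - |s|),
      sq_nonneg (|q|)]
  have hu : |u| * Δ ≤ m * (|x| + |y|) := by
    have h1 : u * Δ = q * y - s * x := by rw [hx, hy, hΔ]; ring
    calc |u| * Δ ≤ |u| * |Δ| := by gcongr; exact le_abs_self _
      _ = |q * y - s * x| := by rw [← abs_mul, h1]
      _ ≤ |q * y| + |s * x| := abs_sub _ _
      _ = |q| * |y| + |s| * |x| := by rw [abs_mul, abs_mul]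
      _ ≤ m * |y| + m * |x| := by
        gcongr <;> rw [hm] <;> linarith [abs_nonneg p, abs_nonneg q, abs_nonneg s]
      _ = m * (|x| + |y|) := by ring
  have hv : |v| * Δ ≤ m * (|x| + |y|) := by
    have h1 : v * Δ = q * x - p * y := by rw [hx, hy, hΔ]; ring
    calc |v| * Δ ≤ |v| * |Δ| := by gcongr; exact le_abs_self _
      _ = |q * x - p * y| := by rw [← abs_mul, h1]
      _ ≤ |q * x| + |p * y| := abs_sub _ _
      _ = |q| * |x| + |p| * |y| := by rw [abs_mul, abs_mul]
      _ ≤ m * |x| + m * |y| := by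
        gcongr <;> rw [hm] <;> linarith [abs_nonneg p, abs_nonneg q, abs_nonneg s]
      _ = m * (|x| + |y|) := by ring
  rcases hm0.eq_or_lt with h0 | h0
  · rw [← h0]
    simp only [zero_mul, mul_zero]
    positivity
  · refine le_of_mul_le_mul_left ?_ h0
    have h1 : D * m ^ 2 ≤ 3 * ((h₀ + h₂) ^ 2 * Δ) := by
      have := mul_le_mul_of_nonneg_left hsq hdet.le
      linarith
    have h2 : D * m ^ 2 * (|u| + |v|) ≤ 3 * ((h₀ + h₂) ^ 2 * Δ) * (|u| + |v|) := by gcongr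
    have h3 : (h₀ + h₂) ^ 2 * ((|u| + |v|) * Δ) ≤ (h₀ + h₂) ^ 2 * (2 * (m * (|x| + |y|))) :=
      mul_le_mul_of_nonneg_left (by linarith) (sq_nonneg _)
    linarith

section SecondForm

variable {V : Type*} [NormedAddCommGroup V] [InnerProductSpace ℝ V]

/-- The pairing of the partial derivatives of a map with those of a field `ν`; for a
parametrized surface with unit normal `ν` this is the second fundamental form. -/
noncomputable def secondForm (F ν : EuclideanSpace ℝ (Fin 2) → V) (i j : Fin 2)
    (x : EuclideanSpace ℝ (Fin 2)) : ℝ :=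
  ⟪partialDeriv i F x, partialDeriv j ν x⟫

variable {F ν : EuclideanSpace ℝ (Fin 2) → V}

theorem ContDiff.partialDeriv_infty (hF : ContDiff ℝ ∞ F) (i : Fin 2) :
    ContDiff ℝ ∞ (partialDeriv i F) :=
  hF.partialDeriv_of_le (by simp) i

theorem ContDiff.differentiableAt_infty (hF : ContDiff ℝ ∞ F) (x : EuclideanSpace ℝ (Fin 2)) :
    DifferentiableAt ℝ F x :=
  hF.contDiffAt.differentiableAt (by simp)

theorem contDiff_secondForm (hF : ContDiff ℝ ∞ F) (hν : ContDiff ℝ ∞ ν) (i j : Fin 2) :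
    ContDiff ℝ ∞ (secondForm F ν i j) :=
  (hF.partialDeriv_infty i).inner ℝ (hν.partialDeriv_infty j)

theorem partialDeriv_secondForm (hF : ContDiff ℝ ∞ F) (hν : ContDiff ℝ ∞ ν) (i j k : Fin 2)
    (x : EuclideanSpace ℝ (Fin 2)) :
    partialDeriv k (secondForm F ν i j) x =
      ⟪partialDeriv k (partialDeriv i F) x, partialDeriv j ν x⟫ +
        ⟪partialDeriv i F x, partialDeriv k (partialDeriv j ν) x⟫ :=
  partialDeriv_inner ((hF.partialDeriv_infty i).differentiableAt_infty x)
    ((hν.partialDeriv_infty j).differentiableAt_infty x) k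

theorem partialDeriv_comm_infty (hF : ContDiff ℝ ∞ F) (i j : Fin 2)
    (x : EuclideanSpace ℝ (Fin 2)) :
    partialDeriv i (partialDeriv j F) x = partialDeriv j (partialDeriv i F) x :=
  partialDeriv_comm (by exact_mod_cast contDiff_infty.1 hF 2) i j x

theorem inner_partialDeriv_partialDeriv_eq_neg_secondForm (hF : ContDiff ℝ ∞ F)
    (hν : ContDiff ℝ ∞ ν) (h : ∀ x i, ⟪partialDeriv i F x, ν x⟫ = 0) (i j : Fin 2)
    (x : EuclideanSpace ℝ (Fin 2)) :
    ⟪partialDeriv j (partialDeriv i F) x, ν x⟫ = -secondForm F ν i j x := by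
  have h1 := partialDeriv_inner ((hF.partialDeriv_infty i).differentiableAt_infty x)
    (hν.differentiableAt_infty x) j
  have h2 : (fun y => ⟪partialDeriv i F y, ν y⟫) = fun _ => 0 := funext fun y => h y i
  rw [h2] at h1
  simp only [partialDeriv, fderiv_fun_const, Pi.zero_apply, zero_apply] at h1
  simp only [secondForm, partialDeriv]
  linarith

theorem secondForm_comm (hF : ContDiff ℝ ∞ F) (hν : ContDiff ℝ ∞ ν)
    (h : ∀ x i, ⟪partialDeriv i F x, ν x⟫ = 0) (i j : Fin 2) :
    secondForm F ν i j = secondForm F ν j i := by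
  funext x
  have h1 := inner_partialDeriv_partialDeriv_eq_neg_secondForm hF hν h i j x
  have h2 := inner_partialDeriv_partialDeriv_eq_neg_secondForm hF hν h j i x
  rw [partialDeriv_comm_infty hF] at h1
  linarith

/-- The Codazzi equation for a map whose derivative is orthogonal to `ν`. -/
theorem inner_partialDeriv_partialDeriv_comm (hF : ContDiff ℝ ∞ F) (hν : ContDiff ℝ ∞ ν)
    (h : ∀ x i, ⟪partialDeriv i F x, ν x⟫ = 0) (i j k : Fin 2) (x : EuclideanSpace ℝ (Fin 2)) :
    ⟪partialDeriv j (partialDeriv i F) x, partialDeriv k ν x⟫ =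
      ⟪partialDeriv k (partialDeriv j F) x, partialDeriv i ν x⟫ +
      ⟪partialDeriv k F x, partialDeriv j (partialDeriv i ν) x⟫ -
      ⟪partialDeriv i F x, partialDeriv j (partialDeriv k ν) x⟫ := by
  have h1 := partialDeriv_secondForm hF hν i k j x
  have h2 := partialDeriv_secondForm hF hν k i j x
  rw [secondForm_comm hF hν h i k] at h1
  rw [partialDeriv_comm_infty hF j k] at h2
  linarith

end SecondForm

section Asymptotics

variable {X V : Type*} [TopologicalSpace X] [NormedAddCommGroup V] [InnerProductSpace ℝ V]
  {x : X} {m : X → ℝ}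

theorem ContinuousAt.mul_isBigO {c g : X → ℝ} (hc : ContinuousAt c x) (hg : g =O[𝓝 x] m) :
    (fun y => c y * g y) =O[𝓝 x] m := by
  simpa using (hc.tendsto.isBigO_one ℝ).mul hg

theorem ContinuousAt.isBigO_smul {c : X → V} {g : X → ℝ} (hc : ContinuousAt c x)
    (hg : g =O[𝓝 x] m) : (fun y => g y • c y) =O[𝓝 x] m := by
  simpa using hg.smul (hc.tendsto.isBigO_one ℝ)

theorem ContinuousAt.inner_isBigO {F G : X → V} (hG : ContinuousAt G x) (hF : F =O[𝓝 x] m) :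
    (fun y => ⟪F y, G y⟫) =O[𝓝 x] m := by
  have h1 : (fun y => ⟪F y, G y⟫) =O[𝓝 x] fun y => ‖F y‖ * ‖G y‖ :=
    IsBigO.of_bound 1 (Eventually.of_forall fun y => by
      simpa using abs_real_inner_le_norm (F y) (G y))
  have h2 := hF.norm_left.mul (hG.norm.tendsto.isBigO_one ℝ)
  simpa using h1.trans h2

end Asymptotics

/-- A parametrized strictly convex surface `r` with unit normal `ν`, together with the rotation
field `Y` of an infinitesimal bending. -/
structure IsRotationField (r ν Y : EuclideanSpace ℝ (Fin 2) → EuclideanSpace ℝ (Fin 3)) :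
    Prop where
  contDiff_surface : ContDiff ℝ ∞ r
  contDiff_normal : ContDiff ℝ ∞ ν
  contDiff_field : ContDiff ℝ ∞ Y
  norm_normal : ∀ x, ‖ν x‖ = 1
  inner_normal : ∀ x i, ⟪partialDeriv i r x, ν x⟫ = 0
  convex : ∀ x v, v ≠ 0 → 0 < ⟪fderiv ℝ r x v, fderiv ℝ ν x v⟫
  cross_comm : ∀ x, cross3 (partialDeriv 0 Y x) (partialDeriv 1 r x) =
    cross3 (partialDeriv 1 Y x) (partialDeriv 0 r x)

namespace IsRotationField

variable {r ν Y : EuclideanSpace ℝ (Fin 2) → EuclideanSpace ℝ (Fin 3)}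

theorem secondForm_surface_comm (h : IsRotationField r ν Y) (i j : Fin 2) :
    secondForm r ν i j = secondForm r ν j i :=
  secondForm_comm h.contDiff_surface h.contDiff_normal h.inner_normal i j

theorem secondForm_pos (h : IsRotationField r ν Y) (x : EuclideanSpace ℝ (Fin 2)) {a b : ℝ}
    (hab : a ≠ 0 ∨ b ≠ 0) :
    0 < a ^ 2 * secondForm r ν 0 0 x + 2 * a * b * secondForm r ν 0 1 x +
      b ^ 2 * secondForm r ν 1 1 x := by
  have hv : (!₂[a, b] : EuclideanSpace ℝ (Fin 2)) ≠ 0 := by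
    intro h0
    have h1 := congrArg (fun v : EuclideanSpace ℝ (Fin 2) => v 0) h0
    have h2 := congrArg (fun v : EuclideanSpace ℝ (Fin 2) => v 1) h0
    simp at h1 h2
    tauto
  have h1 := h.convex x _ hv
  rw [fderiv_apply_eq_partialDeriv, fderiv_apply_eq_partialDeriv] at h1
  simp only [inner_add_left, inner_add_right, inner_smul_left, inner_smul_right] at h1
  have h2 := congrFun (h.secondForm_surface_comm 1 0) x
  simp only [secondForm] at h2 ⊢
  simp at h1
  rw [h2] at h1
  linarith

theorem secondForm_zero_zero_pos (h : IsRotationField r ν Y) (x : EuclideanSpace ℝ (Fin 2)) :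
    0 < secondForm r ν 0 0 x := by
  simpa using h.secondForm_pos x (a := 1) (b := 0) (by simp)

theorem secondForm_one_one_pos (h : IsRotationField r ν Y) (x : EuclideanSpace ℝ (Fin 2)) :
    0 < secondForm r ν 1 1 x := by
  simpa using h.secondForm_pos x (a := 0) (b := 1) (by simp)

theorem det_secondForm_pos (h : IsRotationField r ν Y) (x : EuclideanSpace ℝ (Fin 2)) :
    0 < secondForm r ν 0 0 x * secondForm r ν 1 1 x - secondForm r ν 0 1 x ^ 2 := by
  have h0 := h.secondForm_zero_zero_pos x
  have h1 := h.secondForm_pos x (a := secondForm r ν 0 1 x) (b := -secondForm r ν 0 0 x)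
    (Or.inr (neg_ne_zero.2 h0.ne'))
  refine pos_of_mul_pos_right (a := secondForm r ν 0 0 x) ?_ h0.le
  linarith

theorem inner_partialDeriv_normal (h : IsRotationField r ν Y) (x : EuclideanSpace ℝ (Fin 2))
    (i : Fin 2) : ⟪ν x, partialDeriv i ν x⟫ = 0 := by
  have h1 := partialDeriv_inner (h.contDiff_normal.differentiableAt_infty x)
    (h.contDiff_normal.differentiableAt_infty x) i
  have h2 : (fun y => ⟪ν y, ν y⟫) = fun _ => 1 := funext fun y => by
    rw [real_inner_self_eq_norm_sq, h.norm_normal, one_pow]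
  rw [h2, real_inner_comm] at h1
  simp only [partialDeriv, fderiv_fun_const, Pi.zero_apply, zero_apply] at h1
  simp only [partialDeriv]
  linarith

theorem inner_cross3_partialDeriv (h : IsRotationField r ν Y) (x : EuclideanSpace ℝ (Fin 2)) :
    ⟪cross3 (partialDeriv 0 r x) (partialDeriv 1 r x),
      cross3 (partialDeriv 0 ν x) (partialDeriv 1 ν x)⟫ =
    secondForm r ν 0 0 x * secondForm r ν 1 1 x - secondForm r ν 0 1 x ^ 2 := by
  rw [inner_cross3_cross3]
  have h2 := congrFun (h.secondForm_surface_comm 1 0) x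
  simp only [secondForm] at h2 ⊢
  rw [h2]
  ring

theorem cross3_surface_eq (h : IsRotationField r ν Y) (x : EuclideanSpace ℝ (Fin 2)) :
    cross3 (partialDeriv 0 r x) (partialDeriv 1 r x) =
      ⟪cross3 (partialDeriv 0 r x) (partialDeriv 1 r x), ν x⟫ • ν x :=
  cross3_eq_inner_smul (h.norm_normal x) (by rw [real_inner_comm, h.inner_normal])
    (by rw [real_inner_comm, h.inner_normal])

theorem triple_surface_ne_zero (h : IsRotationField r ν Y) (x : EuclideanSpace ℝ (Fin 2)) :
    ⟪cross3 (partialDeriv 0 r x) (partialDeriv 1 r x), ν x⟫ ≠ 0 := by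
  intro h0
  have h1 := h.det_secondForm_pos x
  rw [← h.inner_cross3_partialDeriv, h.cross3_surface_eq, h0] at h1
  simp at h1

theorem triple_normal_ne_zero (h : IsRotationField r ν Y) (x : EuclideanSpace ℝ (Fin 2)) :
    ⟪cross3 (partialDeriv 0 ν x) (partialDeriv 1 ν x), ν x⟫ ≠ 0 := by
  intro h0
  have h1 := h.det_secondForm_pos x
  rw [← h.inner_cross3_partialDeriv, cross3_eq_inner_smul (h.norm_normal x)
    (h.inner_partialDeriv_normal x 0) (h.inner_partialDeriv_normal x 1), h0] at h1
  simp at h1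

/-- The derivative of the rotation field is tangent to the surface. -/
theorem inner_partialDeriv_field (h : IsRotationField r ν Y) (x : EuclideanSpace ℝ (Fin 2))
    (i : Fin 2) : ⟪partialDeriv i Y x, ν x⟫ = 0 := by
  have key : ⟪partialDeriv i Y x, cross3 (partialDeriv 0 r x) (partialDeriv 1 r x)⟫ = 0 := by
    rw [real_inner_comm]
    fin_cases i
    · change ⟪_, partialDeriv 0 Y x⟫ = 0
      rw [inner_cross3_cyclic, cross3_comm, inner_neg_left, h.cross_comm,
        inner_cross3_self_right, neg_zero]
    · change ⟪_, partialDeriv 1 Y x⟫ = 0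
      rw [inner_cross3_cyclic, inner_cross3_cyclic, ← h.cross_comm, inner_cross3_self_right]
  rw [h.cross3_surface_eq, inner_smul_right] at key
  exact (mul_eq_zero.1 key).resolve_left (h.triple_surface_ne_zero x)

theorem secondForm_field_comm (h : IsRotationField r ν Y) (i j : Fin 2) :
    secondForm Y ν i j = secondForm Y ν j i :=
  secondForm_comm h.contDiff_field h.contDiff_normal h.inner_partialDeriv_field i j

theorem trace_secondForm_field (h : IsRotationField r ν Y) (x : EuclideanSpace ℝ (Fin 2)) :
    secondForm r ν 1 1 x * secondForm Y ν 0 0 x - 2 * secondForm r ν 0 1 x * secondForm Y ν 0 1 x +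
      secondForm r ν 0 0 x * secondForm Y ν 1 1 x = 0 := by
  have h1 := congrArg (fun w => ⟪w, cross3 (partialDeriv 0 ν x) (partialDeriv 1 ν x)⟫)
    (h.cross_comm x)
  simp only [inner_cross3_cross3] at h1
  have h2 := congrFun (h.secondForm_surface_comm 1 0) x
  have h3 := congrFun (h.secondForm_field_comm 1 0) x
  simp only [secondForm] at h2 h3 ⊢
  rw [h2, h3] at h1
  linarith

end IsRotationField

/-- The trace of the second derivative of a field with respect to the second fundamental form. -/
noncomputable def secondTrace (r ν Y : EuclideanSpace ℝ (Fin 2) → EuclideanSpace ℝ (Fin 3))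
    (x : EuclideanSpace ℝ (Fin 2)) : EuclideanSpace ℝ (Fin 3) :=
  secondForm r ν 1 1 x • partialDeriv 0 (partialDeriv 0 Y) x -
    (2 * secondForm r ν 0 1 x) • partialDeriv 0 (partialDeriv 1 Y) x +
    secondForm r ν 0 0 x • partialDeriv 1 (partialDeriv 1 Y) x

/-- The size of the form of a field. -/
noncomputable def secondFormNorm (Y ν : EuclideanSpace ℝ (Fin 2) → EuclideanSpace ℝ (Fin 3))
    (x : EuclideanSpace ℝ (Fin 2)) : ℝ :=
  |secondForm Y ν 0 0 x| + |secondForm Y ν 0 1 x| + |secondForm Y ν 1 1 x|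

namespace IsRotationField

variable {r ν Y : EuclideanSpace ℝ (Fin 2) → EuclideanSpace ℝ (Fin 3)}

theorem secondForm_field_isBigO (h : IsRotationField r ν Y) (i j : Fin 2)
    (x₀ : EuclideanSpace ℝ (Fin 2)) :
    secondForm Y ν i j =O[𝓝 x₀] secondFormNorm Y ν := by
  refine IsBigO.of_bound 1 (Eventually.of_forall fun x => ?_)
  have h10 := congrFun (h.secondForm_field_comm 1 0) x
  have h0 := abs_nonneg (secondForm Y ν 0 0 x)
  have h1 := abs_nonneg (secondForm Y ν 0 1 x)
  have h2 := abs_nonneg (secondForm Y ν 1 1 x)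
  simp only [one_mul, Real.norm_eq_abs]
  refine le_trans ?_ (le_abs_self _)
  unfold secondFormNorm
  fin_cases i <;> fin_cases j <;> simp only [Fin.zero_eta, Fin.mk_one, h10] <;> linarith

theorem partialDeriv_field_eq (h : IsRotationField r ν Y) (i : Fin 2)
    (x : EuclideanSpace ℝ (Fin 2)) :
    ⟪cross3 (partialDeriv 0 ν x) (partialDeriv 1 ν x), ν x⟫ • partialDeriv i Y x =
      secondForm Y ν i 0 x • cross3 (partialDeriv 1 ν x) (ν x) +
        secondForm Y ν i 1 x • cross3 (ν x) (partialDeriv 0 ν x) := by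
  rw [triple_smul_eq_dual_expansion, h.inner_partialDeriv_field, zero_smul, add_zero]
  rfl

theorem partialDeriv_field_isBigO (h : IsRotationField r ν Y) (i : Fin 2)
    (x₀ : EuclideanSpace ℝ (Fin 2)) :
    partialDeriv i Y =O[𝓝 x₀] secondFormNorm Y ν := by
  have hν := h.contDiff_normal
  have hn := fun j => hν.partialDeriv_infty j
  have hD := ((((hn 0).cross3 (hn 1)).inner ℝ hν).continuous.continuousAt (x := x₀)).inv₀
    (h.triple_normal_ne_zero x₀)
  have h0 := (hD.smul ((hn 1).cross3 hν).continuous.continuousAt).isBigO_smul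
    (h.secondForm_field_isBigO i 0 x₀)
  have h1 := (hD.smul (hν.cross3 (hn 0)).continuous.continuousAt).isBigO_smul
    (h.secondForm_field_isBigO i 1 x₀)
  refine (h0.add h1).congr_left fun x => ?_
  have := h.partialDeriv_field_eq i x
  rw [← eq_inv_smul_iff₀ (h.triple_normal_ne_zero x)] at this
  rw [this, smul_add, smul_comm, smul_comm _ (secondForm Y ν i 1 x)]
  rfl

theorem inner_secondTrace_normal (h : IsRotationField r ν Y) (x : EuclideanSpace ℝ (Fin 2)) :
    ⟪secondTrace r ν Y x, ν x⟫ = 0 := by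
  have h1 := inner_partialDeriv_partialDeriv_eq_neg_secondForm h.contDiff_field h.contDiff_normal
    h.inner_partialDeriv_field
  have h10 := congrFun (h.secondForm_field_comm 1 0) x
  simp only [secondTrace, inner_add_left, inner_sub_left, real_inner_smul_left, h1, h10]
  linear_combination -h.trace_secondForm_field x

theorem partialDeriv_trace_secondForm_field (h : IsRotationField r ν Y) (k : Fin 2)
    (x : EuclideanSpace ℝ (Fin 2)) :
    secondForm r ν 1 1 x * partialDeriv k (secondForm Y ν 0 0) x -
      2 * secondForm r ν 0 1 x * partialDeriv k (secondForm Y ν 0 1) x +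
      secondForm r ν 0 0 x * partialDeriv k (secondForm Y ν 1 1) x =
    -(partialDeriv k (secondForm r ν 1 1) x * secondForm Y ν 0 0 x -
      2 * partialDeriv k (secondForm r ν 0 1) x * secondForm Y ν 0 1 x +
      partialDeriv k (secondForm r ν 0 0) x * secondForm Y ν 1 1 x) := by
  have hr := fun i j => (contDiff_secondForm h.contDiff_surface h.contDiff_normal i
    j).differentiableAt_infty x
  have hY := fun i j => (contDiff_secondForm h.contDiff_field h.contDiff_normal i
    j).differentiableAt_infty x
  have h1 := (((hr 1 1).hasFDerivAt.mul (hY 0 0).hasFDerivAt).sub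
    (((hr 0 1).hasFDerivAt.mul (hY 0 1).hasFDerivAt).const_mul 2)).add
    ((hr 0 0).hasFDerivAt.mul (hY 1 1).hasFDerivAt)
  have h2 := congrArg (fun L => L (EuclideanSpace.single k 1))
    ((h1.congr_of_eventuallyEq (f₁ := fun _ => 0) (Eventually.of_forall fun y => by
      simp only [Pi.add_apply, Pi.sub_apply, Pi.mul_apply]
      linear_combination -h.trace_secondForm_field y)).unique (hasFDerivAt_const 0 x))
  simp at h2
  simp only [partialDeriv]
  linarith

theorem inner_secondTrace_partialDeriv_normal_isBigO (h : IsRotationField r ν Y) (k : Fin 2)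
    (x₀ : EuclideanSpace ℝ (Fin 2)) :
    (fun x => ⟪secondTrace r ν Y x, partialDeriv k ν x⟫) =O[𝓝 x₀] secondFormNorm Y ν := by
  have hν := h.contDiff_normal
  have hY := h.contDiff_field
  have hform := fun i j => contDiff_secondForm h.contDiff_surface hν i j
  have hS : ∀ a i j i' j', (fun x => partialDeriv a (secondForm r ν i j) x *
      secondForm Y ν i' j' x) =O[𝓝 x₀] secondFormNorm Y ν := fun a i j i' j' =>
    ((hform i j).partialDeriv_infty a).continuous.continuousAt.mul_isBigO
      (h.secondForm_field_isBigO i' j' x₀)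
  have hI : ∀ i j i' a b, (fun x => secondForm r ν i j x *
      ⟪partialDeriv i' Y x, partialDeriv a (partialDeriv b ν) x⟫) =O[𝓝 x₀] secondFormNorm Y ν :=
    fun i j i' a b => (hform i j).continuous.continuousAt.mul_isBigO
      (((hν.partialDeriv_infty b).partialDeriv_infty a).continuous.continuousAt.inner_isBigO
        (h.partialDeriv_field_isBigO i' x₀))
  have hsum := (((hS k 1 1 0 0).sub ((hS k 0 1 0 1).const_mul_left 2)).add
    (hS k 0 0 1 1)).neg_left.add (((((hI 1 1 k 0 0).sub (hI 1 1 0 k 0)).sub (hI 1 1 0 0 k)).sub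
      ((((hI 0 1 k 0 1).sub (hI 0 1 0 k 1)).sub (hI 0 1 1 0 k)).const_mul_left 2)).add
      (((hI 0 0 k 1 1).sub (hI 0 0 1 k 1)).sub (hI 0 0 1 1 k)))
  refine hsum.congr_left fun x => ?_
  have hcod := fun i j =>
    inner_partialDeriv_partialDeriv_comm hY hν h.inner_partialDeriv_field i j k x
  have htr := h.partialDeriv_trace_secondForm_field k x
  simp only [partialDeriv_secondForm hY hν] at htr
  simp only [secondTrace, inner_add_left, inner_sub_left, real_inner_smul_left, hcod]
  linear_combination -htr

theorem triple_mul_inner_partialDeriv_field (h : IsRotationField r ν Y) (i : Fin 2)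
    (x : EuclideanSpace ℝ (Fin 2)) :
    ⟪cross3 (partialDeriv 0 ν x) (partialDeriv 1 ν x), ν x⟫ * ⟪Y x, partialDeriv i Y x⟫ =
      secondForm Y ν i 0 x * ⟪Y x, cross3 (partialDeriv 1 ν x) (ν x)⟫ +
        secondForm Y ν i 1 x * ⟪Y x, cross3 (ν x) (partialDeriv 0 ν x)⟫ := by
  have := congrArg (fun w => ⟪Y x, w⟫) (h.partialDeriv_field_eq i x)
  simpa only [inner_add_right, real_inner_smul_right] using this

theorem triple_mul_inner_secondTrace (h : IsRotationField r ν Y) (x : EuclideanSpace ℝ (Fin 2)) :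
    ⟪cross3 (partialDeriv 0 ν x) (partialDeriv 1 ν x), ν x⟫ * ⟪Y x, secondTrace r ν Y x⟫ =
      ⟪Y x, cross3 (partialDeriv 1 ν x) (ν x)⟫ * ⟪secondTrace r ν Y x, partialDeriv 0 ν x⟫ +
        ⟪Y x, cross3 (ν x) (partialDeriv 0 ν x)⟫ * ⟪secondTrace r ν Y x, partialDeriv 1 ν x⟫ := by
  have := congrArg (fun w => ⟪secondTrace r ν Y x, w⟫)
    (triple_smul_eq_expansion (partialDeriv 0 ν x) (partialDeriv 1 ν x) (ν x) (Y x))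
  simpa only [inner_add_right, real_inner_smul_right, h.inner_secondTrace_normal, mul_zero,
    add_zero, real_inner_comm (Y x) (secondTrace r ν Y x)] using this

theorem partialDeriv_inner_field_self (h : IsRotationField r ν Y) (i : Fin 2) :
    partialDeriv i (fun y => ⟪Y y, Y y⟫) = fun x => 2 * ⟪Y x, partialDeriv i Y x⟫ := by
  funext x
  rw [partialDeriv_inner (h.contDiff_field.differentiableAt_infty x)
    (h.contDiff_field.differentiableAt_infty x), real_inner_comm]
  ring

theorem partialDeriv_partialDeriv_inner_field_self (h : IsRotationField r ν Y) (i j : Fin 2)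
    (x : EuclideanSpace ℝ (Fin 2)) :
    partialDeriv j (partialDeriv i fun y => ⟪Y y, Y y⟫) x =
      2 * ⟪partialDeriv j Y x, partialDeriv i Y x⟫ +
        2 * ⟪Y x, partialDeriv j (partialDeriv i Y) x⟫ := by
  have h1 := h.contDiff_field.differentiableAt_infty x
  have h2 := (h.contDiff_field.partialDeriv_infty i).differentiableAt_infty x
  rw [h.partialDeriv_inner_field_self, partialDeriv_mul (differentiableAt_const 2) (h1.inner ℝ h2),
    partialDeriv_inner h1 h2]
  simp [partialDeriv]
  ring

theorem inner_field_secondTrace_isBigO (h : IsRotationField r ν Y) (x₀ : EuclideanSpace ℝ (Fin 2)) :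
    (fun x => ⟪Y x, secondTrace r ν Y x⟫) =O[𝓝 x₀] fun x =>
      |partialDeriv 0 (fun y => ⟪Y y, Y y⟫) x| + |partialDeriv 1 (fun y => ⟪Y y, Y y⟫) x| := by
  have hν := h.contDiff_normal
  have hn := fun j => hν.partialDeriv_infty j
  have hform := fun i j =>
    (contDiff_secondForm h.contDiff_surface hν i j).continuous.continuousAt (x := x₀)
  have hD := (((hn 0).cross3 (hn 1)).inner ℝ hν).continuous.continuousAt (x := x₀)
  have hDinv := hD.inv₀ (h.triple_normal_ne_zero x₀)
  set S : Fin 2 → EuclideanSpace ℝ (Fin 2) → ℝ := fun i x =>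
    ![⟪Y x, cross3 (partialDeriv 1 ν x) (ν x)⟫, ⟪Y x, cross3 (ν x) (partialDeriv 0 ν x)⟫] i with hS
  have hSle : ∀ i, S i =O[𝓝 x₀] fun x => |S 0 x| + |S 1 x| := by
    refine fun i => IsBigO.of_bound 1 (Eventually.of_forall fun x => ?_)
    rw [one_mul, Real.norm_eq_abs]
    refine le_trans ?_ (le_abs_self _)
    fin_cases i
    · exact le_add_of_nonneg_right (abs_nonneg _)
    · exact le_add_of_nonneg_left (abs_nonneg _)
  have hprod := fun i => (hSle i).mul (h.inner_secondTrace_partialDeriv_normal_isBigO i x₀)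
  have h1 : (fun x => ⟪Y x, secondTrace r ν Y x⟫) =O[𝓝 x₀] fun x =>
      (|S 0 x| + |S 1 x|) * secondFormNorm Y ν x := by
    refine (hDinv.mul_isBigO ((hprod 0).add (hprod 1))).congr_left fun x => ?_
    rw [Pi.inv_apply, inv_mul_eq_iff_eq_mul₀ (h.triple_normal_ne_zero x),
      h.triple_mul_inner_secondTrace]
    rfl
  have hc : ContinuousAt (fun x => (secondForm r ν 0 0 x * secondForm r ν 1 1 x -
      secondForm r ν 0 1 x ^ 2)⁻¹ * (6 * (secondForm r ν 0 0 x + secondForm r ν 1 1 x) ^ 2 *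
        (|⟪cross3 (partialDeriv 0 ν x) (partialDeriv 1 ν x), ν x⟫| / 2))) x₀ :=
    ((((hform 0 0).mul (hform 1 1)).sub ((hform 0 1).pow 2)).inv₀
      (h.det_secondForm_pos x₀).ne').mul ((continuousAt_const.mul
        (((hform 0 0).add (hform 1 1)).pow 2)).mul (hD.abs.div_const 2))
  refine h1.trans (IsBigO.trans (IsBigO.of_bound 1 (Eventually.of_forall fun x => ?_))
    (hc.mul_isBigO (isBigO_refl _ _)))
  have hM := fun i => h.triple_mul_inner_partialDeriv_field i x
  have hle := det_mul_le_of_trace_free (u := S 0 x) (v := S 1 x) (h.secondForm_zero_zero_pos x)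
    (h.secondForm_one_one_pos x) (h.det_secondForm_pos x) (h.trace_secondForm_field x)
  have h10 := congrFun (h.secondForm_field_comm 1 0) x
  have e0 : secondForm Y ν 0 0 x * S 0 x + secondForm Y ν 0 1 x * S 1 x =
    ⟪cross3 (partialDeriv 0 ν x) (partialDeriv 1 ν x), ν x⟫ * ⟪Y x, partialDeriv 0 Y x⟫ :=
    (hM 0).symm
  have e1 : secondForm Y ν 0 1 x * S 0 x + secondForm Y ν 1 1 x * S 1 x =
    ⟪cross3 (partialDeriv 0 ν x) (partialDeriv 1 ν x), ν x⟫ * ⟪Y x, partialDeriv 1 Y x⟫ := by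
    rw [← h10]
    exact (hM 1).symm
  rw [e0, e1] at hle
  rw [one_mul, Real.norm_eq_abs, Real.norm_eq_abs, abs_of_nonneg (mul_nonneg (by positivity)
    (by unfold secondFormNorm; positivity))]
  refine le_trans ?_ (le_abs_self _)
  rw [mul_assoc, le_inv_mul_iff₀ (h.det_secondForm_pos x), h.partialDeriv_inner_field_self,
    h.partialDeriv_inner_field_self, mul_comm (|S 0 x| + |S 1 x|)]
  refine hle.trans_eq ?_
  simp only [abs_mul, abs_two]
  ring

theorem trace_hessian_inner_field_self (h : IsRotationField r ν Y)
    (x : EuclideanSpace ℝ (Fin 2)) :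
    secondForm r ν 1 1 x * partialDeriv 0 (partialDeriv 0 fun y => ⟪Y y, Y y⟫) x +
      2 * -secondForm r ν 0 1 x * partialDeriv 0 (partialDeriv 1 fun y => ⟪Y y, Y y⟫) x +
      secondForm r ν 0 0 x * partialDeriv 1 (partialDeriv 1 fun y => ⟪Y y, Y y⟫) x =
    2 * (secondForm r ν 1 1 x * ⟪partialDeriv 0 Y x, partialDeriv 0 Y x⟫ -
      2 * secondForm r ν 0 1 x * ⟪partialDeriv 0 Y x, partialDeriv 1 Y x⟫ +
      secondForm r ν 0 0 x * ⟪partialDeriv 1 Y x, partialDeriv 1 Y x⟫) +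
    2 * ⟪Y x, secondTrace r ν Y x⟫ := by
  simp only [h.partialDeriv_partialDeriv_inner_field_self, secondTrace, inner_add_right,
    inner_sub_right, real_inner_smul_right]
  ring

theorem secondForm_mul_energy (h₀ h₁ h₂ : ℝ) (a b : EuclideanSpace ℝ (Fin 3)) :
    h₂ * (h₂ * ⟪a, a⟫ - 2 * h₁ * ⟪a, b⟫ + h₀ * ⟪b, b⟫) =
      ‖h₂ • a - h₁ • b‖ ^ 2 + (h₀ * h₂ - h₁ ^ 2) * ‖b‖ ^ 2 := by
  simp only [← real_inner_self_eq_norm_sq, inner_sub_left, inner_sub_right, real_inner_smul_left,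
    real_inner_smul_right, real_inner_comm a b]
  ring

theorem energy_nonneg (h : IsRotationField r ν Y) (x : EuclideanSpace ℝ (Fin 2))
    (a b : EuclideanSpace ℝ (Fin 3)) :
    0 ≤ secondForm r ν 1 1 x * ⟪a, a⟫ - 2 * secondForm r ν 0 1 x * ⟪a, b⟫ +
      secondForm r ν 0 0 x * ⟪b, b⟫ := by
  refine (mul_nonneg_iff_of_pos_left (c := secondForm r ν 1 1 x) (h.secondForm_one_one_pos x)).1 ?_
  rw [secondForm_mul_energy]
  have := h.det_secondForm_pos x
  positivity

theorem eq_zero_of_energy_eq_zero (h : IsRotationField r ν Y) {x : EuclideanSpace ℝ (Fin 2)}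
    {a b : EuclideanSpace ℝ (Fin 3)}
    (hab : secondForm r ν 1 1 x * ⟪a, a⟫ - 2 * secondForm r ν 0 1 x * ⟪a, b⟫ +
      secondForm r ν 0 0 x * ⟪b, b⟫ = 0) : a = 0 ∧ b = 0 := by
  have h1 := secondForm_mul_energy (secondForm r ν 0 0 x) (secondForm r ν 0 1 x)
    (secondForm r ν 1 1 x) a b
  have hdet := h.det_secondForm_pos x
  rw [hab, mul_zero] at h1
  have hb : b = 0 := by
    by_contra hb
    have := mul_pos hdet (pow_pos (norm_pos_iff.2 hb) 2)
    nlinarith [sq_nonneg ‖secondForm r ν 1 1 x • a - secondForm r ν 0 1 x • b‖]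
  subst hb
  simpa [(h.secondForm_one_one_pos x).ne'] using h1.symm

theorem exists_secondForm_elliptic (h : IsRotationField r ν Y) (x₀ : EuclideanSpace ℝ (Fin 2)) :
    ∃ θ > 0, ∀ᶠ x in 𝓝 x₀, ∀ u v : ℝ, θ * (u ^ 2 + v ^ 2) ≤
      secondForm r ν 1 1 x * u ^ 2 + 2 * -secondForm r ν 0 1 x * u * v +
        secondForm r ν 0 0 x * v ^ 2 := by
  have hform := fun i j =>
    (contDiff_secondForm h.contDiff_surface h.contDiff_normal i j).continuous.continuousAt (x := x₀)
  have htr := fun x => add_pos (h.secondForm_zero_zero_pos x) (h.secondForm_one_one_pos x)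
  have hc : ContinuousAt (fun x => (secondForm r ν 0 0 x * secondForm r ν 1 1 x -
      secondForm r ν 0 1 x ^ 2) / (secondForm r ν 0 0 x + secondForm r ν 1 1 x)) x₀ :=
    (((hform 0 0).mul (hform 1 1)).sub ((hform 0 1).pow 2)).div
      ((hform 0 0).add (hform 1 1)) (htr x₀).ne'
  have hpos := div_pos (h.det_secondForm_pos x₀) (htr x₀)
  refine ⟨_, half_pos hpos, ?_⟩
  filter_upwards [hc.eventually (lt_mem_nhds (half_lt_self hpos))] with x hx u v
  refine (mul_le_mul_of_nonneg_right hx.le (by positivity)).trans ?_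
  rw [div_mul_eq_mul_div, div_le_iff₀ (htr x)]
  nlinarith [sq_nonneg (secondForm r ν 1 1 x * u - secondForm r ν 0 1 x * v),
    sq_nonneg (secondForm r ν 0 1 x * u - secondForm r ν 0 0 x * v)]

/-- The squared length of the rotation field satisfies the strong maximum principle. -/
theorem eventually_inner_field_self_eq (h : IsRotationField r ν Y) {x₀ : EuclideanSpace ℝ (Fin 2)}
    (hmax : ∀ x, ⟪Y x, Y x⟫ ≤ ⟪Y x₀, Y x₀⟫) : ∀ᶠ x in 𝓝 x₀, ⟪Y x, Y x⟫ = ⟪Y x₀, Y x₀⟫ := by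
  obtain ⟨C, hC, hbound⟩ := (h.inner_field_secondTrace_isBigO x₀).exists_nonneg
  obtain ⟨θ, hθ, hell⟩ := h.exists_secondForm_elliptic x₀
  have hform := fun i j =>
    (contDiff_secondForm h.contDiff_surface h.contDiff_normal i j).continuous.continuousAt (x := x₀)
  have htr := ((hform 1 1).add (hform 0 0)).eventually (gt_mem_nhds (lt_add_one _))
  obtain ⟨ρ, hρ, hball⟩ := Metric.eventually_nhds_iff_ball.1 (hell.and (htr.and hbound.bound))
  refine eventually_eq_of_forall_le_of_elliptic (f := fun x => ⟪Y x, Y x⟫)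
    (a := secondForm r ν 1 1) (b := fun x => -secondForm r ν 0 1 x) (c := secondForm r ν 0 0)
    (by exact_mod_cast contDiff_infty.1 (h.contDiff_field.inner ℝ h.contDiff_field) 2) hθ
    (mul_nonneg zero_le_two hC) hρ (fun x hx => (hball x hx).1) (fun x hx => (hball x hx).2.1.le)
    (fun x hx => ?_) fun x _ => hmax x
  have h1 := (hball x hx).2.2
  rw [Real.norm_eq_abs, Real.norm_eq_abs, abs_of_nonneg (a := _ + _) (by positivity)] at h1
  rw [h.trace_hessian_inner_field_self]
  have h2 := h.energy_nonneg x (partialDeriv 0 Y x) (partialDeriv 1 Y x)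
  have h3 := neg_abs_le ⟪Y x, secondTrace r ν Y x⟫
  linarith

/-- A rotation field of constant length is constant. -/
theorem field_eq_of_inner_self_eq (h : IsRotationField r ν Y) {c : ℝ} (hc : ∀ x, ⟪Y x, Y x⟫ = c)
    (x y : EuclideanSpace ℝ (Fin 2)) : Y x = Y y := by
  refine is_const_of_fderiv_eq_zero (fun z => h.contDiff_field.differentiableAt_infty z)
    (fun z => fderiv_eq_zero_of_partialDeriv_eq_zero fun i => ?_) x y
  have hf : (fun y => ⟪Y y, Y y⟫) = fun _ => c := funext hc
  have hd : ∀ i, partialDeriv i (fun _ : EuclideanSpace ℝ (Fin 2) => c) = fun _ => 0 := fun i => by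
    funext w
    simp [partialDeriv]
  have hd0 : ∀ i j, partialDeriv i (partialDeriv j fun y => ⟪Y y, Y y⟫) z = 0 := fun i j => by
    rw [hf, hd]
    simp [partialDeriv]
  have h1 := (h.inner_field_secondTrace_isBigO z).eq_zero_imp.self_of_nhds
  have h2 := h.trace_hessian_inner_field_self z
  rw [h1 (by rw [hf, hd, hd]; simp), hd0, hd0, hd0] at h2
  obtain ⟨h3, h4⟩ := h.eq_zero_of_energy_eq_zero (a := partialDeriv 0 Y z)
    (b := partialDeriv 1 Y z) (x := z) (by linarith)
  fin_cases i
  exacts [h3, h4]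

end IsRotationField

theorem cross3_smul_add_smul (y a b : EuclideanSpace ℝ (Fin 3)) (s t : ℝ) :
    cross3 y (s • a + t • b) = s • cross3 y a + t • cross3 y b := by
  simp only [← cross3L_apply, map_add, map_smul]

theorem eq_of_cross3_eq {y z a b : EuclideanSpace ℝ (Fin 3)} (hab : cross3 a b ≠ 0)
    (ha : cross3 y a = cross3 z a) (hb : cross3 y b = cross3 z b) : y = z := by
  have hcoef : ∀ w, ⟪cross3 a b, cross3 a b⟫ • w = ⟪cross3 w b, cross3 a b⟫ • a -
      ⟪cross3 w a, cross3 a b⟫ • b + ⟪cross3 w a, b⟫ • cross3 a b := fun w => by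
    rw [triple_smul_eq_expansion a b (cross3 a b) w, cross3_comm (cross3 a b) a,
      inner_neg_right, neg_smul, ← sub_eq_add_neg, real_inner_comm, ← inner_cross3_cyclic w b,
      real_inner_comm _ w, ← inner_cross3_cyclic w a, real_inner_comm _ w,
      ← inner_cross3_cyclic w a]
  have h := hcoef y
  rw [ha, hb, ← hcoef z] at h
  rw [← inv_smul_smul₀ (inner_self_ne_zero (𝕜 := ℝ).2 hab) y, h, inv_smul_smul₀
    (inner_self_ne_zero (𝕜 := ℝ).2 hab)]

theorem cross3_self (a : EuclideanSpace ℝ (Fin 3)) : cross3 a a = 0 := by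
  ext i
  fin_cases i <;> simp [cross3_zero, cross3_one, cross3_two, mul_comm]

theorem cross3_rotation_left {a b s t : EuclideanSpace ℝ (Fin 3)} (hs : ⟪s, a⟫ = 0) :
    cross3 (⟪s, b⟫ • cross3 a b + ⟪t, cross3 a b⟫ • a - ⟪s, cross3 a b⟫ • b) a =
      ⟪cross3 a b, cross3 a b⟫ • s := by
  rw [triple_smul_eq_dual_expansion a b (cross3 a b) s, hs]
  simp only [← cross3L_apply, map_add, map_sub, map_smul, add_apply, sub_apply, smul_apply]
  simp only [cross3L_apply, cross3_self, cross3_comm b a]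
  module

theorem cross3_rotation_right {a b s t : EuclideanSpace ℝ (Fin 3)} (ht : ⟪t, b⟫ = 0)
    (hst : ⟪t, a⟫ = -⟪s, b⟫) :
    cross3 (⟪s, b⟫ • cross3 a b + ⟪t, cross3 a b⟫ • a - ⟪s, cross3 a b⟫ • b) b =
      ⟪cross3 a b, cross3 a b⟫ • t := by
  rw [triple_smul_eq_dual_expansion a b (cross3 a b) t, ht, hst]
  simp only [← cross3L_apply, map_add, map_sub, map_smul, add_apply, sub_apply, smul_apply]
  simp only [cross3L_apply, cross3_self, cross3_comm b (cross3 a b)]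
  module

/-- A bending of a parametrized convex surface has a rotation field. -/
theorem exists_isRotationField {r ν τ : EuclideanSpace ℝ (Fin 2) → EuclideanSpace ℝ (Fin 3)}
    (hr : ContDiff ℝ ∞ r) (hν : ContDiff ℝ ∞ ν) (hτ : ContDiff ℝ ∞ τ) (hnorm : ∀ x, ‖ν x‖ = 1)
    (hnormal : ∀ x v, ⟪ν x, fderiv ℝ r x v⟫ = 0)
    (hconv : ∀ x v, v ≠ 0 → 0 < ⟪fderiv ℝ r x v, fderiv ℝ ν x v⟫)
    (hbend : ∀ x v w, ⟪fderiv ℝ r x v, fderiv ℝ τ x w⟫ + ⟪fderiv ℝ r x w, fderiv ℝ τ x v⟫ = 0) :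
    ∃ Y, IsRotationField r ν Y ∧
      (∀ x, cross3 (partialDeriv 0 r x) (partialDeriv 1 r x) ≠ 0) ∧
      ∀ x v, cross3 (Y x) (fderiv ℝ r x v) = fderiv ℝ τ x v := by
  have hin : ∀ x i, ⟪partialDeriv i r x, ν x⟫ = 0 := fun x i => by
    rw [real_inner_comm]
    exact hnormal x _
  have hzero : ∀ i x, partialDeriv i
      (0 : EuclideanSpace ℝ (Fin 2) → EuclideanSpace ℝ (Fin 3)) x = 0 :=
    fun i x => by simp [partialDeriv]
  have hrot : IsRotationField r ν 0 :=
    ⟨hr, hν, contDiff_const, hnorm, hin, hconv, fun x => by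
      simp only [hzero, ← cross3L_apply, map_zero, zero_apply]⟩
  have hne : ∀ x, cross3 (partialDeriv 0 r x) (partialDeriv 1 r x) ≠ 0 := fun x h0 =>
    hrot.triple_surface_ne_zero x (by rw [h0, inner_zero_left])
  have hr' := fun i => hr.partialDeriv_infty i
  have hτ' := fun i => hτ.partialDeriv_infty i
  have hN := (hr' 0).cross3 (hr' 1)
  set N := fun x => cross3 (partialDeriv 0 r x) (partialDeriv 1 r x) with hN_def
  set Y : EuclideanSpace ℝ (Fin 2) → EuclideanSpace ℝ (Fin 3) := fun x => ⟪N x, N x⟫⁻¹ •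
    (⟪partialDeriv 0 τ x, partialDeriv 1 r x⟫ • N x + ⟪partialDeriv 1 τ x, N x⟫ • partialDeriv 0 r x
      - ⟪partialDeriv 0 τ x, N x⟫ • partialDeriv 1 r x) with hY_def
  have hY : ContDiff ℝ ∞ Y :=
    ((hN.inner ℝ hN).inv fun x => inner_self_ne_zero.2 (hne x)).smul
      (((((hτ' 0).inner ℝ (hr' 1)).smul hN).add (((hτ' 1).inner ℝ hN).smul (hr' 0))).sub
        (((hτ' 0).inner ℝ hN).smul (hr' 1)))
  have hb00 : ∀ x, ⟪partialDeriv 0 τ x, partialDeriv 0 r x⟫ = 0 := fun x => by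
    have := hbend x (EuclideanSpace.single 0 1) (EuclideanSpace.single 0 1)
    rw [real_inner_comm]
    simp only [partialDeriv]
    linarith
  have hb11 : ∀ x, ⟪partialDeriv 1 τ x, partialDeriv 1 r x⟫ = 0 := fun x => by
    have := hbend x (EuclideanSpace.single 1 1) (EuclideanSpace.single 1 1)
    rw [real_inner_comm]
    simp only [partialDeriv]
    linarith
  have hb10 : ∀ x, ⟪partialDeriv 1 τ x, partialDeriv 0 r x⟫ =
      -⟪partialDeriv 0 τ x, partialDeriv 1 r x⟫ := fun x => by
    have := hbend x (EuclideanSpace.single 0 1) (EuclideanSpace.single 1 1)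
    rw [real_inner_comm, real_inner_comm (partialDeriv 1 r x)]
    simp only [partialDeriv]
    linarith
  have hcross : ∀ x i, cross3 (Y x) (partialDeriv i r x) = partialDeriv i τ x := by
    intro x i
    have hs : ∀ w c, cross3 (⟪N x, N x⟫⁻¹ • w) c = ⟪N x, N x⟫⁻¹ • cross3 w c := fun w c => by
      simp only [← cross3L_apply, map_smul, smul_apply]
    rw [hY_def, hs, inv_smul_eq_iff₀ (inner_self_ne_zero.2 (hne x))]
    fin_cases i
    exacts [cross3_rotation_left (hb00 x), cross3_rotation_right (hb11 x) (hb10 x)]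
  refine ⟨Y, ⟨hr, hν, hY, hnorm, hin, hconv, fun x => ?_⟩, hne, fun x v => ?_⟩
  · have hd : ∀ i j, cross3 (Y x) (partialDeriv j (partialDeriv i r) x) +
        cross3 (partialDeriv j Y x) (partialDeriv i r x) =
        partialDeriv j (partialDeriv i τ) x := fun i j => by
      rw [← partialDeriv_cross3 (hY.differentiableAt_infty x) ((hr' i).differentiableAt_infty x)]
      exact congrArg (fun f => partialDeriv j f x) (funext fun y => hcross y i)
    have h1 := hd 1 0
    rw [partialDeriv_comm_infty hr 0 1, partialDeriv_comm_infty hτ 0 1, ← hd 0 1] at h1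
    exact add_left_cancel h1
  · rw [fderiv_apply_eq_partialDeriv, fderiv_apply_eq_partialDeriv, cross3_smul_add_smul, hcross,
      hcross]

section Sphere

/-- The inverse of the stereographic chart of the sphere at `q`. -/
noncomputable def sphereParam (q : Metric.sphere (0 : EuclideanSpace ℝ (Fin 3)) 1) :
    EuclideanSpace ℝ (Fin 2) → Metric.sphere (0 : EuclideanSpace ℝ (Fin 3)) 1 :=
  (chartAt (EuclideanSpace ℝ (Fin 2)) q).symm

variable (q : Metric.sphere (0 : EuclideanSpace ℝ (Fin 3)) 1)

theorem chartAt_sphere_target : (chartAt (EuclideanSpace ℝ (Fin 2)) q).target = Set.univ :=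
  have := Fact.mk (@finrank_euclideanSpace_fin ℝ _ 3)
  stereographic'_target (-q)

theorem contMDiff_sphereParam :
    ContMDiff 𝓘(ℝ, EuclideanSpace ℝ (Fin 2)) (𝓡 2) ∞ (sphereParam q) := by
  have h := contMDiffOn_chart_symm (I := 𝓡 2) (n := ∞) (x := q)
  rwa [chartAt_sphere_target, contMDiffOn_univ] at h

theorem sphereParam_chartAt {p q : Metric.sphere (0 : EuclideanSpace ℝ (Fin 3)) 1}
    (hp : p ∈ (chartAt (EuclideanSpace ℝ (Fin 2)) q).source) :
    sphereParam q (chartAt (EuclideanSpace ℝ (Fin 2)) q p) = p :=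
  (chartAt (EuclideanSpace ℝ (Fin 2)) q).left_inv hp

theorem eventually_sphere_of_eventually {P : Metric.sphere (0 : EuclideanSpace ℝ (Fin 3)) 1 → Prop}
    (h : ∀ᶠ x in 𝓝 (chartAt (EuclideanSpace ℝ (Fin 2)) q q), P (sphereParam q x)) :
    ∀ᶠ p in 𝓝 q, P p := by
  have hs := mem_chart_source (EuclideanSpace ℝ (Fin 2)) q
  filter_upwards [((chartAt (EuclideanSpace ℝ (Fin 2)) q).continuousAt hs).eventually h,
    (chartAt (EuclideanSpace ℝ (Fin 2)) q).open_source.mem_nhds hs] with p h1 h2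
  rwa [sphereParam_chartAt h2] at h1

theorem exists_sphereParam_eq : ∃ x, sphereParam q x = q :=
  ⟨_, sphereParam_chartAt (mem_chart_source (EuclideanSpace ℝ (Fin 2)) q)⟩

theorem mfderiv_sphereParam_injective (x : EuclideanSpace ℝ (Fin 2)) :
    Function.Injective (mfderiv 𝓘(ℝ, EuclideanSpace ℝ (Fin 2)) (𝓡 2) (sphereParam q) x) := by
  have h := (mdifferentiable_chart (I := 𝓡 2) q).comp_symm_deriv (x := x)
    (by simp [chartAt_sphere_target])
  intro v w hvw
  have hv := congrArg (fun L => L v) h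
  have hw := congrArg (fun L => L w) h
  exact hv.symm.trans ((congrArg _ hvw).trans hw)

theorem mfderiv_sphereParam_surjective (x : EuclideanSpace ℝ (Fin 2)) :
    Function.Surjective (mfderiv 𝓘(ℝ, EuclideanSpace ℝ (Fin 2)) (𝓡 2) (sphereParam q) x) := by
  have h := (mdifferentiable_chart (I := 𝓡 2) q).symm_comp_deriv (x := sphereParam q x)
    ((chartAt (EuclideanSpace ℝ (Fin 2)) q).map_target (by simp [chartAt_sphere_target]))
  rw [show chartAt (EuclideanSpace ℝ (Fin 2)) q (sphereParam q x) = x from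
    (chartAt (EuclideanSpace ℝ (Fin 2)) q).right_inv (by simp [chartAt_sphere_target])] at h
  exact fun v => ⟨_, congrArg (fun L => L v) h⟩

variable {V : Type*} [NormedAddCommGroup V] [NormedSpace ℝ V]
  {F : Metric.sphere (0 : EuclideanSpace ℝ (Fin 3)) 1 → V}

theorem ContMDiff.contDiff_comp_sphereParam (hF : ContMDiff (𝓡 2) 𝓘(ℝ, V) ∞ F) :
    ContDiff ℝ ∞ (F ∘ sphereParam q) :=
  (hF.comp (contMDiff_sphereParam q)).contDiff

theorem ContMDiff.fderiv_comp_sphereParam (hF : ContMDiff (𝓡 2) 𝓘(ℝ, V) ∞ F)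
    (x v : EuclideanSpace ℝ (Fin 2)) :
    fderiv ℝ (F ∘ sphereParam q) x v = mfderiv (𝓡 2) 𝓘(ℝ, V) F (sphereParam q x)
      (mfderiv 𝓘(ℝ, EuclideanSpace ℝ (Fin 2)) (𝓡 2) (sphereParam q) x v) := by
  rw [← mfderiv_eq_fderiv, mfderiv_comp x ((hF _).mdifferentiableAt (by simp))
    ((contMDiff_sphereParam q x).mdifferentiableAt (by simp))]
  rfl

instance : PreconnectedSpace (Metric.sphere (0 : EuclideanSpace ℝ (Fin 3)) 1) :=
  Subtype.preconnectedSpace (isPreconnected_sphere (by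
    rw [← Module.finrank_eq_rank, finrank_euclideanSpace_fin]; norm_num) _ _)

theorem eq_of_comp_sphereParam_eq {α : Type*}
    {g : Metric.sphere (0 : EuclideanSpace ℝ (Fin 3)) 1 → α}
    (hg : ∀ q x y, g (sphereParam q x) = g (sphereParam q y))
    (p p' : Metric.sphere (0 : EuclideanSpace ℝ (Fin 3)) 1) : g p = g p' := by
  refine ((IsLocallyConstant.iff_eventually_eq g).2 fun q => ?_).apply_eq_of_preconnectedSpace p p'
  obtain ⟨y, hy⟩ := exists_sphereParam_eq q
  refine eventually_sphere_of_eventually q (Eventually.of_forall fun x => ?_)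
  rw [hg q x y, hy]

end Sphere

/-- Infinitesimal rigidity of closed strictly convex surfaces in `ℝ³`: if
`r : S² → ℝ³` is a smooth strictly convex immersion with smooth unit normal `ν`, and
`τ : S² → ℝ³` is a smooth solution of the linearized isometry equation
`⟨dr(v), dτ(w)⟩ + ⟨dr(w), dτ(v)⟩ = 0`, then `τ = A × r + B` for constant vectors
`A, B ∈ ℝ³`. -/
theorem infinitesimal_rigidity_convex_surface
    (r ν τ : (Metric.sphere (0 : EuclideanSpace ℝ (Fin 3)) 1) → EuclideanSpace ℝ (Fin 3))
    (hr : ContMDiff (𝓡 2) 𝓘(ℝ, EuclideanSpace ℝ (Fin 3)) (⊤ : ℕ∞) r)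
    (himm : ∀ p, Function.Injective
      (mfderiv (𝓡 2) 𝓘(ℝ, EuclideanSpace ℝ (Fin 3)) r p))
    (hν : ContMDiff (𝓡 2) 𝓘(ℝ, EuclideanSpace ℝ (Fin 3)) (⊤ : ℕ∞) ν)
    (hνunit : ∀ p, ‖ν p‖ = 1)
    (hνnormal : ∀ p (v : EuclideanSpace ℝ (Fin 2)),
      ⟪ν p, mfderiv (𝓡 2) 𝓘(ℝ, EuclideanSpace ℝ (Fin 3)) r p v⟫ = 0)
    (hconv : ∀ p (v : EuclideanSpace ℝ (Fin 2)), v ≠ 0 →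
      0 < ⟪mfderiv (𝓡 2) 𝓘(ℝ, EuclideanSpace ℝ (Fin 3)) ν p v,
            mfderiv (𝓡 2) 𝓘(ℝ, EuclideanSpace ℝ (Fin 3)) r p v⟫)
    (hτ : ContMDiff (𝓡 2) 𝓘(ℝ, EuclideanSpace ℝ (Fin 3)) (⊤ : ℕ∞) τ)
    (heq : ∀ p (v w : EuclideanSpace ℝ (Fin 2)),
      ⟪mfderiv (𝓡 2) 𝓘(ℝ, EuclideanSpace ℝ (Fin 3)) r p v,
        mfderiv (𝓡 2) 𝓘(ℝ, EuclideanSpace ℝ (Fin 3)) τ p w⟫ +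
      ⟪mfderiv (𝓡 2) 𝓘(ℝ, EuclideanSpace ℝ (Fin 3)) r p w,
        mfderiv (𝓡 2) 𝓘(ℝ, EuclideanSpace ℝ (Fin 3)) τ p v⟫ = 0) :
    ∃ A B : EuclideanSpace ℝ (Fin 3), ∀ p, τ p = cross3 A (r p) + B := by
  have hin : ∀ q x v, ⟪ν (sphereParam q x), fderiv ℝ (r ∘ sphereParam q) x v⟫ = 0 :=
    fun q x v => by
      rw [hr.fderiv_comp_sphereParam]
      exact hνnormal _ _
  have hchart := fun q => exists_isRotationField (hr.contDiff_comp_sphereParam q)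
    (hν.contDiff_comp_sphereParam q) (hτ.contDiff_comp_sphereParam q) (fun x => hνunit _) (hin q)
    (fun x v hv => by
      rw [real_inner_comm, hr.fderiv_comp_sphereParam, hν.fderiv_comp_sphereParam]
      exact hconv _ _ fun h0 => hv (mfderiv_sphereParam_injective q x
        (h0.trans (map_zero (mfderiv 𝓘(ℝ, EuclideanSpace ℝ (Fin 2)) (𝓡 2)
          (sphereParam q) x)).symm)))
    (fun x v w => by
      rw [hr.fderiv_comp_sphereParam, hr.fderiv_comp_sphereParam, hτ.fderiv_comp_sphereParam,
        hτ.fderiv_comp_sphereParam]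
      exact heq _ _ _)
  choose Z hZ hne hZr using hchart
  have hex : ∀ p, ∃ y, ∀ v : EuclideanSpace ℝ (Fin 2),
      cross3 y (mfderiv (𝓡 2) 𝓘(ℝ, EuclideanSpace ℝ (Fin 3)) r p v) =
        mfderiv (𝓡 2) 𝓘(ℝ, EuclideanSpace ℝ (Fin 3)) τ p v := by
    intro p
    obtain ⟨q, x, rfl⟩ : ∃ q x, sphereParam q x = p := ⟨p, exists_sphereParam_eq p⟩
    refine ⟨Z q x, fun v => ?_⟩
    obtain ⟨w, rfl⟩ := mfderiv_sphereParam_surjective q x v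
    exact (congrArg (cross3 (Z q x)) (hr.fderiv_comp_sphereParam q x w).symm).trans
      ((hZr q x w).trans (hτ.fderiv_comp_sphereParam q x w))
  choose Y hY using hex
  have hYZ : ∀ q x, Y (sphereParam q x) = Z q x := fun q x => by
    have h1 : ∀ v, cross3 (Y (sphereParam q x)) (fderiv ℝ (r ∘ sphereParam q) x v) =
        cross3 (Z q x) (fderiv ℝ (r ∘ sphereParam q) x v) := fun v => by
      rw [hZr, hr.fderiv_comp_sphereParam, hτ.fderiv_comp_sphereParam]
      exact hY _ _
    exact eq_of_cross3_eq (hne q x) (h1 _) (h1 _)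
  set f : Metric.sphere (0 : EuclideanSpace ℝ (Fin 3)) 1 → ℝ := fun p => ⟪Y p, Y p⟫ with hf
  have hfZ : ∀ q x, f (sphereParam q x) = ⟪Z q x, Z q x⟫ := fun q x => by
    simp only [hf, hYZ]
  have hfc : Continuous f := continuous_iff_continuousAt.2 fun q => by
    have h1 : ContinuousAt (fun x => ⟪Z q x, Z q x⟫) (chartAt (EuclideanSpace ℝ (Fin 2)) q q) :=
      ((hZ q).contDiff_field.inner ℝ (hZ q).contDiff_field).continuous.continuousAt
    intro s hs
    refine eventually_sphere_of_eventually q ?_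
    simp only [hfZ]
    refine h1 ?_
    beta_reduce
    rwa [← hfZ, sphereParam_chartAt (mem_chart_source (EuclideanSpace ℝ (Fin 2)) q)]
  have : Nonempty (Metric.sphere (0 : EuclideanSpace ℝ (Fin 3)) 1) :=
    (NormedSpace.sphere_nonempty.2 zero_le_one).to_subtype
  obtain ⟨p₀, -, hp₀⟩ := isCompact_univ.exists_isMaxOn Set.univ_nonempty hfc.continuousOn
  have huniv : {p | f p = f p₀} = Set.univ := by
    refine IsClopen.eq_univ ⟨isClosed_eq hfc continuous_const, ?_⟩ ⟨p₀, rfl⟩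
    refine isOpen_iff_mem_nhds.2 fun q hq => eventually_sphere_of_eventually q ?_
    have hx := sphereParam_chartAt (mem_chart_source (EuclideanSpace ℝ (Fin 2)) q)
    have hmax := (hZ q).eventually_inner_field_self_eq
      (x₀ := chartAt (EuclideanSpace ℝ (Fin 2)) q q) fun x => by
        rw [← hfZ, ← hfZ, hx, show f q = f p₀ from hq]
        exact hp₀ (Set.mem_univ _)
    filter_upwards [hmax] with x h1
    rw [← hfZ, ← hfZ, hx] at h1
    exact h1.trans hq
  have hYc := eq_of_comp_sphereParam_eq (g := Y) fun q x y => by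
    rw [hYZ, hYZ]
    refine (hZ q).field_eq_of_inner_self_eq (c := f p₀) (fun z => ?_) x y
    rw [← hfZ]
    exact Set.eq_univ_iff_forall.1 huniv _
  have hB := eq_of_comp_sphereParam_eq (g := fun p => τ p - cross3 (Y p₀) (r p)) fun q x y => by
    have hd1 : ∀ z, DifferentiableAt ℝ (τ ∘ sphereParam q) z := fun z =>
      (hτ.contDiff_comp_sphereParam q).differentiableAt_infty z
    have hd2 : ∀ z, DifferentiableAt ℝ (r ∘ sphereParam q) z := fun z =>
      (hr.contDiff_comp_sphereParam q).differentiableAt_infty z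
    have hd3 := fun z => (hd1 z).hasFDerivAt.sub
      ((cross3L (Y p₀)).hasFDerivAt.comp z (hd2 z).hasFDerivAt)
    refine is_const_of_fderiv_eq_zero (𝕜 := ℝ) (fun z => (hd3 z).differentiableAt)
      (fun z => (hd3 z).fderiv.trans ?_) x y
    ext1 v
    have h1 := hZr q z v
    rw [← hYZ, hYc _ p₀] at h1
    exact sub_eq_zero.2 h1.symm
  exact ⟨Y p₀, τ p₀ - cross3 (Y p₀) (r p₀), fun p => sub_eq_iff_eq_add'.1 (hB p p₀)⟩
end

section
/- Let S² be the unit 2-sphere as a smooth manifold, and let r : S² → ℝ³ be a smooth immersion admitting a smooth unit normal ν : S² → ℝ³ (i.e. ‖ν(p)‖ = 1 and ⟨ν(p), dr_p(v)⟩ = 0 for every p and every tangent vector v at p) that is strictly convex in the sense that ⟨dν_p(v), dr_p(v)⟩ > 0 for every p and every nonzero tangent vector v at p. Then the real vector space of smooth maps τ : S² → ℝ³ satisfying ⟨dr_p(v), dτ_p(w)⟩ + ⟨dr_p(w), dτ_p(v)⟩ = 0 for all p ∈ S² and all tangent vectors v, w has dimension exactly 6. -/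
open scoped RealInnerProductSpace Manifold

/-- The tangent spaces of the Euclidean model carry the Euclidean inner product. -/
noncomputable instance tangentSpaceInner' {n : ℕ} (x : EuclideanSpace ℝ (Fin n)) :
    Inner ℝ (TangentSpace 𝓘(ℝ, EuclideanSpace ℝ (Fin n)) x) :=
  inferInstanceAs (Inner ℝ (EuclideanSpace ℝ (Fin n)))

/-- A map `τ : S² → ℝ³` is an infinitesimal isometric deformation of the immersion `r`
if it is smooth and satisfies `⟨dr(v), dτ(w)⟩ + ⟨dr(w), dτ(v)⟩ = 0` everywhere. -/
def IsInfinitesimalDeformation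
    (r τ : (Metric.sphere (0 : EuclideanSpace ℝ (Fin 3)) 1) → EuclideanSpace ℝ (Fin 3)) :
    Prop :=
  ContMDiff (𝓡 2) 𝓘(ℝ, EuclideanSpace ℝ (Fin 3)) (⊤ : ℕ∞) τ ∧
  ∀ p (v w : EuclideanSpace ℝ (Fin 2)),
    ⟪mfderiv (𝓡 2) 𝓘(ℝ, EuclideanSpace ℝ (Fin 3)) r p v,
      mfderiv (𝓡 2) 𝓘(ℝ, EuclideanSpace ℝ (Fin 3)) τ p w⟫ +
    ⟪mfderiv (𝓡 2) 𝓘(ℝ, EuclideanSpace ℝ (Fin 3)) r p w,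
      mfderiv (𝓡 2) 𝓘(ℝ, EuclideanSpace ℝ (Fin 3)) τ p v⟫ = 0

/-- The complement of a countable subset of the `2`-sphere is preconnected. -/
theorem isPreconnected_compl_countable_sphere
    {F : Set (Metric.sphere (0 : EuclideanSpace ℝ (Fin 3)) 1)} (hF : F.Countable) :
    IsPreconnected Fᶜ := by
  have : Fact (Module.finrank ℝ (EuclideanSpace ℝ (Fin 3)) = 2 + 1) := ⟨by simp⟩
  rcases F.eq_empty_or_nonempty with rfl | ⟨u, hu⟩
  · rw [Set.compl_empty, ← Topology.IsInducing.subtypeVal.isPreconnected_image, Set.image_univ,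
      Subtype.range_coe]
    refine isPreconnected_sphere ?_ _ _
    rw [← Module.finrank_eq_rank]
    simp
  · set φ := stereographic' 2 u
    have hsymm : ∀ y, φ (φ.symm y) = y := fun y => φ.right_inv (by simp [φ])
    have himage : Fᶜ = φ.symm '' (φ.symm ⁻¹' F)ᶜ := by
      ext x
      constructor
      · intro hx
        have hxs : x ∈ φ.source := by
          simp only [φ, stereographic'_source]
          rintro rfl
          exact hx hu
        exact ⟨φ x, by simpa [φ.left_inv hxs] using hx, φ.left_inv hxs⟩
      · rintro ⟨y, hy, rfl⟩
        exact hy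
    have hcont : Continuous φ.symm := by
      have := φ.continuousOn_symm
      rwa [show φ.target = Set.univ from stereographic'_target u, ← continuousOn_univ.symm] at this
    rw [himage]
    refine IsPreconnected.image ?_ _ hcont.continuousOn
    refine (Set.Countable.isConnected_compl_of_one_lt_rank ?_ ?_).isPreconnected
    · rw [← Module.finrank_eq_rank]
      simp
    · exact hF.preimage (Function.LeftInverse.injective hsymm)

/-- A local homeomorphism of the `2`-sphere into itself is injective. -/
theorem IsLocalHomeomorph.injective_sphere
    {p : Metric.sphere (0 : EuclideanSpace ℝ (Fin 3)) 1 →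
      Metric.sphere (0 : EuclideanSpace ℝ (Fin 3)) 1}
    (hp : IsLocalHomeomorph p) : Function.Injective p := by
  have : Fact (Module.finrank ℝ (EuclideanSpace ℝ (Fin 3)) = 2 + 1) := ⟨by simp⟩
  have cov : IsCoveringMap p := isLocalHomeomorph_iff_isCoveringMap.mp hp
  intro e₀ e₁ he
  set u := -p e₀ with hu
  set φ := stereographic' 2 u with hφ
  have hright : ∀ y, φ (φ.symm y) = y := fun y => φ.right_inv (by simp [φ])
  have hleft : ∀ x, x ≠ u → φ.symm (φ x) = x := fun x hx =>
    φ.left_inv (by simpa [φ, stereographic'_source] using hx)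
  have hcont : Continuous φ.symm := by
    have := φ.continuousOn_symm
    rwa [show φ.target = Set.univ from stereographic'_target u, ← continuousOn_univ.symm] at this
  have hne : ∀ y, φ.symm y ≠ u := fun y => by
    have := φ.map_target (x := y) (by simp [φ])
    simpa [φ, stereographic'_source] using this
  have hopen : IsOpenMap φ.symm := by
    refine (φ.symm.isOpenEmbedding ?_).isOpenMap
    simp [φ]
  have hlift : ∀ e, p e ≠ u → ∃ G : C(EuclideanSpace ℝ (Fin 2), _),
      G (φ (p e)) = e ∧ p ∘ G = φ.symm := fun e h =>
    (cov.existsUnique_continuousMap_lifts ⟨φ.symm, hcont⟩ (φ (p e)) e (hleft _ h).symm).exists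
  have : Nonempty C(EuclideanSpace ℝ (Fin 2), Metric.sphere (0 : EuclideanSpace ℝ (Fin 3)) 1) :=
    ⟨⟨φ.symm, hcont⟩⟩
  choose! G hG hpG using hlift
  have hGopen : ∀ e, p e ≠ u → IsOpen (Set.range (G e)) := by
    intro e h
    have hl : IsLocalHomeomorph (G e) := by
      refine IsLocalHomeomorph.of_comp (g := p) ?_ hp (G e).continuous
      rw [hpG e h]
      exact (φ.symm.isOpenEmbedding (by simp [φ])).isLocalHomeomorph
    exact hl.isOpenMap.isOpen_range
  have hval : ∀ e, p e ≠ u → ∀ y, p (G e y) = φ.symm y := fun e h y => congrFun (hpG e h) y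
  have hu₀ : p e₀ ≠ u := by
    intro h
    exact ne_neg_of_mem_unit_sphere ℝ (p e₀) h
  have hconn : IsPreconnected (p ⁻¹' {u})ᶜ := by
    refine isPreconnected_compl_countable_sphere (Set.Finite.countable ?_)
    have := (cov u).1
    have : CompactSpace (p ⁻¹' {u}) :=
      isCompact_iff_compactSpace.mp (isClosed_singleton.preimage cov.continuous).isCompact
    exact finite_of_compact_of_discrete
  have hsep := hconn (Set.range (G e₀)) (⋃ e ∈ {e | p e ≠ u ∧ e ∉ Set.range (G e₀)}, Set.range (G e))
    (hGopen e₀ hu₀) (isOpen_biUnion fun e h => hGopen e h.1) ?_ ⟨e₀, hu₀, _, hG e₀ hu₀⟩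
  · by_contra hne'
    have he₁ : e₁ ∉ Set.range (G e₀) := by
      rintro ⟨y, hy⟩
      have h1 : φ.symm y = p e₁ := by rw [← hy, hval e₀ hu₀]
      have h2 : y = φ (p e₀) := by rw [he, ← h1, hright]
      exact hne' (by rw [← hy, h2, hG e₀ hu₀])
    obtain ⟨z, hz, ⟨y, rfl⟩, hz'⟩ := hsep ⟨e₁, by rw [Set.mem_compl_iff, Set.mem_preimage, ← he]; exact hu₀,
      Set.mem_biUnion (show e₁ ∈ _ from ⟨he ▸ hu₀, he₁⟩) ⟨_, hG e₁ (he ▸ hu₀)⟩⟩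
    simp only [Set.mem_ofPred_eq, Set.mem_iUnion] at hz'
    obtain ⟨e, ⟨h, h'⟩, y', hy'⟩ := hz'
    have hyy : y' = y := by
      rw [← hright y, ← hright y', ← hval e h, hy', hval e₀ hu₀]
    subst hyy
    have : (G e : _ → _) = G e₀ := cov.eq_of_comp_eq (G e).continuous (G e₀).continuous
      (by rw [hpG e h, hpG e₀ hu₀]) y' hy'
    exact h' (this ▸ ⟨_, hG e h⟩)
  · intro e h
    by_cases h' : e ∈ Set.range (G e₀)
    · exact Or.inl h'
    · exact Or.inr (Set.mem_biUnion (show e ∈ _ from ⟨h, h'⟩) ⟨_, hG e h⟩)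
open scoped ContDiff

namespace InfinitesimalRigidity

/-- Euclidean three-space. -/
abbrev R3 := EuclideanSpace ℝ (Fin 3)

theorem inner_coord (a b : R3) : ⟪a, b⟫ = a 0 * b 0 + a 1 * b 1 + a 2 * b 2 := by
  simp only [PiLp.inner_apply, Fin.sum_univ_three, RCLike.inner_apply, conj_trivial]
  ring

theorem ext_coord {a b : R3} (h0 : a 0 = b 0) (h1 : a 1 = b 1) (h2 : a 2 = b 2) : a = b := by
  ext i
  fin_cases i <;> assumption

/-- The cross product on Euclidean three-space. -/
noncomputable def cross : R3 →L[ℝ] R3 →L[ℝ] R3 :=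
  LinearMap.toContinuousBilinearMap <| LinearMap.mk₂ ℝ
    (fun a b => !₂[a 1 * b 2 - a 2 * b 1, a 2 * b 0 - a 0 * b 2, a 0 * b 1 - a 1 * b 0])
    (fun a a' b => by apply ext_coord <;> simp <;> ring)
    (fun c a b => by apply ext_coord <;> simp <;> ring)
    (fun a b b' => by apply ext_coord <;> simp <;> ring)
    (fun c a b => by apply ext_coord <;> simp <;> ring)

@[simp] theorem cross_zero (a b : R3) : cross a b 0 = a 1 * b 2 - a 2 * b 1 := rfl
@[simp] theorem cross_one (a b : R3) : cross a b 1 = a 2 * b 0 - a 0 * b 2 := rfl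
@[simp] theorem cross_two (a b : R3) : cross a b 2 = a 0 * b 1 - a 1 * b 0 := rfl

theorem cross_self (a : R3) : cross a a = 0 := by
  apply ext_coord <;> simp <;> ring

theorem cross_swap (a b : R3) : cross a b = -cross b a := by
  apply ext_coord <;> simp <;> ring

/-- A vector is recovered from its cross products with two vectors. -/
theorem norm_cross_smul_eq (A X Y : R3) :
    ⟪cross X Y, cross X Y⟫ • A =
      ⟪cross A X, Y⟫ • cross X Y + ⟪cross A Y, cross X Y⟫ • X - ⟪cross A X, cross X Y⟫ • Y := by
  apply ext_coord <;> simp only [PiLp.add_apply, PiLp.sub_apply, PiLp.smul_apply, PiLp.neg_apply, smul_eq_mul, inner_coord,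
    cross_zero, cross_one, cross_two] <;> ring

/-- The expansion of a vector in the basis `X, Y, X × Y`. -/
theorem norm_cross_smul_eq_expansion (a X Y : R3) :
    ⟪cross X Y, cross X Y⟫ • a =
      ⟪a, cross X Y⟫ • cross X Y + ⟪a, cross Y (cross X Y)⟫ • X
        + ⟪a, cross (cross X Y) X⟫ • Y := by
  apply ext_coord <;> simp only [PiLp.add_apply, PiLp.sub_apply, PiLp.smul_apply, PiLp.neg_apply, smul_eq_mul, inner_coord,
    cross_zero, cross_one, cross_two] <;> ring

/-- Cramer's rule. -/
theorem triple_smul_eq (u x v w : R3) :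
    ⟪x, cross v w⟫ • u = ⟪u, cross v w⟫ • x + ⟪x, cross u w⟫ • v + ⟪x, cross v u⟫ • w := by
  apply ext_coord <;> simp only [PiLp.add_apply, PiLp.sub_apply, PiLp.smul_apply, PiLp.neg_apply, smul_eq_mul, inner_coord,
    cross_zero, cross_one, cross_two] <;> ring

theorem eq_zero_of_cross_eq_zero {A X Y : R3} (hXY : cross X Y ≠ 0) (hX : cross A X = 0)
    (hY : cross A Y = 0) : A = 0 := by
  have h := norm_cross_smul_eq A X Y
  rw [hX, hY] at h
  simp only [inner_zero_left, zero_smul, add_zero, sub_zero] at h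
  exact (smul_eq_zero.mp h).resolve_left (inner_self_ne_zero.mpr hXY)

/-- Two vectors with vanishing cross product are linearly dependent. -/
theorem exists_of_cross_eq_zero {X Y : R3} (h : cross X Y = 0) :
    ∃ s t : ℝ, (s ≠ 0 ∨ t ≠ 0) ∧ s • X + t • Y = 0 := by
  by_cases hY : Y = 0
  · exact ⟨0, 1, Or.inr one_ne_zero, by simp [hY]⟩
  · refine ⟨⟪Y, Y⟫, -⟪X, Y⟫, Or.inl (inner_self_ne_zero.mpr hY), ?_⟩
    have h0 := congrArg (fun v : R3 => v 0) h
    have h1 := congrArg (fun v : R3 => v 1) h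
    have h2 := congrArg (fun v : R3 => v 2) h
    simp only [cross_zero, cross_one, cross_two, PiLp.zero_apply] at h0 h1 h2
    apply ext_coord <;> simp only [PiLp.zero_apply, PiLp.add_apply, PiLp.sub_apply, PiLp.smul_apply, PiLp.neg_apply, smul_eq_mul, inner_coord,
    cross_zero, cross_one, cross_two]
    · linear_combination Y 1 * h2 - Y 2 * h1
    · linear_combination Y 2 * h0 - Y 0 * h2
    · linear_combination Y 0 * h1 - Y 1 * h0

/-- The infinitesimal rotation taking `X, Y` to `X', Y'`. -/
noncomputable def rotation (X Y X' Y' : R3) : R3 :=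
  (⟪cross X Y, cross X Y⟫)⁻¹ •
    (⟪X', Y⟫ • cross X Y + ⟪Y', cross X Y⟫ • X - ⟪X', cross X Y⟫ • Y)

theorem cross_rotation {X Y X' Y' : R3} (hXY : cross X Y ≠ 0) (h11 : ⟪X, X'⟫ = 0)
    (h12 : ⟪X, Y'⟫ + ⟪Y, X'⟫ = 0) (h22 : ⟪Y, Y'⟫ = 0) :
    cross (rotation X Y X' Y') X = X' ∧ cross (rotation X Y X' Y') Y = Y' := by
  have hne : ⟪cross X Y, cross X Y⟫ ≠ 0 := inner_self_ne_zero.mpr hXY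
  simp only [rotation, map_smul, smul_apply]
  rw [inv_smul_eq_iff₀ hne, inv_smul_eq_iff₀ hne]
  clear hne hXY
  simp only [inner_coord, cross_zero, cross_one, cross_two] at *
  constructor
  · apply ext_coord <;> simp only [PiLp.zero_apply, PiLp.add_apply, PiLp.sub_apply, PiLp.smul_apply, PiLp.neg_apply, smul_eq_mul, inner_coord,
    cross_zero, cross_one, cross_two]
    · linear_combination (norm := (simp only [cross_zero, cross_one, cross_two]; ring1)) (-(cross Y (cross X Y) 0)) * h11
    · linear_combination (norm := (simp only [cross_zero, cross_one, cross_two]; ring1)) (-(cross Y (cross X Y) 1)) * h11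
    · linear_combination (norm := (simp only [cross_zero, cross_one, cross_two]; ring1)) (-(cross Y (cross X Y) 2)) * h11
  · apply ext_coord <;> simp only [PiLp.zero_apply, PiLp.add_apply, PiLp.sub_apply, PiLp.smul_apply, PiLp.neg_apply, smul_eq_mul, inner_coord,
    cross_zero, cross_one, cross_two]
    · linear_combination (norm := (simp only [cross_zero, cross_one, cross_two]; ring1)) (-(cross (cross X Y) X 0)) * h22 - cross Y (cross X Y) 0 * h12
    · linear_combination (norm := (simp only [cross_zero, cross_one, cross_two]; ring1)) (-(cross (cross X Y) X 1)) * h22 - cross Y (cross X Y) 1 * h12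
    · linear_combination (norm := (simp only [cross_zero, cross_one, cross_two]; ring1)) (-(cross (cross X Y) X 2)) * h22 - cross Y (cross X Y) 2 * h12

/-- If `b × X = a × Y`, then `a, b` are tangent, and the matrix expressing them in terms of `X, Y`
is trace-free. -/
theorem exists_traceFree {X Y a b : R3} (hXY : cross X Y ≠ 0) (h : cross b X = cross a Y) :
    ∃ α β γ : ℝ, a = α • X + β • Y ∧ b = γ • X - α • Y := by
  have hne : ⟪cross X Y, cross X Y⟫ ≠ 0 := inner_self_ne_zero.mpr hXY
  have h0 := congrArg (fun v : R3 => v 0) h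
  have h1 := congrArg (fun v : R3 => v 1) h
  have h2 := congrArg (fun v : R3 => v 2) h
  simp only [cross_zero, cross_one, cross_two] at h0 h1 h2
  have ha : ⟪a, cross X Y⟫ = 0 := by
    simp only [inner_coord, cross_zero, cross_one, cross_two]
    linear_combination X 0 * h0 + X 1 * h1 + X 2 * h2
  have hb : ⟪b, cross X Y⟫ = 0 := by
    simp only [inner_coord, cross_zero, cross_one, cross_two]
    linear_combination Y 0 * h0 + Y 1 * h1 + Y 2 * h2
  have htr : ⟪b, cross (cross X Y) X⟫ = -⟪a, cross Y (cross X Y)⟫ := by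
    simp only [inner_coord, cross_zero, cross_one, cross_two]
    linear_combination (norm := (simp only [cross_zero, cross_one, cross_two]; ring1)) -(cross X Y 0 * h0 + cross X Y 1 * h1 + cross X Y 2 * h2)
  have ea := norm_cross_smul_eq_expansion a X Y
  have eb := norm_cross_smul_eq_expansion b X Y
  rw [ha, zero_smul, zero_add] at ea
  rw [hb, zero_smul, zero_add, htr] at eb
  refine ⟨⟪cross X Y, cross X Y⟫⁻¹ * ⟪a, cross Y (cross X Y)⟫,
    ⟪cross X Y, cross X Y⟫⁻¹ * ⟪a, cross (cross X Y) X⟫,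
    ⟪cross X Y, cross X Y⟫⁻¹ * ⟪b, cross Y (cross X Y)⟫, ?_, ?_⟩
  · rw [mul_smul, mul_smul, ← smul_add, ← ea, inv_smul_smul₀ hne]
  · rw [mul_smul, mul_smul, ← smul_sub, sub_eq_add_neg, ← neg_smul, ← eb, inv_smul_smul₀ hne]

/-- A trace-free matrix which is symmetric with respect to a positive definite form has
nonpositive determinant, which vanishes only for the zero matrix. -/
theorem traceFree_sign {α β γ L M K : ℝ} (hL : 0 < L) (hdet : 0 < L * K - M ^ 2)
    (h : 2 * α * M + β * K - γ * L = 0) :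
    0 ≤ α ^ 2 + β * γ ∧ (α ^ 2 + β * γ = 0 → α = 0 ∧ β = 0 ∧ γ = 0) := by
  have key : L ^ 2 * (α ^ 2 + β * γ) = (L * α + M * β) ^ 2 + (L * K - M ^ 2) * β ^ 2 := by
    linear_combination (-L * β) * h
  constructor
  · have : 0 ≤ L ^ 2 * (α ^ 2 + β * γ) := by rw [key]; positivity
    exact nonneg_of_mul_nonneg_right this (sq_pos_of_pos hL)
  · intro h0
    rw [h0, mul_zero] at key
    have hβ : β = 0 := by
      have : (L * K - M ^ 2) * β ^ 2 = 0 := by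
        nlinarith [sq_nonneg (L * α + M * β), mul_nonneg hdet.le (sq_nonneg β)]
      exact pow_eq_zero_iff two_ne_zero |>.mp ((mul_eq_zero.mp this).resolve_left hdet.ne')
    subst hβ
    have hα : α = 0 := by simpa [hL.ne'] using key.symm
    subst hα
    refine ⟨rfl, rfl, ?_⟩
    simpa [hL.ne'] using h

/-- The density against the area form of the `2`-form `(v, w) ↦ ⟪c, A v × A w⟫`. -/
noncomputable def density (x c : R3) (A : R3 →L[ℝ] R3) : ℝ :=
  x 0 * ⟪c, cross (A (EuclideanSpace.single 1 1)) (A (EuclideanSpace.single 2 1))⟫ +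
  x 1 * ⟪c, cross (A (EuclideanSpace.single 2 1)) (A (EuclideanSpace.single 0 1))⟫ +
  x 2 * ⟪c, cross (A (EuclideanSpace.single 0 1)) (A (EuclideanSpace.single 1 1))⟫

theorem eq_sum_single (v : R3) : v = v 0 • EuclideanSpace.single 0 1 +
    v 1 • EuclideanSpace.single 1 1 + v 2 • EuclideanSpace.single 2 1 := by
  apply ext_coord <;> simp

theorem density_mul_triple {x c : R3} {A : R3 →L[ℝ] R3} (hA : A x = 0) (v w : R3) :
    density x c A * ⟪x, cross v w⟫ = ⟪x, x⟫ * ⟪c, cross (A v) (A w)⟫ := by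
  have hv := congrArg A (eq_sum_single v)
  have hw := congrArg A (eq_sum_single w)
  have hx := congrArg A (eq_sum_single x)
  rw [hA] at hx
  simp only [map_add, map_smul] at hv hw hx
  rw [hv, hw, density]
  generalize A (EuclideanSpace.single 0 1) = a at *
  generalize A (EuclideanSpace.single 1 1) = b at *
  generalize A (EuclideanSpace.single 2 1) = d at *
  have hx1 := congrArg (fun z => ⟪c, cross z a⟫) hx
  have hx2 := congrArg (fun z => ⟪c, cross z b⟫) hx
  have hx3 := congrArg (fun z => ⟪c, cross z d⟫) hx
  simp only [map_add, map_smul, add_apply, smul_apply,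
    cross_self, smul_zero, inner_add_right, inner_smul_right, inner_zero_right,
    map_zero, zero_apply, zero_add, add_zero] at hx1 hx2 hx3 ⊢
  rw [cross_swap b a, cross_swap d a, inner_neg_right, inner_neg_right] at *
  rw [cross_swap d b, inner_neg_right] at *
  simp only [inner_coord x, cross_zero, cross_one, cross_two]
  linear_combination (norm := (simp only [cross_zero, cross_one, cross_two]; ring1))
    hx1 * cross (cross v w) x 0 + hx2 * cross (cross v w) x 1 + hx3 * cross (cross v w) x 2

/-- Positively homogeneous extensions of degree zero of a strictly convex immersion of the sphere
and of its unit normal. -/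
structure IsConvexPair (R N : R3 → R3) : Prop where
  contDiffAt_fst : ∀ x ≠ 0, ContDiffAt ℝ ∞ R x
  contDiffAt_snd : ∀ x ≠ 0, ContDiffAt ℝ ∞ N x
  radial_fst : ∀ x ≠ 0, fderiv ℝ R x x = 0
  normal : ∀ x ≠ 0, ∀ v, ⟪N x, fderiv ℝ R x v⟫ = 0
  unit : ∀ x ≠ 0, ⟪N x, N x⟫ = 1
  convex : ∀ x ≠ 0, ∀ v, (∀ t : ℝ, v ≠ t • x) → 0 < ⟪fderiv ℝ N x v, fderiv ℝ R x v⟫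

/-- Positively homogeneous extensions of degree zero of an infinitesimal deformation. -/
structure IsRadialDeformation (R T : R3 → R3) : Prop where
  contDiffAt : ∀ x ≠ 0, ContDiffAt ℝ ∞ T x
  radial : ∀ x ≠ 0, fderiv ℝ T x x = 0
  skew : ∀ x ≠ 0, ∀ v w,
    ⟪fderiv ℝ R x v, fderiv ℝ T x w⟫ + ⟪fderiv ℝ R x w, fderiv ℝ T x v⟫ = 0

theorem exists_triple_ne_zero {x : R3} (hx : x ≠ 0) : ∃ v w, ⟪x, cross v w⟫ ≠ 0 := by
  by_contra! h
  apply hx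
  have h0 := h (EuclideanSpace.single 1 1) (EuclideanSpace.single 2 1)
  have h1 := h (EuclideanSpace.single 2 1) (EuclideanSpace.single 0 1)
  have h2 := h (EuclideanSpace.single 0 1) (EuclideanSpace.single 1 1)
  simp [inner_coord] at h0 h1 h2
  exact ext_coord h0 h1 h2

theorem smul_add_smul_ne_smul {x v w : R3} (h : ⟪x, cross v w⟫ ≠ 0) {s t : ℝ}
    (hst : s ≠ 0 ∨ t ≠ 0) (c : ℝ) : s • v + t • w ≠ c • x := by
  intro e
  have ev : s * ⟪x, cross v w⟫ = 0 := by
    have := congrArg (fun z => ⟪x, cross z w⟫) e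
    simp only [inner_coord, cross_zero, cross_one, cross_two, PiLp.add_apply, PiLp.smul_apply,
      smul_eq_mul] at this ⊢
    linear_combination this
  have ew : t * ⟪x, cross v w⟫ = 0 := by
    have := congrArg (fun z => ⟪x, cross v z⟫) e
    simp only [inner_coord, cross_zero, cross_one, cross_two, PiLp.add_apply, PiLp.smul_apply,
      smul_eq_mul] at this ⊢
    linear_combination this
  rcases hst with hs | ht
  · exact (mul_ne_zero hs h) ev
  · exact (mul_ne_zero ht h) ew

theorem exists_frame_expansion {x v w : R3} (h : ⟪x, cross v w⟫ ≠ 0) (u : R3) :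
    ∃ a b c : ℝ, u = a • x + b • v + c • w := by
  have e := triple_smul_eq u x v w
  refine ⟨⟪x, cross v w⟫⁻¹ * ⟪u, cross v w⟫, ⟪x, cross v w⟫⁻¹ * ⟪x, cross u w⟫,
    ⟪x, cross v w⟫⁻¹ * ⟪x, cross v u⟫, ?_⟩
  rw [mul_smul, mul_smul, mul_smul, ← smul_add, ← smul_add, ← e, inv_smul_smul₀ h]

/-- Two linear maps agreeing on a frame agree. -/
theorem eq_of_frame {x v w : R3} (h : ⟪x, cross v w⟫ ≠ 0) {A B : R3 →L[ℝ] R3}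
    (hx : A x = B x) (hv : A v = B v) (hw : A w = B w) : A = B := by
  ext1 u
  obtain ⟨a, b, c, rfl⟩ := exists_frame_expansion h u
  simp only [map_add, map_smul, hx, hv, hw]

section Regularity

variable {F G : R3 → R3} {x : R3}

theorem contDiffAt_fderiv_apply (hF : ContDiffAt ℝ ∞ F x) (v : R3) :
    ContDiffAt ℝ ∞ (fun y => fderiv ℝ F y v) x :=
  (hF.fderiv_right (m := ∞) (by simp)).clm_apply contDiffAt_const

theorem contDiffAt_cross (hF : ContDiffAt ℝ ∞ F x) (hG : ContDiffAt ℝ ∞ G x) :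
    ContDiffAt ℝ ∞ (fun y => cross (F y) (G y)) x :=
  (cross.contDiff.contDiffAt.comp x hF).clm_apply hG

theorem differentiableAt_of_contDiffAt {E : Type*} [NormedAddCommGroup E] [NormedSpace ℝ E]
    {F : R3 → E} (hF : ContDiffAt ℝ ∞ F x) : DifferentiableAt ℝ F x :=
  hF.differentiableAt (by simp)

theorem fderiv_cross (hF : DifferentiableAt ℝ F x) (hG : DifferentiableAt ℝ G x) (u : R3) :
    fderiv ℝ (fun y => cross (F y) (G y)) x u =
      cross (F x) (fderiv ℝ G x u) + cross (fderiv ℝ F x u) (G x) := by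
  rw [ContinuousLinearMap.fderiv_of_bilinear cross hF hG]
  simp [ContinuousLinearMap.precompR, ContinuousLinearMap.precompL]

theorem fderiv_fderiv_apply (hF : ContDiffAt ℝ ∞ F x) (v u : R3) :
    fderiv ℝ (fun y => fderiv ℝ F y v) x u = fderiv ℝ (fderiv ℝ F) x u v := by
  have hd : DifferentiableAt ℝ (fderiv ℝ F) x :=
    (hF.fderiv_right (m := ∞) (by simp)).differentiableAt (by simp)
  rw [fderiv_clm_apply hd (differentiableAt_const v)]
  simp

theorem fderiv_fderiv_symm (hF : ContDiffAt ℝ ∞ F x) (u v : R3) :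
    fderiv ℝ (fun y => fderiv ℝ F y v) x u = fderiv ℝ (fun y => fderiv ℝ F y u) x v := by
  rw [fderiv_fderiv_apply hF, fderiv_fderiv_apply hF]
  refine (hF.isSymmSndFDerivAt ?_).eq u v
  rw [minSmoothness_of_isRCLikeNormedField]
  exact WithTop.coe_le_coe.mpr (le_top : (2 : ℕ∞) ≤ ⊤)

/-- The second fundamental form is symmetric. -/
theorem inner_fderiv_symm {N : R3 → R3} (hx : x ≠ 0) (hN : ContDiffAt ℝ ∞ N x)
    (hF : ContDiffAt ℝ ∞ F x) (h : ∀ y ≠ 0, ∀ v, ⟪N y, fderiv ℝ F y v⟫ = 0) (v w : R3) :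
    ⟪fderiv ℝ N x w, fderiv ℝ F x v⟫ = ⟪fderiv ℝ N x v, fderiv ℝ F x w⟫ := by
  have key : ∀ v w : R3, ⟪N x, fderiv ℝ (fun y => fderiv ℝ F y v) x w⟫ +
      ⟪fderiv ℝ N x w, fderiv ℝ F x v⟫ = 0 := by
    intro v w
    have h0 : (fun y => ⟪N y, fderiv ℝ F y v⟫) =ᶠ[nhds x] fun _ => 0 := by
      filter_upwards [isOpen_ne.mem_nhds hx] with y hy using h y hy v
    have := h0.fderiv_eq (𝕜 := ℝ)
    rw [← fderiv_inner_apply (𝕜 := ℝ) (differentiableAt_of_contDiffAt hN)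
      (differentiableAt_of_contDiffAt (contDiffAt_fderiv_apply hF v)), this]
    simp
  have h1 := key v w
  have h2 := key w v
  rw [fderiv_fderiv_symm hF] at h1
  linarith

end Regularity

namespace IsConvexPair

variable {R N : R3 → R3} {x v w : R3}

theorem cross_fderiv_ne_zero (h : IsConvexPair R N) (hx : x ≠ 0)
    (hvw : ⟪x, cross v w⟫ ≠ 0) : cross (fderiv ℝ R x v) (fderiv ℝ R x w) ≠ 0 := by
  intro e
  obtain ⟨s, t, hst, h0⟩ := exists_of_cross_eq_zero e
  have := h.convex x hx (s • v + t • w) (smul_add_smul_ne_smul hvw hst)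
  rw [map_add, map_add, map_smul, map_smul, map_smul, map_smul, h0, inner_zero_right] at this
  exact lt_irrefl _ this

theorem inner_cross_eq (h : IsConvexPair R N) (hx : x ≠ 0) (a : R3) :
    ⟪a, cross (fderiv ℝ R x v) (fderiv ℝ R x w)⟫ =
      ⟪a, N x⟫ * ⟪N x, cross (fderiv ℝ R x v) (fderiv ℝ R x w)⟫ := by
  have h0 := h.normal x hx v
  have h1 := h.normal x hx w
  have h2 := h.unit x hx
  generalize fderiv ℝ R x v = X at *
  generalize fderiv ℝ R x w = Y at *
  generalize N x = n at *
  have e : cross (cross X Y) n = 0 := by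
    have : cross (cross X Y) n = ⟪n, X⟫ • Y - ⟪n, Y⟫ • X := by
      apply ext_coord <;> simp [inner_coord] <;> ring
    rw [this, h0, h1, zero_smul, zero_smul, sub_zero]
  have e2 : cross n (cross (cross X Y) n) = ⟪n, n⟫ • cross X Y - ⟪n, cross X Y⟫ • n := by
    apply ext_coord <;> simp only [inner_coord, cross_zero, cross_one, cross_two,
      PiLp.sub_apply, PiLp.smul_apply, smul_eq_mul] <;> ring
  rw [e, map_zero, h2, one_smul, eq_comm, sub_eq_zero] at e2
  conv_lhs => rw [e2]
  rw [inner_smul_right, mul_comm]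

end IsConvexPair

/-- A rotation field of an infinitesimal deformation. -/
structure IsRotationField (R Ω : R3 → R3) : Prop where
  contDiffAt : ∀ x ≠ 0, ContDiffAt ℝ ∞ Ω x
  cross_symm : ∀ x ≠ 0, ∀ v w, cross (fderiv ℝ Ω x w) (fderiv ℝ R x v) =
    cross (fderiv ℝ Ω x v) (fderiv ℝ R x w)

theorem contDiffAt_rotation {X Y X' Y' : R3 → R3} {x : R3} (hX : ContDiffAt ℝ ∞ X x)
    (hY : ContDiffAt ℝ ∞ Y x) (hX' : ContDiffAt ℝ ∞ X' x) (hY' : ContDiffAt ℝ ∞ Y' x)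
    (h : cross (X x) (Y x) ≠ 0) :
    ContDiffAt ℝ ∞ (fun y => rotation (X y) (Y y) (X' y) (Y' y)) x := by
  have hc := contDiffAt_cross hX hY
  refine ((hc.inner ℝ hc).inv (inner_self_ne_zero.mpr h)).smul ?_
  exact (((hX'.inner ℝ hY).smul hc).add ((hY'.inner ℝ hc).smul hX)).sub
    ((hX'.inner ℝ hc).smul hY)

variable {R N T Ω : R3 → R3}

/-- Every infinitesimal deformation has a smooth rotation field. -/
theorem IsConvexPair.exists_rotation (h : IsConvexPair R N) (hT : IsRadialDeformation R T) :
    ∃ Ω : R3 → R3, (∀ x ≠ 0, ContDiffAt ℝ ∞ Ω x) ∧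
      ∀ x ≠ 0, ∀ v, fderiv ℝ T x v = cross (Ω x) (fderiv ℝ R x v) := by
  have local_rotation : ∀ x ≠ 0, ∀ v w, ⟪x, cross v w⟫ ≠ 0 → fderiv ℝ T x =
      (cross (rotation (fderiv ℝ R x v) (fderiv ℝ R x w) (fderiv ℝ T x v)
        (fderiv ℝ T x w))).comp (fderiv ℝ R x) := by
    intro x hx v w hvw
    have hs := hT.skew x hx
    have := cross_rotation (h.cross_fderiv_ne_zero hx hvw) (by linarith [hs v v]) (hs v w)
      (by linarith [hs w w])
    refine eq_of_frame hvw ?_ this.1.symm this.2.symm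
    rw [hT.radial x hx, ContinuousLinearMap.comp_apply, h.radial_fst x hx, map_zero]
  have pointwise : ∀ x : R3, ∃ A : R3, x ≠ 0 → fderiv ℝ T x = (cross A).comp (fderiv ℝ R x) := by
    intro x
    by_cases hx : x = 0
    · exact ⟨0, fun hx' => absurd hx hx'⟩
    · obtain ⟨v, w, hvw⟩ := exists_triple_ne_zero hx
      exact ⟨_, fun _ => local_rotation x hx v w hvw⟩
  choose Ω hΩ using pointwise
  refine ⟨Ω, fun x hx => ?_, fun x hx v => by rw [hΩ x hx]; rfl⟩
  obtain ⟨v, w, hvw⟩ := exists_triple_ne_zero hx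
  have hR := h.contDiffAt_fst x hx
  have hT' := hT.contDiffAt x hx
  refine (contDiffAt_rotation (contDiffAt_fderiv_apply hR v) (contDiffAt_fderiv_apply hR w)
    (contDiffAt_fderiv_apply hT' v) (contDiffAt_fderiv_apply hT' w)
    (h.cross_fderiv_ne_zero hx hvw)).congr_of_eventuallyEq ?_
  have hopen : IsOpen {y : R3 | ⟪y, cross v w⟫ ≠ 0} :=
    isOpen_ne_fun (by fun_prop) continuous_const
  filter_upwards [isOpen_ne.mem_nhds hx, hopen.mem_nhds hvw] with y hy hyvw
  rw [← sub_eq_zero]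
  have e := (hΩ y hy).symm.trans (local_rotation y hy v w hyvw)
  refine eq_zero_of_cross_eq_zero (h.cross_fderiv_ne_zero hy hyvw) ?_ ?_
  · have := congrArg (fun A : R3 →L[ℝ] R3 => A v) e
    simpa [sub_eq_zero] using this
  · have := congrArg (fun A : R3 →L[ℝ] R3 => A w) e
    simpa [sub_eq_zero] using this

theorem isRotationField (hR : ∀ x ≠ 0, ContDiffAt ℝ ∞ R x) (hT : ∀ x ≠ 0, ContDiffAt ℝ ∞ T x)
    (hΩ : ∀ x ≠ 0, ContDiffAt ℝ ∞ Ω x)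
    (h : ∀ x ≠ 0, ∀ v, fderiv ℝ T x v = cross (Ω x) (fderiv ℝ R x v)) :
    IsRotationField R Ω := by
  refine ⟨hΩ, fun x hx v w => ?_⟩
  have key : ∀ v w, fderiv ℝ (fun y => fderiv ℝ T y v) x w =
      cross (Ω x) (fderiv ℝ (fun y => fderiv ℝ R y v) x w) +
        cross (fderiv ℝ Ω x w) (fderiv ℝ R x v) := by
    intro v w
    have e : (fun y => fderiv ℝ T y v) =ᶠ[nhds x] fun y => cross (Ω y) (fderiv ℝ R y v) := by
      filter_upwards [isOpen_ne.mem_nhds hx] with y hy using h y hy v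
    rw [e.fderiv_eq, fderiv_cross (differentiableAt_of_contDiffAt (hΩ x hx))
      (differentiableAt_of_contDiffAt (contDiffAt_fderiv_apply (hR x hx) v))]
  have h1 := key v w
  rw [fderiv_fderiv_symm (hT x hx), fderiv_fderiv_symm (hR x hx), key w v] at h1
  exact (add_left_cancel h1).symm

namespace IsRotationField

theorem radial (hΩ : IsRotationField R Ω) (h : IsConvexPair R N) {x : R3} (hx : x ≠ 0) :
    fderiv ℝ Ω x x = 0 := by
  obtain ⟨v, w, hvw⟩ := exists_triple_ne_zero hx
  refine eq_zero_of_cross_eq_zero (h.cross_fderiv_ne_zero hx hvw) ?_ ?_ <;>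
  rw [hΩ.cross_symm x hx, h.radial_fst x hx, map_zero]

theorem normal (hΩ : IsRotationField R Ω) (h : IsConvexPair R N) {x : R3} (hx : x ≠ 0)
    (u : R3) : ⟪N x, fderiv ℝ Ω x u⟫ = 0 := by
  obtain ⟨v, w, hvw⟩ := exists_triple_ne_zero hx
  obtain ⟨α, β, γ, ha, hb⟩ := exists_traceFree (h.cross_fderiv_ne_zero hx hvw)
    (hΩ.cross_symm x hx v w)
  obtain ⟨a, b, c, rfl⟩ := exists_frame_expansion hvw u
  simp only [map_add, map_smul, hΩ.radial h hx, ha, hb, inner_add_right, inner_smul_right,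
    inner_sub_right, h.normal x hx, inner_zero_right, mul_zero, add_zero, sub_zero]

/-- The form obtained from the rotation field is a nonpositive multiple of the area form. -/
theorem exists_density_eq (hΩ : IsRotationField R Ω) (h : IsConvexPair R N) (o : R3) {x : R3}
    (hx : x ≠ 0) : ∃ q : ℝ, 0 ≤ q ∧ (q = 0 → fderiv ℝ Ω x = 0) ∧
      density x (R x - o) (fderiv ℝ Ω x) =
        -(q * (⟪R x - o, N x⟫ * density x (N x) (fderiv ℝ R x))) := by
  obtain ⟨v, w, hvw⟩ := exists_triple_ne_zero hx
  obtain ⟨α, β, γ, ha, hb⟩ := exists_traceFree (h.cross_fderiv_ne_zero hx hvw)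
    (hΩ.cross_symm x hx v w)
  have hL := h.convex x hx v (fun t => by
    simpa using smul_add_smul_ne_smul hvw (s := 1) (t := 0) (Or.inl one_ne_zero) t)
  have hM := inner_fderiv_symm hx (h.contDiffAt_snd x hx) (h.contDiffAt_fst x hx) h.normal v w
  have hS := inner_fderiv_symm hx (h.contDiffAt_snd x hx) (hΩ.contDiffAt x hx)
    (fun y hy => hΩ.normal h hy) v w
  have hD := h.convex x hx
    (⟪fderiv ℝ N x v, fderiv ℝ R x w⟫ • v + (-⟪fderiv ℝ N x v, fderiv ℝ R x v⟫) • w)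
    (smul_add_smul_ne_smul hvw (Or.inr (neg_ne_zero.mpr hL.ne')))
  have hg := density_mul_triple (c := R x - o) (hΩ.radial h hx) v w
  have hJ := density_mul_triple (c := N x) (h.radial_fst x hx) v w
  have hN := h.inner_cross_eq (v := v) (w := w) hx (R x - o)
  rw [ha, hb] at hS hg
  have hr := hΩ.radial h hx
  simp only [map_add, map_smul, inner_add_left, inner_add_right, inner_smul_left,
    inner_smul_right, inner_sub_right, conj_trivial, hM] at hS hD
  have hdet : 0 < ⟪fderiv ℝ N x v, fderiv ℝ R x v⟫ * ⟪fderiv ℝ N x w, fderiv ℝ R x w⟫ -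
      ⟪fderiv ℝ N x v, fderiv ℝ R x w⟫ ^ 2 := by
    refine pos_of_mul_pos_right (a := ⟪fderiv ℝ N x v, fderiv ℝ R x v⟫) ?_ hL.le
    linarith
  obtain ⟨hq, hq0⟩ := traceFree_sign (α := α) (β := β) (γ := γ) hL hdet (by linarith)
  refine ⟨_, hq, fun h0 => ?_, ?_⟩
  · obtain ⟨rfl, rfl, rfl⟩ := hq0 h0
    refine eq_of_frame hvw ?_ ?_ ?_
    · simpa using hr
    · simpa using ha
    · simpa using hb
  · apply mul_right_cancel₀ hvw
    rw [hg]
    have e : cross (α • fderiv ℝ R x v + β • fderiv ℝ R x w)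
        (γ • fderiv ℝ R x v - α • fderiv ℝ R x w) =
        -(α ^ 2 + β * γ) • cross (fderiv ℝ R x v) (fderiv ℝ R x w) := by
      apply ext_coord <;> simp only [cross_zero, cross_one, cross_two, PiLp.add_apply,
        PiLp.sub_apply, PiLp.smul_apply, PiLp.neg_apply, smul_eq_mul] <;> ring
    rw [e, inner_smul_right, hN]
    linear_combination (α ^ 2 + β * γ) * ⟪R x - o, N x⟫ * hJ

end IsRotationField

theorem IsConvexPair.density_ne_zero (h : IsConvexPair R N) {x : R3} (hx : x ≠ 0) :
    density x (N x) (fderiv ℝ R x) ≠ 0 := by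
  obtain ⟨v, w, hvw⟩ := exists_triple_ne_zero hx
  intro h0
  have hJ := density_mul_triple (c := N x) (h.radial_fst x hx) v w
  rw [h0, zero_mul, eq_comm, mul_eq_zero] at hJ
  have hn := hJ.resolve_left (inner_self_ne_zero.mpr hx)
  have hc := h.inner_cross_eq (v := v) (w := w) hx
    (cross (fderiv ℝ R x v) (fderiv ℝ R x w))
  rw [hn, mul_zero] at hc
  exact h.cross_fderiv_ne_zero hx hvw (inner_self_eq_zero.mp hc)

open MeasureTheory

theorem integral_fderiv_apply_eq_zero {f : R3 → ℝ} (hf : ContDiff ℝ 1 f)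
    (hs : HasCompactSupport f) (v : R3) : ∫ x, fderiv ℝ f x v = 0 := by
  have hc : Continuous fun x => fderiv ℝ f x v :=
    (hf.continuous_fderiv one_ne_zero).clm_apply continuous_const
  have h := integral_mul_fderiv_eq_neg_fderiv_mul_of_integrable (μ := volume) (v := v)
    (f := fun _ : R3 => (1 : ℝ)) (g := f) (𝕜 := ℝ) (by simp)
    (by simpa using hc.integrable_of_hasCompactSupport (hs.fderiv_apply ℝ v))
    (by simpa using hf.continuous.integrable_of_hasCompactSupport hs)
    (by fun_prop) (fun x _ => hf.differentiable one_ne_zero x)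
  simpa using h

theorem fderiv_coord {F : R3 → R3} {x : R3} (hF : DifferentiableAt ℝ F x) (v : R3) (i : Fin 3) :
    fderiv ℝ F x v i = fderiv ℝ (fun y => F y i) x v := by
  have := (EuclideanSpace.proj (𝕜 := ℝ) i : R3 →L[ℝ] ℝ).hasFDerivAt.comp x hF.hasFDerivAt
  exact (congrArg (fun A => A v) this.fderiv).symm

/-- The divergence of a vector field. -/
noncomputable def divergence (V : R3 → R3) (x : R3) : ℝ :=
  fderiv ℝ V x (EuclideanSpace.single 0 1) 0 + fderiv ℝ V x (EuclideanSpace.single 1 1) 1 +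
    fderiv ℝ V x (EuclideanSpace.single 2 1) 2

theorem integral_divergence_eq_zero {V : R3 → R3} (hV : ContDiff ℝ 1 V)
    (hs : HasCompactSupport V) : ∫ x, divergence V x = 0 := by
  have hc (i : Fin 3) : ContDiff ℝ 1 fun x => V x i := by fun_prop
  have hsi (i : Fin 3) : HasCompactSupport fun x => V x i :=
    hs.comp_left (g := fun z : R3 => z i) rfl
  have hd (i : Fin 3) (v x : R3) : fderiv ℝ V x v i = fderiv ℝ (fun y => V y i) x v :=
    fderiv_coord (hV.differentiable one_ne_zero x) v i
  have hi (i : Fin 3) (v : R3) : Integrable fun x => fderiv ℝ V x v i := by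
    simp_rw [hd]
    exact (((hc i).continuous_fderiv one_ne_zero).clm_apply
      continuous_const).integrable_of_hasCompactSupport ((hsi i).fderiv_apply ℝ v)
  unfold divergence
  rw [integral_add (by exact (hi _ _).add (hi _ _)) (hi _ _), integral_add (hi _ _) (hi _ _)]
  simp_rw [hd]
  simp [integral_fderiv_apply_eq_zero (hc _) (hsi _)]

theorem divergence_smul_cross {ψ : ℝ → ℝ} {h : R3 → R3} {x : R3}
    (hψ : DifferentiableAt ℝ ψ ⟪x, x⟫) (hh : DifferentiableAt ℝ h x) :
    divergence (fun y => ψ ⟪y, y⟫ • cross (h y) y) x = ψ ⟪x, x⟫ *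
      (x 0 * (fderiv ℝ h x (EuclideanSpace.single 1 1) 2 -
          fderiv ℝ h x (EuclideanSpace.single 2 1) 1) +
        x 1 * (fderiv ℝ h x (EuclideanSpace.single 2 1) 0 -
          fderiv ℝ h x (EuclideanSpace.single 0 1) 2) +
        x 2 * (fderiv ℝ h x (EuclideanSpace.single 0 1) 1 -
          fderiv ℝ h x (EuclideanSpace.single 1 1) 0)) := by
  have hq : DifferentiableAt ℝ (fun y : R3 => ⟪y, y⟫) x :=
    differentiableAt_fun_id.inner ℝ differentiableAt_fun_id
  have hc : DifferentiableAt ℝ (fun y : R3 => cross (h y) y) x :=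
    (cross.differentiableAt.comp x hh).clm_apply differentiableAt_id
  have key (v : R3) : fderiv ℝ (fun y => ψ ⟪y, y⟫ • cross (h y) y) x v =
      ψ ⟪x, x⟫ • (cross (h x) v + cross (fderiv ℝ h x v) x) +
        (2 * deriv ψ ⟪x, x⟫ * ⟪x, v⟫) • cross (h x) x := by
    have h1 : HasFDerivAt (fun y : R3 => ψ ⟪y, y⟫)
        (deriv ψ ⟪x, x⟫ • fderiv ℝ (fun y : R3 => ⟪y, y⟫) x) x :=
      HasDerivAt.comp_hasFDerivAt (f := fun y : R3 => ⟪y, y⟫) x hψ.hasDerivAt hq.hasFDerivAt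
    have h2 : fderiv ℝ (fun y : R3 => ⟪y, y⟫) x v = 2 * ⟪x, v⟫ := by
      rw [fderiv_inner_apply (𝕜 := ℝ) differentiableAt_fun_id differentiableAt_fun_id]
      simp [real_inner_comm, two_mul]
    rw [(h1.fun_smul hc.hasFDerivAt).fderiv]
    simp only [add_apply, smul_apply, ContinuousLinearMap.smulRight_apply, h2, smul_eq_mul]
    rw [fderiv_cross hh differentiableAt_fun_id]
    simp only [fderiv_fun_id, ContinuousLinearMap.id_apply]
    congr 2
    ring
  rw [divergence, key, key, key]
  simp only [PiLp.add_apply, PiLp.smul_apply, smul_eq_mul, inner_coord,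
    cross_zero, cross_one, cross_two, PiLp.single_apply]
  simp
  ring

open MeasureTheory

variable {R N Ω T : R3 → R3}

/-- The one-form `w ↦ ⟪R - o, Ω × dΩ w⟫`, as a vector field. -/
noncomputable def rotationForm (R Ω : R3 → R3) (o : R3) (y : R3) : R3 :=
  WithLp.toLp 2 fun i => ⟪R y - o, cross (Ω y) (fderiv ℝ Ω y (EuclideanSpace.single i 1))⟫

theorem contDiffAt_rotationForm {x : R3} (hR : ContDiffAt ℝ ∞ R x) (hΩ : ContDiffAt ℝ ∞ Ω x)
    (o : R3) : ContDiffAt ℝ ∞ (rotationForm R Ω o) x := by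
  rw [contDiffAt_euclidean]
  intro i
  exact (hR.sub contDiffAt_const).inner ℝ (contDiffAt_cross hΩ (contDiffAt_fderiv_apply hΩ _))

theorem fderiv_inner_cross {x : R3} (hR : ContDiffAt ℝ ∞ R x) (hΩ : ContDiffAt ℝ ∞ Ω x)
    (o v w : R3) :
    fderiv ℝ (fun y => ⟪R y - o, cross (Ω y) (fderiv ℝ Ω y w)⟫) x v =
      ⟪R x - o, cross (Ω x) (fderiv ℝ (fun y => fderiv ℝ Ω y w) x v)⟫ +
        ⟪R x - o, cross (fderiv ℝ Ω x v) (fderiv ℝ Ω x w)⟫ +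
        ⟪fderiv ℝ R x v, cross (Ω x) (fderiv ℝ Ω x w)⟫ := by
  have hd := contDiffAt_fderiv_apply hΩ w
  rw [fderiv_inner_apply (𝕜 := ℝ) ((differentiableAt_of_contDiffAt hR).sub_const o)
    (differentiableAt_of_contDiffAt (contDiffAt_cross hΩ hd)),
    fderiv_cross (differentiableAt_of_contDiffAt hΩ) (differentiableAt_of_contDiffAt hd),
    fderiv_sub_const, inner_add_right]

theorem IsRotationField.curl_eq (hΩ : IsRotationField R Ω) {x : R3} (hx : x ≠ 0)
    (hR : ContDiffAt ℝ ∞ R x) (o v w : R3) :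
    fderiv ℝ (fun y => ⟪R y - o, cross (Ω y) (fderiv ℝ Ω y w)⟫) x v -
      fderiv ℝ (fun y => ⟪R y - o, cross (Ω y) (fderiv ℝ Ω y v)⟫) x w =
      2 * ⟪R x - o, cross (fderiv ℝ Ω x v) (fderiv ℝ Ω x w)⟫ := by
  have hs := hΩ.contDiffAt x hx
  have hc := congrArg (fun z => ⟪Ω x, z⟫) (hΩ.cross_symm x hx v w)
  have triple (a b c : R3) : ⟪a, cross b c⟫ = ⟪b, cross c a⟫ := by
    simp only [inner_coord, cross_zero, cross_one, cross_two]
    ring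
  rw [fderiv_inner_cross hR hs, fderiv_inner_cross hR hs, fderiv_fderiv_symm hs v w,
    cross_swap (fderiv ℝ Ω x w), inner_neg_right, triple (fderiv ℝ R x v),
    triple (fderiv ℝ R x w)]
  linear_combination hc

theorem IsRotationField.divergence_eq (hΩ : IsRotationField R Ω) {x : R3} (hx : x ≠ 0)
    (hR : ContDiffAt ℝ ∞ R x) (o : R3) {ψ : ℝ → ℝ} (hψ : DifferentiableAt ℝ ψ ⟪x, x⟫) :
    divergence (fun y => ψ ⟪y, y⟫ • cross (rotationForm R Ω o y) y) x =
      2 * (ψ ⟪x, x⟫ * density x (R x - o) (fderiv ℝ Ω x)) := by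
  have hd := differentiableAt_of_contDiffAt
    (contDiffAt_rotationForm hR (hΩ.contDiffAt x hx) o)
  rw [divergence_smul_cross hψ hd]
  simp only [fderiv_coord hd]
  simp only [rotationForm]
  rw [hΩ.curl_eq hx hR, hΩ.curl_eq hx hR, hΩ.curl_eq hx hR, density]
  ring

theorem IsRotationField.integral_density_eq_zero (hΩ : IsRotationField R Ω)
    (hR : ∀ x ≠ 0, ContDiffAt ℝ ∞ R x) (o : R3) {ψ : ℝ → ℝ} (hψ : ContDiff ℝ 1 ψ)
    {ε ρ : ℝ} (hε : 0 < ε) (hψε : ∀ t < ε, ψ t = 0) (hψρ : ∀ t, ρ ^ 2 < t → ψ t = 0) :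
    ∫ x : R3, ψ ⟪x, x⟫ * density x (R x - o) (fderiv ℝ Ω x) = 0 := by
  have hcs : HasCompactSupport fun y : R3 => ψ ⟪y, y⟫ • cross (rotationForm R Ω o y) y := by
    refine HasCompactSupport.intro (isCompact_closedBall (0 : R3) |ρ|) fun x hx => ?_
    rw [mem_closedBall_zero_iff, not_le] at hx
    have : ρ ^ 2 < ⟪x, x⟫ := by
      rw [real_inner_self_eq_norm_sq, ← sq_abs ρ]
      gcongr
    simp only [hψρ _ this, zero_smul]
  have hq : ContDiff ℝ 1 fun y : R3 => ⟪y, y⟫ := contDiff_fun_id.inner ℝ contDiff_fun_id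
  have hV : ContDiff ℝ 1 fun y : R3 => ψ ⟪y, y⟫ • cross (rotationForm R Ω o y) y := by
    rw [contDiff_iff_contDiffAt]
    intro x
    by_cases hx : x = 0
    · subst hx
      have h0 : {y : R3 | ⟪y, y⟫ < ε} ∈ nhds 0 :=
        (isOpen_lt hq.continuous continuous_const).mem_nhds (by simpa using hε)
      refine (contDiffAt_const (c := (0 : R3))).congr_of_eventuallyEq ?_
      filter_upwards [h0] with y hy
      rw [hψε _ hy, zero_smul]
    · have h1 := contDiffAt_rotationForm (hR x hx) (hΩ.contDiffAt x hx) o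
      exact (hψ.comp hq).contDiffAt.smul
        ((contDiffAt_cross h1 contDiffAt_fun_id).of_le (by simp))
  have hdiv := integral_divergence_eq_zero hV hcs
  have he : divergence (fun y : R3 => ψ ⟪y, y⟫ • cross (rotationForm R Ω o y) y) =ᵐ[volume]
      fun x => 2 * (ψ ⟪x, x⟫ * density x (R x - o) (fderiv ℝ Ω x)) := by
    filter_upwards [compl_mem_ae_iff.mpr (measure_singleton (0 : R3))] with x hx
    exact hΩ.divergence_eq hx (hR x hx) o (hψ.differentiable one_ne_zero _)
  rw [integral_congr_ae he, integral_const_mul] at hdiv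
  simpa using hdiv

theorem sign_of_isPreconnected {X : Type*} [TopologicalSpace X] {s : Set X}
    (hs : IsPreconnected s) {f : X → ℝ} (hf : ContinuousOn f s) (h0 : ∀ x ∈ s, f x ≠ 0) :
    (∀ x ∈ s, 0 < f x) ∨ ∀ x ∈ s, f x < 0 := by
  by_contra! h
  obtain ⟨⟨x, hx, hfx⟩, y, hy, hfy⟩ := h
  obtain ⟨z, hz, hfz⟩ := hs.intermediate_value hx hy hf ⟨hfx, hfy⟩
  exact h0 z hz hfz

theorem isPreconnected_compl_zero : IsPreconnected ({0}ᶜ : Set R3) :=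
  (isConnected_compl_singleton_of_one_lt_rank
    (by rw [← Module.finrank_eq_rank]; simp) 0).isPreconnected

theorem continuousOn_density {A : R3 → R3} {c : R3 → R3}
    (hc : ∀ x ≠ 0, ContDiffAt ℝ ∞ c x) (hA : ∀ x ≠ 0, ContDiffAt ℝ ∞ A x) :
    ContinuousOn (fun x => density x (c x) (fderiv ℝ A x)) {0}ᶜ := by
  intro x hx
  have h (i j : Fin 3) : ContinuousAt (fun x => ⟪c x, cross
      (fderiv ℝ A x (EuclideanSpace.single i 1)) (fderiv ℝ A x (EuclideanSpace.single j 1))⟫) x :=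
    ((hc x hx).inner ℝ (contDiffAt_cross (contDiffAt_fderiv_apply (hA x hx) _)
      (contDiffAt_fderiv_apply (hA x hx) _))).continuousAt
  have hp (i : Fin 3) : ContinuousAt (fun x : R3 => x i) x := by fun_prop
  exact ((((hp 0).mul (h 1 2)).add ((hp 1).mul (h 2 0))).add
    ((hp 2).mul (h 0 1))).continuousWithinAt

/-- The rotation field of an infinitesimal deformation of a convex surface is constant. -/
theorem IsRotationField.fderiv_eq_zero (hΩ : IsRotationField R Ω) (h : IsConvexPair R N) (o : R3)
    (ho : ∀ x ≠ 0, ⟪R x - o, N x⟫ ≠ 0) {x₀ : R3} (hx₀ : x₀ ≠ 0) : fderiv ℝ Ω x₀ = 0 := by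
  have hRo (x : R3) (hx : x ≠ 0) : ContDiffAt ℝ ∞ (fun x => R x - o) x :=
    (h.contDiffAt_fst x hx).sub contDiffAt_const
  have hσc : ContinuousOn (fun x => ⟪R x - o, N x⟫ * density x (N x) (fderiv ℝ R x)) {0}ᶜ :=
    ContinuousOn.mul (fun x hx => ((hRo x hx).inner ℝ
      (h.contDiffAt_snd x hx)).continuousAt.continuousWithinAt)
      (continuousOn_density h.contDiffAt_snd h.contDiffAt_fst)
  have hσ := sign_of_isPreconnected isPreconnected_compl_zero hσc
    fun x hx => mul_ne_zero (ho x hx) (h.density_ne_zero hx)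
  have hpos : 0 < ⟪x₀, x₀⟫ := real_inner_self_pos.mpr hx₀
  let ψ : ContDiffBump (⟪x₀, x₀⟫ : ℝ) :=
    ⟨⟪x₀, x₀⟫ / 4, ⟪x₀, x₀⟫ / 2, by positivity, by linarith⟩
  have hψε : ∀ t < ⟪x₀, x₀⟫ / 2, ψ t = 0 := fun t ht => ψ.zero_of_le_dist (by
    rw [Real.dist_eq, abs_sub_comm]
    refine le_trans ?_ (le_abs_self _)
    change ⟪x₀, x₀⟫ / 2 ≤ _
    linarith)
  have hψρ : ∀ t, (2 * ‖x₀‖) ^ 2 < t → ψ t = 0 := fun t ht => ψ.zero_of_le_dist (by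
    rw [Real.dist_eq]
    refine le_trans ?_ (le_abs_self _)
    change ⟪x₀, x₀⟫ / 2 ≤ _
    have := real_inner_self_eq_norm_sq x₀
    nlinarith)
  have hint := hΩ.integral_density_eq_zero h.contDiffAt_fst o (ψ := ψ) ψ.contDiff
    (half_pos hpos) hψε hψρ
  set f : R3 → ℝ := fun x => ψ ⟪x, x⟫ * density x (R x - o) (fderiv ℝ Ω x) with hf
  have hq : Continuous fun y : R3 => (⟪y, y⟫ : ℝ) := continuous_id.inner continuous_id
  have hfc : Continuous f := by
    rw [continuous_iff_continuousAt]
    intro x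
    by_cases hx : x = 0
    · subst hx
      have h0 : {y : R3 | ⟪y, y⟫ < ⟪x₀, x₀⟫ / 2} ∈ nhds 0 :=
        (isOpen_lt hq continuous_const).mem_nhds (by simp [hx₀])
      refine (continuousAt_const (y := (0 : ℝ))).congr ?_
      filter_upwards [h0] with y hy
      rw [hf]
      simp only [hψε _ hy, zero_mul]
    · exact (ψ.continuous.comp hq).continuousAt.mul
        ((continuousOn_density hRo hΩ.contDiffAt).continuousAt (isOpen_compl_singleton.mem_nhds hx))
  have hfs : HasCompactSupport f := by
    refine HasCompactSupport.intro (isCompact_closedBall (0 : R3) (2 * ‖x₀‖)) fun x hx => ?_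
    rw [mem_closedBall_zero_iff, not_le] at hx
    have : (2 * ‖x₀‖) ^ 2 < ⟪x, x⟫ := by
      rw [real_inner_self_eq_norm_sq]
      gcongr
    simp only [hf, hψρ _ this, zero_mul]
  have hf0 : f x₀ = 0 := by
    by_contra hne
    have hnn : 0 ≤ f ∨ 0 ≤ -f := by
      rcases hσ with hσ | hσ
      · right
        intro x
        by_cases hx : x = 0
        · simp [hf, hx, density]
        · obtain ⟨q, hq, -, he⟩ := hΩ.exists_density_eq h o hx
          have := mul_nonneg (ψ.nonneg (x := ⟪x, x⟫)) (mul_nonneg hq (hσ x hx).le)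
          simp only [hf, he, Pi.zero_apply, Pi.neg_apply]
          linarith
      · left
        intro x
        by_cases hx : x = 0
        · simp [hf, hx, density]
        · obtain ⟨q, hq, -, he⟩ := hΩ.exists_density_eq h o hx
          have := mul_nonneg (ψ.nonneg (x := ⟪x, x⟫))
            (mul_nonneg hq (neg_nonneg.mpr (hσ x hx).le))
          simp only [hf, he, Pi.zero_apply]
          linarith
    rcases hnn with hnn | hnn
    · exact (hfc.integral_pos_of_hasCompactSupport_nonneg_nonzero (μ := volume) hfs hnn hne).ne'
        hint
    · have := hfc.neg.integral_pos_of_hasCompactSupport_nonneg_nonzero (μ := volume) hfs.neg hnn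
        (neg_ne_zero.mpr hne)
      simp only [Pi.neg_apply, integral_neg, hint, neg_zero, lt_self_iff_false] at this
  obtain ⟨q, -, hq0, he⟩ := hΩ.exists_density_eq h o hx₀
  have hψ1 : ψ ⟪x₀, x₀⟫ = 1 := ψ.one_of_mem_closedBall (Metric.mem_closedBall_self ψ.rIn_pos.le)
  simp only [hf, hψ1, one_mul, he, neg_eq_zero, mul_eq_zero] at hf0
  exact hq0 (hf0.resolve_right (not_or.mpr ⟨ho x₀ hx₀, h.density_ne_zero hx₀⟩))

/-- Infinitesimal rigidity. -/
theorem IsConvexPair.exists_eq_cross_add (h : IsConvexPair R N) (o : R3)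
    (ho : ∀ x ≠ 0, ⟪R x - o, N x⟫ ≠ 0) (hT : IsRadialDeformation R T) :
    ∃ A B : R3, ∀ x ≠ 0, T x = cross A (R x) + B := by
  obtain ⟨Ω, hΩs, hΩT⟩ := h.exists_rotation hT
  have hΩ := isRotationField h.contDiffAt_fst hT.contDiffAt hΩs hΩT
  obtain ⟨A, hA⟩ := isOpen_compl_singleton.exists_is_const_of_fderiv_eq_zero (𝕜 := ℝ)
    isPreconnected_compl_zero
    (fun x hx => (differentiableAt_of_contDiffAt (hΩs x hx)).differentiableWithinAt)
    (fun x hx => hΩ.fderiv_eq_zero h o ho hx)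
  have hcR (x : R3) (hx : x ≠ 0) : DifferentiableAt ℝ (fun y => cross A (R y)) x :=
    (cross A).differentiableAt.comp x (differentiableAt_of_contDiffAt (h.contDiffAt_fst x hx))
  obtain ⟨B, hB⟩ := isOpen_compl_singleton.exists_is_const_of_fderiv_eq_zero (𝕜 := ℝ)
    isPreconnected_compl_zero (f := fun x => T x - cross A (R x))
    (fun x hx => ((differentiableAt_of_contDiffAt (hT.contDiffAt x hx)).sub
      (hcR x hx)).differentiableWithinAt)
    (fun x hx => by
      rw [fderiv_fun_sub (differentiableAt_of_contDiffAt (hT.contDiffAt x hx)) (hcR x hx)]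
      ext1 v
      have := fderiv_cross (F := fun _ => A) (differentiableAt_const A)
        (differentiableAt_of_contDiffAt (h.contDiffAt_fst x hx)) v
      rw [sub_apply, this, hΩT x hx, hA x hx]
      simp)
  exact ⟨A, B, fun x hx => by rw [← hB x hx]; abel⟩

/-- The unit sphere. -/
abbrev S2 := Metric.sphere (0 : R3) 1

open Classical in
/-- The radial projection to the unit sphere. -/
noncomputable def proj (x : R3) : S2 :=
  if h : x = 0 then ⟨EuclideanSpace.single 0 1, by simp⟩
  else ⟨‖x‖⁻¹ • x, by simp [norm_smul, h]⟩

theorem coe_proj {x : R3} (hx : x ≠ 0) : (proj x : R3) = ‖x‖⁻¹ • x := by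
  simp [proj, hx]

theorem proj_coe (p : S2) : proj (p : R3) = p := by
  have hp : ‖(p : R3)‖ = 1 := norm_eq_of_mem_sphere p
  have : (p : R3) ≠ 0 := ne_zero_of_mem_unit_sphere p
  ext1
  rw [coe_proj this, hp, inv_one, one_smul]

theorem proj_smul {x : R3} (hx : x ≠ 0) {t : ℝ} (ht : 0 < t) : proj (t • x) = proj x := by
  ext1
  rw [coe_proj hx, coe_proj (smul_ne_zero ht.ne' hx), norm_smul, Real.norm_of_nonneg ht.le,
    smul_smul, mul_inv, mul_right_comm, inv_mul_cancel₀ ht.ne', one_mul]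

theorem contMDiffAt_proj {x : R3} (hx : x ≠ 0) : ContMDiffAt 𝓘(ℝ, R3) (𝓡 2) ∞ proj x := by
  have : Fact (Module.finrank ℝ R3 = 2 + 1) := ⟨finrank_euclideanSpace_fin⟩
  let U : TopologicalSpace.Opens R3 := ⟨{0}ᶜ, isOpen_compl_singleton⟩
  have hf : ContMDiff 𝓘(ℝ, R3) 𝓘(ℝ, R3) ∞ (fun y : U => ‖(y : R3)‖⁻¹ • (y : R3)) := by
    intro y
    have : ContDiffAt ℝ ∞ (fun y : R3 => ‖y‖⁻¹ • y) y :=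
      ((contDiffAt_norm ℝ y.2).inv (norm_ne_zero_iff.mpr y.2)).smul contDiffAt_fun_id
    exact contMDiffAt_subtype_iff.mpr this.contMDiffAt
  have hm (y : U) : ‖(y : R3)‖⁻¹ • (y : R3) ∈ Metric.sphere (0 : R3) 1 := by
    have : (y : R3) ≠ 0 := y.2
    simp [norm_smul, this]
  have h := ContMDiff.codRestrict_sphere (n := 2) hf hm
  have he : Set.codRestrict (fun y : U => ‖(y : R3)‖⁻¹ • (y : R3)) _ hm =
      fun y : U => proj y := by
    ext1 y
    exact Subtype.ext (coe_proj y.2).symm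
  rw [he] at h
  exact contMDiffAt_subtype_iff.mp (h ⟨x, hx⟩)

theorem mfderiv_proj_ne_zero {x v : R3} (hx : x ≠ 0) (hv : ∀ t : ℝ, v ≠ t • x) :
    mfderiv 𝓘(ℝ, R3) (𝓡 2) proj x v ≠ 0 := by
  intro h0
  have : Fact (Module.finrank ℝ R3 = 2 + 1) := ⟨finrank_euclideanSpace_fin⟩
  have hp : MDifferentiableAt 𝓘(ℝ, R3) (𝓡 2) proj x :=
    (contMDiffAt_proj hx).mdifferentiableAt (by simp)
  have hc : MDifferentiableAt (𝓡 2) 𝓘(ℝ, R3) ((↑) : S2 → R3) (proj x) :=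
    (contMDiff_coe_sphere (m := ∞)).mdifferentiableAt (by simp)
  have h1 := mfderiv_comp x hc hp
  have he : ((↑) : S2 → R3) ∘ proj =ᶠ[nhds x] fun y => ‖y‖⁻¹ • y := by
    filter_upwards [isOpen_ne.mem_nhds hx] with y hy using coe_proj hy
  rw [mfderiv_eq_fderiv, he.fderiv_eq] at h1
  have h2 := congrArg (fun A : R3 →L[ℝ] R3 => A v) h1
  have h3 : fderiv ℝ (fun y : R3 => ‖y‖⁻¹ • y) x v = 0 := by
    refine h2.trans ?_
    change mfderiv (𝓡 2) 𝓘(ℝ, R3) ((↑) : S2 → R3) (proj x) (mfderiv 𝓘(ℝ, R3) (𝓡 2) proj x v) = 0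
    rw [h0]
    exact map_zero _
  have hn : DifferentiableAt ℝ (fun y : R3 => ‖y‖⁻¹) x :=
    ((contDiffAt_norm ℝ hx).inv (norm_ne_zero_iff.mpr hx) (n := 1)).differentiableAt one_ne_zero
  rw [fderiv_fun_smul hn differentiableAt_fun_id] at h3
  simp only [add_apply, smul_apply, ContinuousLinearMap.smulRight_apply, fderiv_fun_id,
    ContinuousLinearMap.id_apply] at h3
  apply hv (-(‖x‖ * fderiv ℝ (fun y : R3 => ‖y‖⁻¹) x v))
  have h4 := congrArg (fun z => ‖x‖ • z) h3
  simp only [smul_add, smul_smul, smul_zero, mul_inv_cancel₀ (norm_ne_zero_iff.mpr hx),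
    one_smul] at h4
  rw [neg_smul]
  exact eq_neg_of_add_eq_zero_left h4

variable {f : S2 → R3}

theorem contDiffAt_comp_proj (hf : ContMDiff (𝓡 2) 𝓘(ℝ, R3) ∞ f) {x : R3} (hx : x ≠ 0) :
    ContDiffAt ℝ ∞ (f ∘ proj) x :=
  ((hf (proj x)).comp x (contMDiffAt_proj hx)).contDiffAt

theorem fderiv_comp_proj (hf : ContMDiff (𝓡 2) 𝓘(ℝ, R3) ∞ f) {x : R3} (hx : x ≠ 0) (v : R3) :
    fderiv ℝ (f ∘ proj) x v =
      mfderiv (𝓡 2) 𝓘(ℝ, R3) f (proj x) (mfderiv 𝓘(ℝ, R3) (𝓡 2) proj x v) := by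
  have h1 := mfderiv_comp x (hf.mdifferentiableAt (by simp) (x := proj x))
    ((contMDiffAt_proj hx).mdifferentiableAt (by simp))
  rw [mfderiv_eq_fderiv] at h1
  exact congrArg (fun A : R3 →L[ℝ] R3 => A v) h1

theorem fderiv_comp_proj_self (hf : ContMDiff (𝓡 2) 𝓘(ℝ, R3) ∞ f) {x : R3} (hx : x ≠ 0) :
    fderiv ℝ (f ∘ proj) x x = 0 := by
  have hd := (differentiableAt_of_contDiffAt (contDiffAt_comp_proj hf hx)).hasFDerivAt
  have hl : HasDerivAt (fun t : ℝ => t • x) x 1 := by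
    simpa using (hasDerivAt_id (1 : ℝ)).smul_const x
  have hc : HasDerivAt ((f ∘ proj) ∘ fun t : ℝ => t • x) (fderiv ℝ (f ∘ proj) x x) 1 :=
    HasFDerivAt.comp_hasDerivAt (1 : ℝ) (by simpa using hd) hl
  have he : ((f ∘ proj) ∘ fun t : ℝ => t • x) =ᶠ[nhds 1] fun _ => f (proj x) := by
    filter_upwards [isOpen_Ioi.mem_nhds (Set.mem_Ioi.mpr one_pos)] with t ht
    simp only [Function.comp_apply, proj_smul hx ht]
  exact hc.unique ((hasDerivAt_const (1 : ℝ) (f (proj x))).congr_of_eventuallyEq he)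

variable {R N : R3 → R3} {r ν : S2 → R3}

/-- A unit vector orthogonal to the tangent plane is one of the two unit normals. -/
theorem IsConvexPair.eq_or_eq_neg (h : IsConvexPair R N) {x a : R3} (hx : x ≠ 0)
    (ha : ⟪a, a⟫ = 1) (hn : ∀ v, ⟪a, fderiv ℝ R x v⟫ = 0) : N x = a ∨ N x = -a := by
  obtain ⟨v, w, hvw⟩ := exists_triple_ne_zero hx
  have hc := h.inner_cross_eq (v := v) (w := w) hx (a - ⟪a, N x⟫ • N x)
  have hv := h.normal x hx v
  have hw := h.normal x hx w
  have hv' := hn v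
  have hw' := hn w
  have hXY := h.cross_fderiv_ne_zero hx hvw
  have hu := h.unit x hx
  generalize fderiv ℝ R x v = X at *
  generalize fderiv ℝ R x w = Y at *
  have e := norm_cross_smul_eq_expansion (a - ⟪a, N x⟫ • N x) X Y
  have expand (b : R3) : ⟪b, cross Y (cross X Y)⟫ = ⟪b, X⟫ * ⟪Y, Y⟫ - ⟪b, Y⟫ * ⟪X, Y⟫ := by
    simp only [inner_coord, cross_zero, cross_one, cross_two]
    ring
  have expand' (b : R3) : ⟪b, cross (cross X Y) X⟫ = ⟪b, Y⟫ * ⟪X, X⟫ - ⟪b, X⟫ * ⟪X, Y⟫ := by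
    simp only [inner_coord, cross_zero, cross_one, cross_two]
    ring
  have hbN : ⟪a - ⟪a, N x⟫ • N x, N x⟫ = 0 := by
    rw [inner_sub_left, real_inner_smul_left, hu]
    ring
  have hbX : ⟪a - ⟪a, N x⟫ • N x, X⟫ = 0 := by
    rw [inner_sub_left, real_inner_smul_left, hv, hv']
    ring
  have hbY : ⟪a - ⟪a, N x⟫ • N x, Y⟫ = 0 := by
    rw [inner_sub_left, real_inner_smul_left, hw, hw']
    ring
  rw [expand, expand', hc, hbN, hbX, hbY] at e
  simp only [zero_mul, sub_zero, zero_smul, add_zero] at e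
  have hb := (smul_eq_zero.mp e).resolve_left (inner_self_ne_zero.mpr hXY)
  have ha' : a = ⟪a, N x⟫ • N x := sub_eq_zero.mp hb
  have hsq : ⟪a, N x⟫ * ⟪a, N x⟫ = 1 := by
    rw [ha', real_inner_smul_left, real_inner_smul_right, hu] at ha
    linarith
  rcases mul_self_eq_one_iff.mp hsq with h1 | h1
  · left
    rw [h1, one_smul] at ha'
    exact ha'.symm
  · right
    rw [h1, neg_smul, one_smul] at ha'
    rw [ha', neg_neg]

theorem coe_ne_zero (p : S2) : (p : R3) ≠ 0 := ne_zero_of_mem_unit_sphere p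

/-- At a maximum of a height function the normal is parallel to the direction. -/
theorem IsConvexPair.normal_eq_of_isMax (h : IsConvexPair (r ∘ proj) (ν ∘ proj)) {a : R3}
    (ha : ⟪a, a⟫ = 1) {q : S2} (hq : ∀ p, ⟪a, r p⟫ ≤ ⟪a, r q⟫) : ν q = a ∨ ν q = -a := by
  have hd := differentiableAt_of_contDiffAt (h.contDiffAt_fst q (coe_ne_zero q))
  have hmax : IsLocalMax (fun y => ⟪a, (r ∘ proj) y⟫) (q : R3) := by
    refine Filter.Eventually.of_forall fun y => ?_
    simpa only [Function.comp_apply, proj_coe] using hq (proj y)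
  have h0 := hmax.fderiv_eq_zero
  have := h.eq_or_eq_neg (coe_ne_zero q) ha fun v => by
    have h1 := congrArg (fun A : R3 →L[ℝ] ℝ => A v) h0
    rw [fderiv_inner_apply (𝕜 := ℝ) (differentiableAt_const a) hd] at h1
    simpa using h1
  simpa only [Function.comp_apply, proj_coe] using this

/-- The degree-one homogeneous extension of the unit normal is a local diffeomorphism. -/
theorem IsConvexPair.exists_hasStrictFDerivAt (h : IsConvexPair R N) {x : R3} (hx : x ≠ 0) :
    ∃ A : R3 ≃L[ℝ] R3, HasStrictFDerivAt (fun y => ‖y‖ • N y) (A : R3 →L[ℝ] R3) x := by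
  have hN := h.contDiffAt_snd x hx
  have hF : ContDiffAt ℝ ∞ (fun y => ‖y‖ • N y) x := (contDiffAt_norm ℝ hx).smul hN
  have hs := hF.hasStrictFDerivAt (by simp)
  have hNd := differentiableAt_of_contDiffAt hN
  have hnd : DifferentiableAt ℝ (fun y : R3 => ‖y‖) x :=
    (contDiffAt_norm ℝ hx (n := 1)).differentiableAt one_ne_zero
  have hNN (v : R3) : ⟪N x, fderiv ℝ N x v⟫ = 0 := by
    have he : (fun y => ⟪N y, N y⟫) =ᶠ[nhds x] fun _ => 1 := by
      filter_upwards [isOpen_ne.mem_nhds hx] with y hy using h.unit y hy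
    have h1 := congrArg (fun A : R3 →L[ℝ] ℝ => A v) (he.fderiv_eq (𝕜 := ℝ))
    rw [fderiv_inner_apply (𝕜 := ℝ) hNd hNd, real_inner_comm (N x)] at h1
    simp at h1
    linarith
  have hsq (v : R3) : ‖x‖ * fderiv ℝ (fun y : R3 => ‖y‖) x v = ⟪x, v⟫ := by
    have he : (fun y : R3 => ‖y‖ * ‖y‖) = fun y => ⟪y, y⟫ := by
      ext y
      rw [real_inner_self_eq_norm_mul_norm]
    have h1 := congrArg (fun f => fderiv ℝ f x v) he
    simp only [fderiv_fun_mul hnd hnd] at h1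
    rw [fderiv_inner_apply (𝕜 := ℝ) differentiableAt_fun_id differentiableAt_fun_id] at h1
    simp [real_inner_comm] at h1
    linarith
  have hker : Function.Injective (fderiv ℝ (fun y => ‖y‖ • N y) x) := by
    rw [injective_iff_map_eq_zero]
    intro v hv
    rw [fderiv_fun_smul hnd hNd] at hv
    simp only [add_apply, smul_apply, ContinuousLinearMap.smulRight_apply] at hv
    have h1 := congrArg (fun z => ⟪N x, z⟫) hv
    simp only [inner_add_right, inner_smul_right, hNN, h.unit x hx, inner_zero_right, mul_zero,
      zero_add, mul_one] at h1
    rw [h1, zero_smul, add_zero] at hv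
    have h2 := (smul_eq_zero.mp hv).resolve_left (norm_ne_zero_iff.mpr hx)
    have h3 := hsq v
    rw [h1, mul_zero] at h3
    by_contra hv0
    have h4 := h.convex x hx v (by
      rintro t rfl
      rw [inner_smul_right, eq_comm, mul_eq_zero] at h3
      rcases h3 with rfl | h3
      · exact hv0 (zero_smul ℝ x)
      · exact hx (inner_self_eq_zero.mp h3))
    rw [h2, inner_zero_left] at h4
    exact lt_irrefl _ h4
  refine ⟨(LinearEquiv.ofInjectiveEndo
    (fderiv ℝ (fun y => ‖y‖ • N y) x : R3 →ₗ[ℝ] R3) hker).toContinuousLinearEquiv, ?_⟩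
  exact hs

theorem norm_of_inner_self {a : R3} (h : ⟪a, a⟫ = 1) : ‖a‖ = 1 := by
  rw [real_inner_self_eq_norm_sq] at h
  exact (pow_eq_one_iff_of_nonneg (norm_nonneg a) two_ne_zero).mp h

theorem IsConvexPair.unit_coe (h : IsConvexPair (r ∘ proj) (ν ∘ proj)) (p : S2) :
    ⟪ν p, ν p⟫ = 1 := by
  simpa only [Function.comp_apply, proj_coe] using h.unit p (coe_ne_zero p)

/-- The Gauss map of a strictly convex immersed sphere is injective. -/
theorem IsConvexPair.injective (h : IsConvexPair (r ∘ proj) (ν ∘ proj)) :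
    Function.Injective ν := by
  let n : S2 → S2 := fun p => ⟨ν p, by simp [norm_of_inner_self (h.unit_coe p)]⟩
  have hFp (p : S2) : ‖(p : R3)‖ • (ν ∘ proj) (p : R3) = ν p := by
    rw [norm_eq_of_mem_sphere, one_smul, Function.comp_apply, proj_coe]
  have hcont : Continuous n := by
    refine Continuous.subtype_mk (continuous_iff_continuousAt.mpr fun p => ?_) _
    have h1 : ContinuousAt (ν ∘ proj) (p : R3) :=
      (h.contDiffAt_snd p (coe_ne_zero p)).continuousAt
    have h2 := ContinuousAt.comp (f := ((↑) : S2 → R3)) (x := p) h1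
      continuous_subtype_val.continuousAt
    refine h2.congr (Filter.Eventually.of_forall fun q => ?_)
    simp only [Function.comp_apply, proj_coe]
  have hopen : IsOpenMap n := by
    rw [isOpenMap_iff_nhds_le]
    intro p W hW
    obtain ⟨A, hA⟩ := h.exists_hasStrictFDerivAt (coe_ne_zero p)
    have hmap := hA.map_nhds_eq_of_equiv
    have hproj : ContinuousAt proj (p : R3) := (contMDiffAt_proj (coe_ne_zero p)).continuousAt
    have hV : proj ⁻¹' (n ⁻¹' W) ∩ {0}ᶜ ∈ nhds (p : R3) := by
      refine Filter.inter_mem (hproj ?_) (isOpen_compl_singleton.mem_nhds (coe_ne_zero p))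
      rw [proj_coe]
      exact hW
    have himg := Filter.image_mem_map (m := fun y => ‖y‖ • (ν ∘ proj) y) hV
    rw [hmap, hFp] at himg
    have hpre : ((↑) : S2 → R3) ⁻¹' ((fun y => ‖y‖ • (ν ∘ proj) y) ''
        (proj ⁻¹' (n ⁻¹' W) ∩ {0}ᶜ)) ∈ nhds (n p) :=
      continuous_subtype_val.continuousAt himg
    refine Filter.mem_of_superset hpre ?_
    rintro q ⟨x, ⟨hxW, hx⟩, hxq⟩
    have hnx : ‖x‖ = 1 := by
      have := congrArg norm hxq
      simpa [norm_smul, norm_of_inner_self (h.unit_coe (proj x))] using this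
    have : n (proj x) = q := by
      ext1
      simpa [hnx] using hxq
    rw [← this]
    exact hxW
  have hloc : IsLocalHomeomorph n := by
    rw [isLocalHomeomorph_iff_isOpenEmbedding_restrict]
    intro p
    obtain ⟨A, hA⟩ := h.exists_hasStrictFDerivAt (coe_ne_zero p)
    have hs := (hA.toOpenPartialHomeomorph _).open_source
    refine ⟨((↑) : S2 → R3) ⁻¹' (hA.toOpenPartialHomeomorph _).source,
      (hs.preimage continuous_subtype_val).mem_nhds hA.mem_toOpenPartialHomeomorph_source, ?_⟩
    refine .of_continuous_injective_isOpenMap (hcont.comp continuous_subtype_val) ?_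
      (hopen.domRestrict (hs.preimage continuous_subtype_val))
    rintro ⟨a, ha⟩ ⟨b, hb⟩ hab
    have hab' : ν a = ν b := congrArg Subtype.val hab
    have := (hA.toOpenPartialHomeomorph _).injOn ha hb (by
      rw [hA.toOpenPartialHomeomorph_coe]
      exact (hFp a).trans (hab'.trans (hFp b).symm))
    exact Subtype.ext (Subtype.ext this)
  intro a b hab
  exact hloc.injective_sphere (Subtype.ext hab)

theorem exists_ne_and_ne_neg (hν : Function.Injective ν) (a : R3) :
    ∃ q, ν q ≠ a ∧ ν q ≠ -a := by
  by_contra! h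
  have hne {i j : Fin 3} (hij : i ≠ j) : ν ⟨EuclideanSpace.single i 1, by simp⟩ ≠
      ν ⟨EuclideanSpace.single j 1, by simp⟩ := by
    intro e
    have e1 := congrArg (fun z : S2 => (z : R3) i) (hν e)
    simp [hij] at e1
  have h' (q : S2) : ν q = a ∨ ν q = -a := or_iff_not_imp_left.mpr (h q)
  have h01 := hne (i := 0) (j := 1) (by decide)
  have h02 := hne (i := 0) (j := 2) (by decide)
  have h12 := hne (i := 1) (j := 2) (by decide)
  rcases h' ⟨EuclideanSpace.single 0 1, by simp⟩ with e0 | e0 <;>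
  rcases h' ⟨EuclideanSpace.single 1 1, by simp⟩ with e1 | e1 <;>
  rcases h' ⟨EuclideanSpace.single 2 1, by simp⟩ with e2 | e2 <;>
  simp_all

/-- A strictly convex immersed sphere lies on one side of its tangent planes, so that its support
function with respect to a suitable origin does not vanish. -/
theorem IsConvexPair.exists_support_ne_zero (h : IsConvexPair (r ∘ proj) (ν ∘ proj))
    (hr : Continuous r) (hν : Continuous ν) : ∃ o, ∀ x : R3, ⟪r (proj x) - o, ν (proj x)⟫ ≠ 0 := by
  have hinj := h.injective
  have hne : Nonempty S2 := ⟨proj 0⟩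
  have exists_max (a : R3) : ∃ q, ∀ p, ⟪a, r p⟫ ≤ ⟪a, r q⟫ := by
    obtain ⟨q, -, hq⟩ := isCompact_univ.exists_isMaxOn Set.univ_nonempty
      (f := fun p => ⟪a, r p⟫) (continuous_const.inner hr).continuousOn
    exact ⟨q, fun p => hq (Set.mem_univ p)⟩
  have hdisj (p : S2) (h1 : ∀ q, ⟪ν p, r q⟫ ≤ ⟪ν p, r p⟫)
      (h2 : ∀ q, ⟪ν p, r p⟫ ≤ ⟪ν p, r q⟫) : False := by
    obtain ⟨q, hq1, hq2⟩ := exists_ne_and_ne_neg hinj (ν p)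
    rcases h.normal_eq_of_isMax (h.unit_coe p) (q := q) (fun p' => (h1 p').trans (h2 q)) with e | e
    · exact hq1 e
    · exact hq2 e
  have hcover (p : S2) : (∀ q, ⟪ν p, r q⟫ ≤ ⟪ν p, r p⟫) ∨ ∀ q, ⟪ν p, r p⟫ ≤ ⟪ν p, r q⟫ := by
    obtain ⟨q, hq⟩ := exists_max (ν p)
    obtain ⟨q', hq'⟩ := exists_max (-ν p)
    have hu := h.unit_coe p
    have hu' : ⟪-ν p, -ν p⟫ = 1 := by rw [inner_neg_neg, hu]
    simp only [inner_neg_left, neg_le_neg_iff] at hq'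
    rcases h.normal_eq_of_isMax hu hq with e | e
    · left
      rwa [hinj e] at hq
    · rcases h.normal_eq_of_isMax hu' (q := q') (by simpa using hq') with e' | e'
      · have : q = q' := hinj (e.trans e'.symm)
        subst this
        exact Or.inl fun p' => (hq p').trans (hq' p)
      · right
        rw [neg_neg] at e'
        rwa [hinj e'] at hq'
  have hside : (∀ p q, ⟪ν p, r q⟫ ≤ ⟪ν p, r p⟫) ∨ ∀ p q, ⟪ν p, r p⟫ ≤ ⟪ν p, r q⟫ := by
    have hconn : IsPreconnected (Set.univ : Set S2) := by
      simpa using isPreconnected_compl_countable_sphere Set.countable_empty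
    have hcl1 : IsClosed {p : S2 | ∀ q, ⟪ν p, r q⟫ ≤ ⟪ν p, r p⟫} := by
      simp only [Set.ofPred_forall]
      exact isClosed_iInter fun q => isClosed_le (hν.inner continuous_const) (hν.inner hr)
    have hcl2 : IsClosed {p : S2 | ∀ q, ⟪ν p, r p⟫ ≤ ⟪ν p, r q⟫} := by
      simp only [Set.ofPred_forall]
      exact isClosed_iInter fun q => isClosed_le (hν.inner hr) (hν.inner continuous_const)
    rcases isPreconnected_iff_subset_of_disjoint_closed.mp hconn _ _ hcl1 hcl2
      (fun p _ => hcover p) (by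
        rw [Set.univ_inter]
        ext p
        simpa using fun h1 => by_contra fun h2 => hdisj p h1 (by simpa using h2)) with h1 | h1
    · exact Or.inl fun p => h1 (Set.mem_univ p)
    · exact Or.inr fun p => h1 (Set.mem_univ p)
  let q₁ : S2 := proj 0
  obtain ⟨q₂, hq₂, hq₂'⟩ := exists_ne_and_ne_neg hinj (ν q₁)
  refine ⟨(2⁻¹ : ℝ) • (r q₁ + r q₂), fun x hx => ?_⟩
  set p := proj x
  rw [inner_sub_left, real_inner_smul_left, inner_add_left, real_inner_comm, real_inner_comm _ (r q₁),
    real_inner_comm _ (r q₂)] at hx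
  have hu := h.unit_coe p
  have hpar : (ν q₁ = ν p ∨ ν q₁ = -ν p) ∧ (ν q₂ = ν p ∨ ν q₂ = -ν p) := by
    rcases hside with hs | hs
    · have h1 := hs p q₁
      have h2 := hs p q₂
      exact ⟨h.normal_eq_of_isMax hu fun q => (hs p q).trans (by linarith),
        h.normal_eq_of_isMax hu fun q => (hs p q).trans (by linarith)⟩
    · have h1 := hs p q₁
      have h2 := hs p q₂
      have hu' : ⟪-ν p, -ν p⟫ = 1 := by rw [inner_neg_neg, hu]
      have e1 := h.normal_eq_of_isMax hu' (q := q₁) fun q => by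
        rw [inner_neg_left, inner_neg_left]
        linarith [hs p q]
      have e2 := h.normal_eq_of_isMax hu' (q := q₂) fun q => by
        rw [inner_neg_left, inner_neg_left]
        linarith [hs p q]
      rw [neg_neg] at e1 e2
      exact ⟨e1.symm, e2.symm⟩
  rcases hpar with ⟨e1 | e1, e2 | e2⟩ <;> simp_all

variable {r ν τ : S2 → R3}

/-- The trivial deformation with rotation vector `(c 0, c 1, c 2)` and translation vector
`(c 3, c 4, c 5)`. -/
noncomputable def trivialField (r : S2 → R3) (c : Fin 6 → ℝ) (p : S2) : R3 :=
  cross !₂[c 0, c 1, c 2] (r p) + !₂[c 3, c 4, c 5]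

theorem trivialField_eq_sum (c : Fin 6 → ℝ) :
    trivialField r c = fun p => ∑ i, c i • trivialField r (Pi.single i 1) p := by
  ext1 p
  apply ext_coord <;> simp [trivialField, Fin.sum_univ_six] <;> ring

theorem isInfinitesimalDeformation_cross_add
    (hr : ContMDiff (𝓡 2) 𝓘(ℝ, R3) ∞ r) (A B : R3) :
    IsInfinitesimalDeformation r fun p => cross A (r p) + B := by
  have hL : ContDiff ℝ ∞ fun y : R3 => cross A y + B := (cross A).contDiff.add contDiff_const
  refine ⟨hL.contMDiff.comp hr, fun p v w => ?_⟩
  have hd : mfderiv (𝓡 2) 𝓘(ℝ, R3) (fun p => cross A (r p) + B) p =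
      (cross A).comp (mfderiv (𝓡 2) 𝓘(ℝ, R3) r p) := by
    have h1 := mfderiv_comp p (g := fun y : R3 => cross A y + B) (f := r)
      (hL.contMDiff.mdifferentiableAt (by simp)) (hr.mdifferentiableAt (by simp))
    rw [mfderiv_eq_fderiv, fderiv_add_const, ContinuousLinearMap.fderiv] at h1
    exact h1
  rw [hd]
  have key (X Y : R3) : ⟪X, cross A Y⟫ + ⟪Y, cross A X⟫ = 0 := by
    simp only [inner_coord, cross_zero, cross_one, cross_two]
    ring
  exact key _ _

theorem isConvexPair_comp_proj (hr : ContMDiff (𝓡 2) 𝓘(ℝ, R3) ∞ r)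
    (hν : ContMDiff (𝓡 2) 𝓘(ℝ, R3) ∞ ν) (hνunit : ∀ p, ‖ν p‖ = 1)
    (hνnormal : ∀ p (v : EuclideanSpace ℝ (Fin 2)), ⟪ν p, mfderiv (𝓡 2) 𝓘(ℝ, R3) r p v⟫ = 0)
    (hconv : ∀ p (v : EuclideanSpace ℝ (Fin 2)), v ≠ 0 →
      0 < ⟪mfderiv (𝓡 2) 𝓘(ℝ, R3) ν p v, mfderiv (𝓡 2) 𝓘(ℝ, R3) r p v⟫) :
    IsConvexPair (r ∘ proj) (ν ∘ proj) where
  contDiffAt_fst _ hx := contDiffAt_comp_proj hr hx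
  contDiffAt_snd _ hx := contDiffAt_comp_proj hν hx
  radial_fst _ hx := fderiv_comp_proj_self hr hx
  normal x hx v := by
    rw [fderiv_comp_proj hr hx]
    exact hνnormal _ _
  unit x _ := by
    rw [real_inner_self_eq_norm_sq, Function.comp_apply, hνunit, one_pow]
  convex x hx v hv := by
    rw [fderiv_comp_proj hr hx, fderiv_comp_proj hν hx]
    exact hconv _ _ (mfderiv_proj_ne_zero hx hv)

theorem isRadialDeformation_comp_proj (hr : ContMDiff (𝓡 2) 𝓘(ℝ, R3) ∞ r)
    (hτ : IsInfinitesimalDeformation r τ) : IsRadialDeformation (r ∘ proj) (τ ∘ proj) where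
  contDiffAt _ hx := contDiffAt_comp_proj hτ.1 hx
  radial _ hx := fderiv_comp_proj_self hτ.1 hx
  skew x hx v w := by
    simp only [fderiv_comp_proj hr hx, fderiv_comp_proj hτ.1 hx]
    exact hτ.2 _ _ _

/-- A Killing field vanishing along an immersed surface is zero. -/
theorem IsConvexPair.eq_zero_of_cross_add_eq_zero {R N : R3 → R3} (h : IsConvexPair R N)
    {A B : R3} (hAB : ∀ x, cross A (R x) + B = 0) : A = 0 ∧ B = 0 := by
  have hx := coe_ne_zero (proj 0)
  have hd := differentiableAt_of_contDiffAt (h.contDiffAt_fst _ hx)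
  have hA (v : R3) : cross A (fderiv ℝ R (proj 0 : R3) v) = 0 := by
    have h1 := ((cross A).hasFDerivAt.comp _ hd.hasFDerivAt).add_const B
    have h2 : (fun y => (cross A ∘ R) y + B) = fun _ => 0 := funext hAB
    rw [h2] at h1
    exact congrArg (fun A : R3 →L[ℝ] R3 => A v) (h1.unique (hasFDerivAt_const 0 _))
  obtain ⟨v, w, hvw⟩ := exists_triple_ne_zero hx
  have hA0 := eq_zero_of_cross_eq_zero (h.cross_fderiv_ne_zero hx hvw) (hA v) (hA w)
  refine ⟨hA0, ?_⟩
  simpa [hA0] using hAB 0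

theorem IsConvexPair.trivialField_injective (h : IsConvexPair (r ∘ proj) (ν ∘ proj)) :
    Function.Injective (trivialField r) := by
  intro c c' hcc
  have key := h.eq_zero_of_cross_add_eq_zero
    (A := !₂[c 0, c 1, c 2] - !₂[c' 0, c' 1, c' 2])
    (B := !₂[c 3, c 4, c 5] - !₂[c' 3, c' 4, c' 5]) fun x => by
      have := congrFun hcc (proj x)
      simp only [trivialField] at this
      rw [map_sub, sub_apply, Function.comp_apply, sub_add_sub_comm, this, sub_self]
  simp only [sub_eq_zero] at key
  have e1 (i : Fin 3) := congrArg (fun z : R3 => z i) key.1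
  have e2 (i : Fin 3) := congrArg (fun z : R3 => z i) key.2
  ext i
  fin_cases i
  · exact e1 0
  · exact e1 1
  · exact e1 2
  · exact e2 0
  · exact e2 1
  · exact e2 2

end InfinitesimalRigidity

open InfinitesimalRigidity

/-- The space of infinitesimal isometric deformations of a smooth strictly convex
immersion `r : S² → ℝ³` (with smooth unit normal `ν`) has dimension exactly `6`:
there are six solutions `b 0, …, b 5` such that every solution is a unique linear
combination of them. -/
theorem infinitesimal_deformation_space_six_dimensional
    (r ν : (Metric.sphere (0 : EuclideanSpace ℝ (Fin 3)) 1) → EuclideanSpace ℝ (Fin 3))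
    (hr : ContMDiff (𝓡 2) 𝓘(ℝ, EuclideanSpace ℝ (Fin 3)) (⊤ : ℕ∞) r)
    (himm : ∀ p, Function.Injective
      (mfderiv (𝓡 2) 𝓘(ℝ, EuclideanSpace ℝ (Fin 3)) r p))
    (hν : ContMDiff (𝓡 2) 𝓘(ℝ, EuclideanSpace ℝ (Fin 3)) (⊤ : ℕ∞) ν)
    (hνunit : ∀ p, ‖ν p‖ = 1)
    (hνnormal : ∀ p (v : EuclideanSpace ℝ (Fin 2)),
      ⟪ν p, mfderiv (𝓡 2) 𝓘(ℝ, EuclideanSpace ℝ (Fin 3)) r p v⟫ = 0)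
    (hconv : ∀ p (v : EuclideanSpace ℝ (Fin 2)), v ≠ 0 →
      0 < ⟪mfderiv (𝓡 2) 𝓘(ℝ, EuclideanSpace ℝ (Fin 3)) ν p v,
            mfderiv (𝓡 2) 𝓘(ℝ, EuclideanSpace ℝ (Fin 3)) r p v⟫) :
    ∃ b : Fin 6 →
        ((Metric.sphere (0 : EuclideanSpace ℝ (Fin 3)) 1) → EuclideanSpace ℝ (Fin 3)),
      (∀ i, IsInfinitesimalDeformation r (b i)) ∧
      ∀ τ, IsInfinitesimalDeformation r τ →
        ∃! c : Fin 6 → ℝ, τ = fun p => ∑ i, c i • b i p := by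
  have h := isConvexPair_comp_proj hr hν hνunit hνnormal hconv
  obtain ⟨o, ho⟩ := h.exists_support_ne_zero hr.continuous hν.continuous
  refine ⟨fun i => trivialField r (Pi.single i 1),
    fun i => isInfinitesimalDeformation_cross_add hr _ _, fun τ hτ => ?_⟩
  simp only [← trivialField_eq_sum]
  obtain ⟨A, B, hAB⟩ := h.exists_eq_cross_add o (fun x _ => ho x)
    (isRadialDeformation_comp_proj hr hτ)
  have hA : !₂[A 0, A 1, A 2] = A := ext_coord rfl rfl rfl
  have hB : !₂[B 0, B 1, B 2] = B := ext_coord rfl rfl rfl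
  have hc : τ = trivialField r ![A 0, A 1, A 2, B 0, B 1, B 2] := by
    ext1 p
    have := hAB p (coe_ne_zero p)
    simp only [Function.comp_apply, proj_coe] at this
    rw [this]
    change _ = cross !₂[A 0, A 1, A 2] (r p) + !₂[B 0, B 1, B 2]
    rw [hA, hB]
  exact ⟨_, hc, fun c' hc' => h.trivialField_injective (hc'.symm.trans hc)⟩
end

section
/- Let m > 0 and C ≥ 0, and let r : [0, ∞) → ℝ be differentiable with r(0) > m, r(0)² > C, and r′(t) = √( (1 − m/r(t))·(1 − C/r(t)²) ) for all t ≥ 0. Then r is strictly increasing on [0, ∞) and r(t) → ∞ as t → ∞. -/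
/-- The speed `√((1 − m/x)(1 − C/x²))` is nondecreasing in the radius `x`
beyond a radius `a` at which both factors are positive. -/
lemma sqrt_schwarzschild_speed_le {m C a x : ℝ} (hm : 0 < m) (hC : 0 ≤ C)
    (ha : m < a) (ha' : C < a ^ 2) (hx : a ≤ x) :
    Real.sqrt ((1 - m / a) * (1 - C / a ^ 2)) ≤
      Real.sqrt ((1 - m / x) * (1 - C / x ^ 2)) := by
  have ha0 : 0 < a := hm.trans ha
  have h₁ : m / a < 1 := (div_lt_one ha0).2 ha
  have h₂ : C / a ^ 2 < 1 := (div_lt_one (by positivity)).2 ha'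
  have h₃ : m / x ≤ m / a := by gcongr
  have h₄ : C / x ^ 2 ≤ C / a ^ 2 := by gcongr
  exact Real.sqrt_le_sqrt
    (mul_le_mul (by linarith) (by linarith) (by linarith) (by linarith))

lemma sqrt_schwarzschild_speed_pos {m C a : ℝ} (hm : 0 < m)
    (ha : m < a) (ha' : C < a ^ 2) :
    0 < Real.sqrt ((1 - m / a) * (1 - C / a ^ 2)) := by
  have ha0 : 0 < a := hm.trans ha
  have h₁ : m / a < 1 := (div_lt_one ha0).2 ha
  have h₂ : C / a ^ 2 < 1 := (div_lt_one (by positivity)).2 ha'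
  exact Real.sqrt_pos.2 (mul_pos (by linarith) (by linarith))

/-- The radius along the geodesic flow in the Schwarzschild manifold:
if `r(0) > m > 0`, `r(0)² > C ≥ 0` and `r′(t) = √((1 − m/r)(1 − C/r²))` for `t ≥ 0`,
then `r` is strictly increasing on `[0, ∞)` and tends to infinity. -/
theorem schwarzschild_radius_increasing_to_infinity
    (m C : ℝ) (hm : 0 < m) (hC : 0 ≤ C) (r : ℝ → ℝ)
    (h0 : m < r 0) (h0' : C < (r 0) ^ 2)
    (hderiv : ∀ t, 0 ≤ t →
      HasDerivAt r (Real.sqrt ((1 - m / r t) * (1 - C / (r t) ^ 2))) t) :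
    StrictMonoOn r (Set.Ici (0 : ℝ)) ∧
    Filter.Tendsto r Filter.atTop Filter.atTop := by
  have hcont : ContinuousOn r (Set.Ici 0) := fun t ht =>
    (hderiv t ht).continuousAt.continuousWithinAt
  have hdiff : DifferentiableOn ℝ r (interior (Set.Ici 0)) := fun t ht =>
    (hderiv t (interior_subset ht)).differentiableAt.differentiableWithinAt
  have hmono : MonotoneOn r (Set.Ici 0) :=
    monotoneOn_of_deriv_nonneg (convex_Ici 0) hcont hdiff fun t ht => by
      rw [(hderiv t (interior_subset ht)).deriv]
      exact Real.sqrt_nonneg _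
  have hpos := sqrt_schwarzschild_speed_pos hm h0 h0'
  have hspeed : ∀ t ∈ interior (Set.Ici (0 : ℝ)),
      Real.sqrt ((1 - m / r 0) * (1 - C / r 0 ^ 2)) ≤ deriv r t := fun t ht => by
    have ht' : t ∈ Set.Ici (0 : ℝ) := interior_subset ht
    rw [(hderiv t ht').deriv]
    exact sqrt_schwarzschild_speed_le hm hC h0 h0' (hmono Set.self_mem_Ici ht' ht')
  refine ⟨strictMonoOn_of_deriv_pos (convex_Ici 0) hcont fun t ht =>
    hpos.trans_le (hspeed t ht), ?_⟩
  refine Filter.tendsto_atTop_mono' _ ?_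
    (Filter.tendsto_atTop_add_const_right _ (r 0) (Filter.tendsto_id.const_mul_atTop hpos))
  filter_upwards [Filter.eventually_ge_atTop 0] with t ht
  have hgrowth := (convex_Ici 0).mul_sub_le_image_sub_of_le_deriv hcont hdiff hspeed
    0 Set.self_mem_Ici t ht ht
  simp only [id, sub_zero] at hgrowth ⊢
  linarith
end
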